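/- Every triconnected (3-connected) planar graph of maximum degree 4 is subhamiltonian, i.e., it is a spanning subgraph of a planar Hamiltonian graph. -/

import Mathlib

open Set

universe u

/-- A topological embedding of a simple graph in the plane: vertices are mapped to
distinct points and every edge is realized by a simple arc joining the images of its
endpoints, such that two arcs of distinct edges meet only in common endpoints and no
vertex point lies in the interior of an arc. -/
structure PlaneEmbedding {V : Type u} (G : SimpleGraph V) where
  pos : V → ℝ × ℝ
  pos_inj : Function.Injective pos
  arc : ∀ ⦃u v : V⦄, G.Adj u v → Set (ℝ × ℝ)
  arc_symm : ∀ ⦃u v : V⦄ (h : G.Adj u v), arc h.symm = arc h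
  arc_curve : ∀ ⦃u v : V⦄ (h : G.Adj u v), ∃ f : ℝ → ℝ × ℝ,
    ContinuousOn f (Set.Icc 0 1) ∧ Set.InjOn f (Set.Icc 0 1) ∧
    f 0 = pos u ∧ f 1 = pos v ∧ f '' Set.Icc 0 1 = arc h
  arc_inter : ∀ ⦃u v w z : V⦄ (h₁ : G.Adj u v) (h₂ : G.Adj w z),
    s(u, v) ≠ s(w, z) → arc h₁ ∩ arc h₂ ⊆ ({pos u, pos v} ∩ {pos w, pos z} : Set (ℝ × ℝ))
  pos_arc : ∀ ⦃u v : V⦄ (h : G.Adj u v) (w : V), pos w ∈ arc h → w = u ∨ w = v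

/-- A graph is planar if it admits a topological embedding in the plane. -/
def SimpleGraph.IsPlanar {V : Type u} (G : SimpleGraph V) : Prop :=
  Nonempty (PlaneEmbedding G)

/-- The point set covered by a plane embedding. -/
def PlaneEmbedding.drawing {V : Type u} {G : SimpleGraph V} (E : PlaneEmbedding G) :
    Set (ℝ × ℝ) :=
  Set.range E.pos ∪ ⋃ (u : V) (v : V) (h : G.Adj u v), E.arc h

/-- A face of a plane embedding is a connected component of the complement of the drawing. -/
def PlaneEmbedding.IsFace {V : Type u} {G : SimpleGraph V} (E : PlaneEmbedding G)
    (F : Set (ℝ × ℝ)) : Prop :=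
  ∃ p, p ∉ E.drawing ∧ F = connectedComponentIn E.drawingᶜ p

/-- A vertex is incident to a face if its point lies on the boundary of the face. -/
def PlaneEmbedding.VertexOnFace {V : Type u} {G : SimpleGraph V} (E : PlaneEmbedding G)
    (v : V) (F : Set (ℝ × ℝ)) : Prop :=
  E.pos v ∈ closure F

/-- Maximum degree at most `d`. -/
def SimpleGraph.MaxDegreeLE {V : Type u} (G : SimpleGraph V) (d : ℕ) : Prop :=
  ∀ v : V, (G.neighborSet v).ncard ≤ d

/-- A graph is triconnected (3-connected) if it has more than three vertices, is
connected, and stays connected after removing any two vertices. -/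
def SimpleGraph.IsTriconnected {V : Type u} (G : SimpleGraph V) : Prop :=
  3 < Nat.card V ∧ G.Connected ∧
    ∀ u v : V, (G.induce {w : V | w ≠ u ∧ w ≠ v}).Connected

/-- A graph is biconnected (2-connected) if it has more than two vertices, is
connected, and stays connected after removing any single vertex. -/
def SimpleGraph.IsBiconnected {V : Type u} (G : SimpleGraph V) : Prop :=
  2 < Nat.card V ∧ G.Connected ∧ ∀ u : V, (G.induce {w : V | w ≠ u}).Connected

/-- A graph is subhamiltonian if it is a spanning subgraph of a planar hamiltonian graph. -/
def SimpleGraph.IsSubhamiltonian {V : Type u} [Fintype V] (G : SimpleGraph V) : Prop :=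
  ∃ H : SimpleGraph V, G ≤ H ∧ H.IsPlanar ∧ (letI := Classical.decEq V; H.IsHamiltonian)

/-- The graph consisting of the edges of the cyclic vertex sequence `σ`. -/
def cyclicSuccGraph {W : Type u} (σ : ZMod (Nat.card W) ≃ W) : SimpleGraph W :=
  SimpleGraph.fromRel fun u v => ∃ i, u = σ i ∧ v = σ (i + 1)

/-- The cyclic ordering `σ` of all vertices of `G` is a subhamiltonian cycle for `G` if
adding the edges between consecutive vertices of `σ` keeps the graph planar. -/
def SimpleGraph.IsSubhamiltonianCycle {W : Type u} (G : SimpleGraph W)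
    (σ : ZMod (Nat.card W) ≃ W) : Prop :=
  SimpleGraph.IsPlanar (G ⊔ cyclicSuccGraph σ)

/-- The edges (pairs of consecutive vertices) of the cyclic sequence `σ`. -/
def cycleEdges {W : Type u} (σ : ZMod (Nat.card W) ≃ W) : Set (Sym2 W) :=
  {e | ∃ i, e = s(σ i, σ (i + 1))}

/-- The subhamiltonian cycle `σ` crosses the face `F` at position `i` if the two
consecutive vertices `σ i` and `σ (i+1)` are both incident to `F` but not adjacent. -/
def CrossesFaceAt {V : Type u} {G : SimpleGraph V} (E : PlaneEmbedding G)
    (σ : ZMod (Nat.card V) ≃ V) (F : Set (ℝ × ℝ)) (i : ZMod (Nat.card V)) : Prop :=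
  E.VertexOnFace (σ i) F ∧ E.VertexOnFace (σ (i + 1)) F ∧ ¬ G.Adj (σ i) (σ (i + 1))

/-- A separating triangle: a triangle whose removal disconnects the graph. -/
def SimpleGraph.IsSepTriangle {V : Type u} (G : SimpleGraph V) (a b c : V) : Prop :=
  G.Adj a b ∧ G.Adj b c ∧ G.Adj a c ∧
    ¬ (G.induce {v : V | v ≠ a ∧ v ≠ b ∧ v ≠ c}).Connected

section Triangle

variable {V : Type u} {G : SimpleGraph V} (E : PlaneEmbedding G) {a b c : V}

/-- The Jordan curve formed by the drawing of the triangle `a b c`. -/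
def triangleDrawing (hab : G.Adj a b) (hbc : G.Adj b c) (hac : G.Adj a c) :
    Set (ℝ × ℝ) :=
  E.arc hab ∪ E.arc hbc ∪ E.arc hac

/-- The vertices strictly inside the triangle `a b c` (bounded side of the Jordan curve). -/
def insideTriangle (hab : G.Adj a b) (hbc : G.Adj b c) (hac : G.Adj a c) : Set V :=
  {v | v ≠ a ∧ v ≠ b ∧ v ≠ c ∧
    Bornology.IsBounded
      (connectedComponentIn (triangleDrawing E hab hbc hac)ᶜ (E.pos v))}

/-- The vertices strictly outside the triangle `a b c` (unbounded side of the Jordan curve). -/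
def outsideTriangle (hab : G.Adj a b) (hbc : G.Adj b c) (hac : G.Adj a c) : Set V :=
  {v | v ≠ a ∧ v ≠ b ∧ v ≠ c ∧
    ¬ Bornology.IsBounded
      (connectedComponentIn (triangleDrawing E hab hbc hac)ᶜ (E.pos v))}

end Triangle

/-- A two-page book drawing (spine coordinates `p`, page signs `s`) gives a plane embedding. -/
theorem planar_of_book {V : Type u} (H : SimpleGraph V) (p : V → ℝ)
    (hp : Function.Injective p) (s : V → V → ℝ) (hs : ∀ u v, s u v = s v u)
    (hs1 : ∀ u v, s u v = 1 ∨ s u v = -1)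
    (hc : ∀ ⦃u v w z : V⦄, H.Adj u v → H.Adj w z → s u v = s w z →
      ¬ (p u < p w ∧ p w < p v ∧ p v < p z)) : H.IsPlanar := by
  have key : ∀ ⦃u v w z : V⦄, H.Adj u v → H.Adj w z → s(u, v) ≠ s(w, z) → p u < p v →
      p w < p z → ∀ x : ℝ, p u ≤ x → x ≤ p v → p w ≤ x → x ≤ p z →
      s u v * ((x - p u) * (p v - x)) = s w z * ((x - p w) * (p z - x)) →
      (x = p u ∨ x = p v) ∧ (x = p w ∨ x = p z) := by
    intro u v w z h1 h2 hne huv hwz x a1 a2 a3 a4 heq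
    have n1 : 0 ≤ (x - p u) * (p v - x) := mul_nonneg (by linarith) (by linarith)
    have n2 : 0 ≤ (x - p w) * (p z - x) := mul_nonneg (by linarith) (by linarith)
    have zero : (x - p u) * (p v - x) = 0 → (x - p w) * (p z - x) = 0 →
        (x = p u ∨ x = p v) ∧ (x = p w ∨ x = p z) := by
      intro e1 e2
      rcases mul_eq_zero.1 e1 with e | e <;> rcases mul_eq_zero.1 e2 with e' | e' <;>
        constructor <;> first | (left; linarith) | (right; linarith)
    by_cases hss : s u v = s w z
    · have hne0 : s w z ≠ 0 := by rcases hs1 w z with h | h <;> rw [h] <;> norm_num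
      have heq' : (x - p u) * (p v - x) = (x - p w) * (p z - x) := by
        rw [hss] at heq; exact mul_left_cancel₀ hne0 heq
      have c1 := hc h1 h2 hss
      have c2 := hc h2 h1 hss.symm
      apply zero
      all_goals
        by_contra h0
        have hpos : 0 < (x - p u) * (p v - x) := by
          rcases n1.lt_or_eq with h | h
          · exact h
          · exfalso; first | exact h0 h.symm | exact h0 (by rw [← heq']; exact h.symm)
        have hpos2 : 0 < (x - p w) * (p z - x) := by rw [← heq']; exact hpos
        have b1 : p u < x := by
          rcases a1.lt_or_eq with h | h
          · exact h
          · rw [h] at hpos; simp at hpos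
        have b2 : x < p v := by
          rcases a2.lt_or_eq with h | h
          · exact h
          · rw [h] at hpos; simp at hpos
        have b3 : p w < x := by
          rcases a3.lt_or_eq with h | h
          · exact h
          · rw [h] at hpos2; simp at hpos2
        have b4 : x < p z := by
          rcases a4.lt_or_eq with h | h
          · exact h
          · rw [h] at hpos2; simp at hpos2
        have hlt : ¬ (p u = p w ∧ p v = p z) := by
          rintro ⟨e1, e2⟩
          exact hne (by rw [hp e1, hp e2])
        rcases lt_trichotomy (p u) (p w) with h | h | h
        · have : p z ≤ p v := by
            by_contra hh; exact c1 ⟨h, by linarith, by linarith⟩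
          nlinarith [mul_pos (sub_pos.2 h) (sub_pos.2 b2), mul_nonneg (sub_nonneg.2 this) (sub_nonneg.2 b3.le)]
        · rcases lt_trichotomy (p v) (p z) with h' | h' | h'
          · rw [h] at heq'; nlinarith [mul_pos (sub_pos.2 b3) (sub_pos.2 h')]
          · exact hlt ⟨h, h'⟩
          · rw [h] at heq'; nlinarith [mul_pos (sub_pos.2 b3) (sub_pos.2 h')]
        · have : p v ≤ p z := by
            by_contra hh; exact c2 ⟨h, by linarith, by linarith⟩
          nlinarith [mul_pos (sub_pos.2 h) (sub_pos.2 b4), mul_nonneg (sub_nonneg.2 this) (sub_nonneg.2 b1.le)]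
    · rcases hs1 u v with h | h <;> rcases hs1 w z with h' | h' <;> rw [h, h'] at heq hss
      · exact absurd rfl hss
      · exact zero (by linarith) (by linarith)
      · exact zero (by linarith) (by linarith)
      · exact absurd rfl hss
  let A : V → V → Set (ℝ × ℝ) := fun u v =>
    {q | min (p u) (p v) ≤ q.1 ∧ q.1 ≤ max (p u) (p v) ∧
      q.2 = s u v * ((q.1 - p u) * (p v - q.1))}
  have Asymm : ∀ u v, A v u = A u v := by
    intro u v; ext q
    simp only [A, Set.mem_setOf_eq, min_comm (p v), max_comm (p v), hs v u]
    rw [show (q.1 - p v) * (p u - q.1) = (q.1 - p u) * (p v - q.1) by ring]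
  have inter : ∀ ⦃u v w z : V⦄, H.Adj u v → H.Adj w z → s(u, v) ≠ s(w, z) →
      A u v ∩ A w z ⊆ ({(p u, 0), (p v, 0)} ∩ {(p w, 0), (p z, 0)} : Set (ℝ × ℝ)) := by
    have base : ∀ ⦃u v w z : V⦄, H.Adj u v → H.Adj w z → s(u, v) ≠ s(w, z) →
        p u < p v → p w < p z →
        A u v ∩ A w z ⊆ ({(p u, 0), (p v, 0)} ∩ {(p w, 0), (p z, 0)} : Set (ℝ × ℝ)) := by
      rintro u v w z h1 h2 hne huv hwz ⟨x, y⟩ ⟨⟨a1, a2, a3⟩, b1, b2, b3⟩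
      simp only [min_eq_left huv.le, max_eq_right huv.le, min_eq_left hwz.le,
        max_eq_right hwz.le] at a1 a2 a3 b1 b2 b3
      obtain ⟨k1, k2⟩ := key h1 h2 hne huv hwz x a1 a2 b1 b2 (a3.symm.trans b3)
      have hy : y = 0 := by rcases k1 with k | k <;> rw [a3, k] <;> ring
      subst hy
      simp only [Set.mem_inter_iff, Set.mem_insert_iff, Set.mem_singleton_iff, Prod.mk.injEq,
        and_true]
      exact ⟨k1, k2⟩
    intro u v w z h1 h2 hne
    have n1 : p u ≠ p v := fun h => h1.ne (hp h)
    have n2 : p w ≠ p z := fun h => h2.ne (hp h)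
    rcases n1.lt_or_gt with a | a <;> rcases n2.lt_or_gt with b | b
    · exact base h1 h2 hne a b
    · have := base h1 h2.symm (by rwa [Sym2.eq_swap (a := z)]) a b
      rwa [Asymm w z, Set.pair_comm (p z, (0:ℝ))] at this
    · have := base h1.symm h2 (by rwa [Sym2.eq_swap (a := v)]) a b
      rwa [Asymm u v, Set.pair_comm (p v, (0:ℝ))] at this
    · have := base h1.symm h2.symm
        (by rwa [Sym2.eq_swap (a := v), Sym2.eq_swap (a := z)]) a b
      rwa [Asymm u v, Asymm w z, Set.pair_comm (p v, (0:ℝ)), Set.pair_comm (p z, (0:ℝ))] at this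
  refine ⟨⟨fun v => (p v, 0), ?_, fun u v _ => A u v, ?_, ?_, ?_, ?_⟩⟩
  · intro u v h; exact hp (congrArg Prod.fst h)
  · intro u v h; exact Asymm u v
  · intro u v h
    have n1 : p u ≠ p v := fun e => h.ne (hp e)
    refine ⟨fun t => (p u + t * (p v - p u),
      s u v * ((t * (p v - p u)) * ((1 - t) * (p v - p u)))), by fun_prop, ?_, ?_, ?_, ?_⟩
    · intro a _ b _ hab
      have := congrArg Prod.fst hab
      simp only [add_right_inj] at this
      exact mul_right_cancel₀ (sub_ne_zero.2 n1.symm) this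
    · simp
    · simp
    · have hd : p v - p u ≠ 0 := sub_ne_zero.2 n1.symm
      ext ⟨x, y⟩
      simp only [Set.mem_image, Set.mem_Icc, Prod.mk.injEq, A, Set.mem_setOf_eq]
      constructor
      · rintro ⟨t, ⟨t0, t1⟩, rfl, rfl⟩
        refine ⟨?_, ?_, by ring⟩
        · rcases n1.lt_or_gt with a | a
          · rw [min_eq_left a.le]; nlinarith
          · rw [min_eq_right a.le]; nlinarith
        · rcases n1.lt_or_gt with a | a
          · rw [max_eq_right a.le]; nlinarith
          · rw [max_eq_left a.le]; nlinarith
      · rintro ⟨h1, h2, rfl⟩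
        have ht : (x - p u) / (p v - p u) * (p v - p u) = x - p u := by field_simp
        refine ⟨(x - p u) / (p v - p u), ?_, by rw [ht]; ring, ?_⟩
        · rcases n1.lt_or_gt with a | a
          · rw [min_eq_left a.le] at h1; rw [max_eq_right a.le] at h2
            exact ⟨div_nonneg (by linarith) (by linarith),
              (div_le_one (by linarith)).2 (by linarith)⟩
          · rw [min_eq_right a.le] at h1; rw [max_eq_left a.le] at h2
            exact ⟨div_nonneg_of_nonpos (by linarith) (by linarith),
              (div_le_one_of_neg (by linarith)).2 (by linarith)⟩
        · rw [sub_mul, ht]; ring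
  · intro u v w z h1 h2 hne; exact inter h1 h2 hne
  · rintro u v h w ⟨-, -, h0⟩
    rcases mul_eq_zero.1 h0.symm with e | e
    · rcases hs1 u v with e' | e' <;> rw [e'] at e <;> norm_num at e
    · rcases mul_eq_zero.1 e with e | e
      · left; exact hp (by simpa [sub_eq_zero] using e)
      · right; exact hp (by simpa [sub_eq_zero, eq_comm] using e)


/-- Strict cyclic order. -/
def cyc {α : Type*} [LT α] (a b c : α) : Prop :=
  (a < b ∧ b < c) ∨ (b < c ∧ c < a) ∨ (c < a ∧ a < b)

/-- A rotation system with sides of cycles. -/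
structure Rot {V : Type u} (G : SimpleGraph V) (ang : V → V → ℝ) : Prop where
  inj : ∀ v x y, G.Adj v x → G.Adj v y → ang v x = ang v y → x = y
  lo : ∀ v x, -4 < ang v x
  hi : ∀ v x, ang v x < 4
  side : ∀ (n : ℕ) (c : ZMod n → V), 3 ≤ n → Function.Injective c →
    (∀ i, G.Adj (c i) (c (i + 1))) → ∃ S : V → V → Prop,
      (∀ u v, G.Adj u v → (∀ i, s(u, v) ≠ s(c i, c (i + 1))) → (S u v ↔ S v u)) ∧
      (∀ w, (∀ i, w ≠ c i) → ∀ x y, G.Adj w x → G.Adj w y → (S w x ↔ S w y)) ∧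
      (∀ i h, G.Adj (c i) h → h ≠ c (i - 1) → h ≠ c (i + 1) →
        (S (c i) h ↔ cyc (ang (c i) (c (i - 1))) (ang (c i) h) (ang (c i) (c (i + 1)))))

section PE_sec

lemma walk_of_fun {V : Type u} (H : SimpleGraph V) (f : ℕ → V) (k : ℕ)
    (h : ∀ i < k, H.Adj (f (i + 1)) (f i)) :
    ∃ w : H.Walk (f k) (f 0), w.length = k ∧ (∀ x ∈ w.support, ∃ i ≤ k, x = f i) ∧
      (∀ e ∈ w.edges, ∃ i < k, e = s(f (i + 1), f i)) ∧
      ((∀ i ≤ k, ∀ j ≤ k, f i = f j → i = j) → w.IsPath) := by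
  induction k with
  | zero => exact ⟨.nil, by simp⟩
  | succ k ih =>
    obtain ⟨w, h1, h2, h3, h4⟩ := ih (fun i hi => h i (by omega))
    refine ⟨.cons (h k (by omega)) w, by simp [h1], ?_, ?_, ?_⟩
    · intro x hx
      rw [SimpleGraph.Walk.support_cons, List.mem_cons] at hx
      rcases hx with rfl | hx
      · exact ⟨_, le_rfl, rfl⟩
      · obtain ⟨i, hi, e⟩ := h2 x hx
        exact ⟨i, by omega, e⟩
    · intro e he
      rw [SimpleGraph.Walk.edges_cons, List.mem_cons] at he
      rcases he with rfl | he
      · exact ⟨k, by omega, rfl⟩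
      · obtain ⟨i, hi, e⟩ := h3 e he
        exact ⟨i, by omega, e⟩
    · intro hinj
      rw [SimpleGraph.Walk.cons_isPath_iff]
      refine ⟨h4 (fun i hi j hj => hinj i (by omega) j (by omega)), fun hx => ?_⟩
      obtain ⟨i, hi, e⟩ := h2 _ hx
      have := hinj _ le_rfl i (by omega) e
      omega

theorem subham_of_order {V : Type u} [Fintype V] (G : SimpleGraph V) (hcard : 3 ≤ Fintype.card V)
    {α : Type*} [LinearOrder α] (key : V → α) (hk : Function.Injective key)
    (T : V → V → Prop) (hT : ∀ u v, T u v → T v u)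
    (h1 : ∀ u v w z, G.Adj u v → G.Adj w z → T u v → T w z →
      ¬ (key u < key w ∧ key w < key v ∧ key v < key z))
    (h2 : ∀ u v w z, G.Adj u v → G.Adj w z → ¬ T u v → ¬ T w z →
      ¬ (key u < key w ∧ key w < key v ∧ key v < key z)) : G.IsSubhamiltonian := by
  classical
  set n := Fintype.card V with hn
  let p : V → ℕ := fun v => (Finset.univ.filter fun w => key w < key v).card
  have pm : ∀ u v, key u < key v → p u < p v := by
    intro u v h
    apply Finset.card_lt_card
    rw [Finset.ssubset_iff_of_subset]
    · exact ⟨u, by simp [h], by simp⟩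
    · intro w hw
      simp only [Finset.mem_filter, Finset.mem_univ, true_and] at hw ⊢
      exact hw.trans h
  have pl : ∀ u v, p u < p v → key u < key v := by
    intro u v h
    by_contra hh
    rcases (not_lt.1 hh).lt_or_eq with h' | h'
    · have := pm _ _ h'; omega
    · have := hk h'; subst this; omega
  have pinj : Function.Injective p := by
    intro u v h
    by_contra hne
    rcases lt_or_gt_of_ne (fun e => hne (hk e)) with h' | h' <;> have := pm _ _ h' <;> omega
  have plt : ∀ v, p v < n := by
    intro v
    rw [hn, ← Finset.card_univ]
    apply Finset.card_lt_card
    rw [Finset.ssubset_iff_of_subset (Finset.subset_univ _)]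
    exact ⟨v, by simp, by simp⟩
  let P : V → Fin n := fun v => ⟨p v, plt v⟩
  have Pb : Function.Bijective P := by
    rw [Fintype.bijective_iff_injective_and_card]
    exact ⟨fun u v h => pinj (congrArg Fin.val h), by simp [hn]⟩
  have hsurj : ∀ i < n, ∃ v, p v = i := fun i hi => by
    obtain ⟨v, hv⟩ := Pb.2 ⟨i, hi⟩
    exact ⟨v, congrArg Fin.val hv⟩
  have hne : Nonempty V := Fintype.card_pos_iff.1 (by omega)
  let f : ℕ → V := fun i => if h : i < n then (hsurj i h).choose else hne.some
  have pf : ∀ i < n, p (f i) = i := fun i hi => by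
    simp only [f, dif_pos hi]; exact (hsurj i hi).choose_spec
  let cons : V → V → Prop := fun u v => p v = p u + 1 ∨ p u = p v + 1 ∨ (p u = 0 ∧ p v + 1 = n) ∨
    (p v = 0 ∧ p u + 1 = n)
  have consymm : ∀ u v, cons u v → cons v u := by
    intro u v h; simp only [cons] at h ⊢; omega
  let H : SimpleGraph V :=
    { Adj := fun u v => G.Adj u v ∨ cons u v
      symm := ⟨fun u v h => h.imp (fun a => a.symm) (consymm u v)⟩
      loopless := ⟨fun u h => by
        rcases h with h | h
        · exact h.ne rfl
        · simp only [cons] at h; omega⟩ }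
  refine ⟨H, fun u v h => Or.inl h, ?_, ?_⟩
  · refine planar_of_book H (fun v => (p v : ℝ)) (fun u v h => pinj (Nat.cast_injective h))
      (fun u v => if T u v ∨ cons u v then 1 else -1) ?_ ?_ ?_
    · intro u v
      have : (T u v ∨ cons u v) ↔ (T v u ∨ cons v u) :=
        ⟨Or.imp (hT _ _) (consymm _ _), Or.imp (hT _ _) (consymm _ _)⟩
      simp only [this]
    · intro u v
      split_ifs <;> simp
    · rintro u v w z huv hwz hs ⟨a, b, c⟩
      simp only [Nat.cast_lt] at a b c
      have n1 : ¬ cons u v := by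
        have := plt z
        simp only [cons]; omega
      have n2 : ¬ cons w z := by
        simp only [cons]; omega
      have g1 : G.Adj u v := huv.resolve_right n1
      have g2 : G.Adj w z := hwz.resolve_right n2
      simp only [n1, n2, or_false] at hs
      have hh := And.intro (pl _ _ a) (And.intro (pl _ _ b) (pl _ _ c))
      by_cases t1 : T u v <;> by_cases t2 : T w z <;> simp only [t1, t2, if_true, if_false] at hs
      · exact h1 u v w z g1 g2 t1 t2 hh
      · norm_num at hs
      · norm_num at hs
      · exact h2 u v w z g1 g2 t1 t2 hh
  · intro _
    obtain ⟨w, w1, w2, w3, w4⟩ := walk_of_fun H f (n - 1) (fun i hi => by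
      right; right; left
      rw [pf _ (by omega), pf _ (by omega)])
    have hfin : ∀ i ≤ n - 1, ∀ j ≤ n - 1, f i = f j → i = j := fun i hi j hj h => by
      have := congrArg p h
      rwa [pf _ (by omega), pf _ (by omega)] at this
    have hadj : H.Adj (f 0) (f (n - 1)) := by
      right; right; right; left
      rw [pf _ (by omega), pf _ (by omega)]; omega
    refine ⟨f 0, .cons hadj w, ?_⟩
    rw [SimpleGraph.Walk.isHamiltonianCycle_iff_isCycle_and_length_eq]
    refine ⟨?_, by rw [SimpleGraph.Walk.length_cons, w1]; omega⟩
    rw [SimpleGraph.Walk.cons_isCycle_iff]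
    refine ⟨w4 hfin, fun he => ?_⟩
    obtain ⟨i, hi, e⟩ := w3 _ he
    rw [Sym2.eq_iff] at e
    rcases e with ⟨e1, e2⟩ | ⟨e1, e2⟩
    · have := hfin 0 (by omega) (i + 1) (by omega) e1; omega
    · have := hfin 0 (by omega) i (by omega) e1
      have := hfin _ le_rfl (i + 1) (by omega) e2; omega

end PE_sec

section PD1_sec

/-- Divergence order on lists. -/
def dv (l m : List ℝ) : Prop := ∃ c a b x y, l = c ++ a :: x ∧ m = c ++ b :: y ∧ a < b

lemma dv_lt {l m : List ℝ} (h : dv l m) : l < m := by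
  obtain ⟨c, a, b, x, y, rfl, rfl, h⟩ := h
  exact List.append_left_lt (List.cons_lt_cons_iff.2 (Or.inl h))

lemma dv_app {l m : List ℝ} (h : dv l m) (u w : List ℝ) : dv (l ++ u) (m ++ w) := by
  obtain ⟨c, a, b, x, y, rfl, rfl, h⟩ := h
  exact ⟨c, a, b, x ++ u, y ++ w, by simp, by simp, h⟩

lemma dv_pre {l m l' m' : List ℝ} (h : dv l m) (h1 : l <+: l') (h2 : m <+: m') : dv l' m' := by
  obtain ⟨u, rfl⟩ := h1
  obtain ⟨w, rfl⟩ := h2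
  exact dv_app h u w

lemma dv_snoc (k : List ℝ) {a b : ℝ} (h : a < b) : dv (k ++ [a]) (k ++ [b]) :=
  ⟨k, a, b, [], [], by simp, by simp, h⟩

lemma prefix_convex : ∀ (c : List ℝ) {l m n : List ℝ}, c <+: l → c <+: n → l < m → m < n → c <+: m
  | [], _, _, _, _, _, _, _ => List.nil_prefix
  | a :: c, l, m, n, h1, h2, h3, h4 => by
    obtain ⟨l, rfl⟩ := h1
    obtain ⟨n, rfl⟩ := h2
    cases m with
    | nil => simp at h3
    | cons b m =>
      simp only [List.cons_append, List.cons_lt_cons_iff] at h3 h4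
      have hab : a = b := by
        rcases h3 with h | h <;> rcases h4 with h' | h'
        · exact absurd (h.trans h') (lt_irrefl _)
        · rw [h'.1]
        · rw [h.1]
        · exact h.1
      subst hab
      simp only [lt_irrefl, false_or, true_and] at h3 h4
      rw [List.cons_prefix_cons]
      exact ⟨rfl, prefix_convex c (List.prefix_append _ _) (List.prefix_append _ _) h3 h4⟩

/-- Tree adjacency given by a parent function. -/
def Te {V : Type u} (a : V) (par : V → V) (u v : V) : Prop :=
  (u ≠ a ∧ par u = v) ∨ (v ≠ a ∧ par v = u)

lemma Te.symm {V : Type u} {a : V} {par : V → V} {u v : V} (h : Te a par u v) : Te a par v u :=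
  Or.symm h

/-- Keys along a rooted tree. -/
lemma exists_key {V : Type u} (a : V) (par : V → V) (rk : V → ℕ) (θ : V → V → ℝ)
    (hrk : ∀ v, v ≠ a → rk (par v) < rk v) :
    ∃ key : V → List ℝ, key a = [] ∧ ∀ v, v ≠ a → key v = key (par v) ++ [θ (par v) v] := by
  classical
  let K : ℕ → V → List ℝ := fun k => Nat.rec (fun _ => []) (fun _ f v =>
    if v = a then [] else f (par v) ++ [θ (par v) v]) k
  have K0 : ∀ v, K 0 v = [] := fun v => rfl
  have K1 : ∀ k v, K (k + 1) v = if v = a then [] else K k (par v) ++ [θ (par v) v] :=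
    fun k v => rfl
  have Ka : ∀ k, K k a = [] := by
    intro k; cases k with
    | zero => rfl
    | succ k => rw [K1, if_pos rfl]
  have st : ∀ k v, rk v ≤ k → K k v = K (rk v) v := by
    intro k
    induction k using Nat.strong_induction_on with
    | _ k ih =>
      intro v hv
      by_cases hva : v = a
      · subst hva; rw [Ka, Ka]
      · have h1 := hrk v hva
        obtain ⟨m, hm⟩ : ∃ m, k = m + 1 := ⟨k - 1, by omega⟩
        obtain ⟨m', hm'⟩ : ∃ m', rk v = m' + 1 := ⟨rk v - 1, by omega⟩
        rw [hm', hm, K1, K1, if_neg hva, if_neg hva, ih m (by omega) _ (by omega),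
          ih m' (by omega) _ (by omega)]
  refine ⟨fun v => K (rk v) v, Ka _, fun v hv => ?_⟩
  have h1 := hrk v hv
  obtain ⟨m', hm'⟩ : ∃ m', rk v = m' + 1 := ⟨rk v - 1, by omega⟩
  show K (rk v) v = K (rk (par v)) (par v) ++ _
  rw [hm', K1, if_neg hv, st m' _ (by omega)]

/-- Data of a tour. -/
structure Tour {V : Type u} (G : SimpleGraph V) (a : V) (par : V → V) (rk : V → ℕ)
    (θ : V → V → ℝ) (key : V → List ℝ) : Prop where
  adj : ∀ v, v ≠ a → G.Adj v (par v)
  rk_lt : ∀ v, v ≠ a → rk (par v) < rk v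
  inj : ∀ v x y, G.Adj v x → G.Adj v y → θ v x = θ v y → x = y
  key_root : key a = []
  key_par : ∀ v, v ≠ a → key v = key (par v) ++ [θ (par v) v]

namespace Tour
variable {V : Type u} {G : SimpleGraph V} {a : V} {par : V → V} {rk : V → ℕ}
    {θ : V → V → ℝ} {key : V → List ℝ}

lemma key_inj (h : Tour G a par rk θ key) : Function.Injective key := by
  have : ∀ n u v, rk u = n → key u = key v → u = v := by
    intro n
    induction n using Nat.strong_induction_on with
    | _ n ih =>
      intro u v hu e
      by_cases h1 : u = a <;> by_cases h2 : v = a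
      · rw [h1, h2]
      · rw [h1, h.key_root, h.key_par v h2] at e; simp at e
      · rw [h2, h.key_root, h.key_par u h1] at e; simp at e
      · rw [h.key_par u h1, h.key_par v h2] at e
        obtain ⟨e1, e2⟩ := List.append_inj' e rfl
        have e3 := ih _ (hu ▸ h.rk_lt u h1) _ _ rfl e1
        rw [e3] at e2
        exact h.inj _ _ _ (e3 ▸ (h.adj u h1).symm) (h.adj v h2).symm (by simpa using e2)
  intro u v e
  exact this _ u v rfl e

lemma pre (h : Tour G a par rk θ key) {u v : V} (hp : key v <+: key u) :
    u = v ∨ ∃ c, c ≠ a ∧ par c = v ∧ key c <+: key u := by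
  have : ∀ n u, rk u = n → key v <+: key u → u = v ∨ ∃ c, c ≠ a ∧ par c = v ∧ key c <+: key u := by
    intro n
    induction n using Nat.strong_induction_on with
    | _ n ih =>
      intro u hu hp
      by_cases h1 : u = a
      · left
        rw [h1, h.key_root, List.prefix_nil] at hp
        exact h.key_inj (by rw [h1, h.key_root, hp])
      · have hp' := hp
        rw [h.key_par u h1, List.prefix_concat_iff] at hp
        rcases hp with e | e
        · left; rw [← h.key_par u h1] at e; exact (h.key_inj e).symm
        · have hpu : key (par u) <+: key u := by
            rw [h.key_par u h1]; exact List.prefix_append _ _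
          rcases ih _ (hu ▸ h.rk_lt u h1) _ rfl e with e' | ⟨c, c1, c2, c3⟩
          · exact Or.inr ⟨u, h1, e', List.prefix_rfl⟩
          · exact Or.inr ⟨c, c1, c2, c3.trans hpu⟩
  exact this _ u rfl hp

lemma sib (h : Tour G a par rk θ key) {c v : V} (hc : c ≠ a) (hv : v ≠ a) (e : par c = par v)
    (hne : c ≠ v) : dv (key c) (key v) ∨ dv (key v) (key c) := by
  rw [h.key_par c hc, h.key_par v hv, e]
  have : θ (par v) c ≠ θ (par v) v := fun e' =>
    hne (h.inj _ _ _ (e ▸ (h.adj c hc).symm) (h.adj v hv).symm e')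
  rcases lt_or_gt_of_ne this with h' | h'
  · exact Or.inl (dv_snoc _ h')
  · exact Or.inr (dv_snoc _ h')

lemma tri (h : Tour G a par rk θ key) (u v : V) :
    key v <+: key u ∨ key u <+: key v ∨ dv (key u) (key v) ∨ dv (key v) (key u) := by
  have : ∀ n v, rk v = n → key v <+: key u ∨ key u <+: key v ∨
      dv (key u) (key v) ∨ dv (key v) (key u) := by
    intro n
    induction n using Nat.strong_induction_on with
    | _ n ih =>
      intro v hv
      by_cases h1 : v = a
      · left; rw [h1, h.key_root]; exact List.nil_prefix
      · have hpv : key (par v) <+: key v := by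
          rw [h.key_par v h1]; exact List.prefix_append _ _
        rcases ih _ (hv ▸ h.rk_lt v h1) _ rfl with e | e | e | e
        · rcases h.pre e with e | ⟨c, c1, c2, c3⟩
          · right; left; rw [e]; exact hpv
          · by_cases hcv : c = v
            · left; exact hcv ▸ c3
            · right; right
              rcases h.sib c1 h1 c2 hcv with d | d
              · exact Or.inl (dv_pre d c3 List.prefix_rfl)
              · exact Or.inr (dv_pre d List.prefix_rfl c3)
        · exact Or.inr (Or.inl (e.trans hpv))
        · exact Or.inr (Or.inr (Or.inl (dv_pre e List.prefix_rfl hpv)))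
        · exact Or.inr (Or.inr (Or.inr (dv_pre e hpv List.prefix_rfl)))
  exact this _ v rfl

/-- page one -/
lemma page1 (h : Tour G a par rk θ key) (t : V → ℝ)
    (ht : ∀ c, c ≠ a → t (par c) ≠ θ (par c) c) (u v w z : V)
    (h1 : Te a par u v) (h2 : Te a par w z) :
    ¬ (key u ++ [t u] < key w ++ [t w] ∧ key w ++ [t w] < key v ++ [t v] ∧
      key v ++ [t v] < key z ++ [t z]) := by
  have nt : ∀ p q, p ≠ q → key p <+: key q ++ [t q] → key p <+: key q := by
    intro p q hpq hp
    rcases List.prefix_concat_iff.1 hp with e | e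
    · exfalso
      by_cases hpa : p = a
      · rw [hpa, h.key_root] at e; simp at e
      · rw [h.key_par p hpa] at e
        obtain ⟨e1, e2⟩ := List.append_inj' e rfl
        have e3 := h.key_inj e1
        have := ht p hpa
        rw [e3] at this e2
        exact this (by simpa using e2.symm)
    · exact e
  have par_pre : ∀ p q, p ≠ q → q ≠ a → key p <+: key q → key p <+: key (par q) := by
    intro p q hpq hq hp
    rw [h.key_par q hq] at hp
    rcases List.prefix_concat_iff.1 hp with e | e
    · rw [← h.key_par q hq] at e
      exact absurd (h.key_inj e) hpq
    · exact e
  -- main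
  have main : ∀ p v x, (v ≠ a ∧ par v = p) → x ≠ p →
      (key p ++ [t p] < key x ++ [t x] ∧ key x ++ [t x] < key v ++ [t v] ∨
       key v ++ [t v] < key x ++ [t x] ∧ key x ++ [t x] < key p ++ [t p]) → key p <+: key x := by
    intro p v x hv hx hb
    have q1 : key p <+: key p ++ [t p] := List.prefix_append _ _
    have q2 : key p <+: key v ++ [t v] := by
      rw [h.key_par v hv.1, hv.2, List.append_assoc]; exact List.prefix_append _ _
    apply nt p x hx.symm
    rcases hb with ⟨b1, b2⟩ | ⟨b1, b2⟩
    · exact prefix_convex _ q1 q2 b1 b2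
    · exact prefix_convex _ q2 q1 b1 b2
  rintro ⟨b1, b2, b3⟩
  have d1 : u ≠ w := by rintro rfl; exact lt_irrefl _ b1
  have d2 : w ≠ v := by rintro rfl; exact lt_irrefl _ b2
  have d3 : v ≠ z := by rintro rfl; exact lt_irrefl _ b3
  have d4 : u ≠ z := by rintro rfl; exact lt_irrefl _ (b1.trans (b2.trans b3))
  have fin : ∀ p q, p ≠ q → key p <+: key q → key q <+: key p → False := by
    intro p q hpq x y
    exact hpq (h.key_inj (x.eq_of_length (le_antisymm x.length_le y.length_le)))
  rcases h1 with h1 | h1 <;> rcases h2 with h2 | h2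
  · -- parent v of u, parent z of w : w between u and v
    have e1 := main v u w h1 d2 (Or.inr ⟨b1, b2⟩)
    have e1 := par_pre _ _ d2.symm h2.1 e1
    have e2 := main z w v h2 d3 (Or.inl ⟨b2, b3⟩ |>.symm)
    rw [h2.2] at e1
    exact fin _ _ d3 e1 e2
  · have e1 := main v u w h1 d2 (Or.inr ⟨b1, b2⟩)
    have e2 := main w z v h2 d2.symm (Or.inl ⟨b2, b3⟩)
    exact fin _ _ d2.symm e1 e2
  · have e1 := main u v w h1 d1.symm (Or.inl ⟨b1, b2⟩)
    have e1 := par_pre _ _ d1 h2.1 e1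
    have e2 := main z w v h2 d3 (Or.inl ⟨b2, b3⟩ |>.symm)
    have e2 := par_pre _ _ d3.symm h1.1 e2
    rw [h2.2] at e1
    rw [h1.2] at e2
    exact fin _ _ d4 e1 e2
  · have e1 := main u v w h1 d1.symm (Or.inl ⟨b1, b2⟩)
    have e2 := main w z v h2 d2.symm (Or.inl ⟨b2, b3⟩)
    have e2 := par_pre _ _ d2 h1.1 e2
    rw [h1.2] at e2
    exact fin _ _ d1 e1 e2

/-- transfer from markers to darts -/
lemma marker (h : Tour G a par rk θ key) (t : V → ℝ)
    (ht : ∀ c k, c ≠ a → G.Adj (par c) k → ¬ Te a par (par c) k →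
      (t (par c) < θ (par c) c ↔ θ (par c) k < θ (par c) c) ∧ t (par c) ≠ θ (par c) c)
    {u v h' k : V} (hu : G.Adj u h') (hu' : ¬ Te a par u h') (hv : G.Adj v k)
    (hv' : ¬ Te a par v k) (hne : u ≠ v) (hlt : key u ++ [t u] < key v ++ [t v]) :
    key u ++ [θ u h'] < key v ++ [θ v k] := by
  rcases h.tri u v with e | e | e | e
  · rcases h.pre e with e | ⟨c, c1, rfl, c3⟩
    · exact absurd e hne
    · rw [h.key_par c c1] at c3
      have hc := (ht c k c1 hv hv')
      have ne2 : θ (par c) k ≠ θ (par c) c := fun e =>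
        hv' (Or.inr ⟨by rw [h.inj _ _ _ hv (h.adj c c1).symm e]; exact c1,
          by rw [h.inj _ _ _ hv (h.adj c c1).symm e]⟩)
      have : θ (par c) c < t (par c) := by
        rcases lt_or_gt_of_ne hc.2 with q | q
        · exact absurd hlt (not_lt.2 (dv_lt (dv_pre (dv_snoc (key (par c)) q) List.prefix_rfl
            (c3.trans (List.prefix_append _ _)))).le)
        · exact q
      have : θ (par c) c < θ (par c) k := by
        rcases lt_or_gt_of_ne ne2 with q | q
        · exact absurd (hc.1.2 q) (not_lt.2 this.le)
        · exact q
      exact dv_lt (dv_pre (dv_snoc (key (par c)) this) (c3.trans (List.prefix_append _ _))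
        List.prefix_rfl)
  · rcases h.pre e with e | ⟨c, c1, rfl, c3⟩
    · exact absurd e hne.symm
    · rw [h.key_par c c1] at c3
      have hc := (ht c h' c1 hu hu')
      have : t (par c) < θ (par c) c := by
        rcases lt_or_gt_of_ne hc.2 with q | q
        · exact q
        · exact absurd hlt (not_lt.2 (dv_lt (dv_pre (dv_snoc (key (par c)) q)
            (c3.trans (List.prefix_append _ _)) List.prefix_rfl)).le)
      exact dv_lt (dv_pre (dv_snoc (key (par c)) (hc.1.1 this)) List.prefix_rfl
        (c3.trans (List.prefix_append _ _)))
  · exact dv_lt (dv_app e _ _)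
  · exact absurd hlt (not_lt.2 (dv_lt (dv_app e _ _)).le)

end Tour

end PD1_sec

section PD2_sec

namespace Tour
variable {V : Type u} {G : SimpleGraph V} {a : V} {par : V → V} {rk : V → ℕ}
    {θ : V → V → ℝ} {key : V → List ℝ}

/-- pending darts -/
def Pend (G : SimpleGraph V) (a : V) (par : V → V) (S : Set V) (u h : V) : Prop :=
  u ∈ S ∧ G.Adj u h ∧ ¬ (Te a par u h ∧ h ∈ S)

/-- induction over parent closed sets -/
lemma closed_induction [Finite V] (hrk : ∀ v, v ≠ a → rk (par v) < rk v)
    (Q : Set V → Prop) (h0 : Q {a})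
    (step : ∀ S v, a ∈ S → (∀ x ∈ S, x ≠ a → par x ∈ S) → v ∉ S → v ≠ a → par v ∈ S →
      Q S → Q (insert v S)) : Q Set.univ := by
  classical
  have key : ∀ n (S : Set V), S.ncard = n → a ∈ S → (∀ x ∈ S, x ≠ a → par x ∈ S) → Q S := by
    intro n
    induction n with
    | zero =>
      intro S hS ha _
      rw [Set.ncard_eq_zero] at hS
      simp [hS] at ha
    | succ n ih =>
      intro S hS ha hcl
      by_cases hSa : S = {a}
      · rw [hSa]; exact h0
      · have hne : (S \ {a}).Nonempty := by
          rw [Set.nonempty_iff_ne_empty]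
          intro e
          apply hSa
          ext x; constructor
          · intro hx; by_contra hxa
            have : x ∈ S \ {a} := ⟨hx, hxa⟩
            simp [e] at this
          · rintro rfl; exact ha
        obtain ⟨v, ⟨hvS, hva⟩, hmax⟩ := Set.exists_max_image (S \ {a}) rk (Set.toFinite _) hne
        have hva : v ≠ a := hva
        have e : insert v (S \ {v}) = S := by
          rw [Set.insert_diff_singleton, Set.insert_eq_of_mem hvS]
        rw [← e]
        have hpv : par v ≠ v := fun e => by have := hrk v hva; rw [e] at this; omega
        have hcl' : ∀ x ∈ S \ {v}, x ≠ a → par x ∈ S \ {v} := by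
          rintro x ⟨hx, hxv⟩ hxa
          refine ⟨hcl x hx hxa, fun e => ?_⟩
          have e : par x = v := e
          have h1 := hrk x hxa
          have := hmax x ⟨hx, hxa⟩
          rw [e] at h1; omega
        refine step _ v ⟨ha, hva.symm⟩ hcl' (by simp) hva ⟨hcl v hvS hva, hpv⟩ ?_
        refine ih _ ?_ ⟨ha, hva.symm⟩ hcl'
        rw [Set.ncard_diff_singleton_of_mem hvS, hS]; rfl
  exact key _ _ rfl (Set.mem_univ _) (fun _ _ _ => Set.mem_univ _)

lemma pend_insert (h : Tour G a par rk θ key) {S : Set V} {v : V} (ha : a ∈ S)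
    (hcl : ∀ x ∈ S, x ≠ a → par x ∈ S) (hv : v ∉ S) (hva : v ≠ a) (hp : par v ∈ S) (u k : V) :
    Pend G a par (insert v S) u k ↔ (u = v ∧ G.Adj v k ∧ k ≠ par v) ∨
      (u ≠ v ∧ Pend G a par S u k ∧ ¬ (u = par v ∧ k = v)) := by
  have F : ∀ x ∈ S, Te a par x v → x = par v := by
    rintro x hx (⟨h1, h2⟩ | ⟨h1, h2⟩)
    · exact absurd (h2 ▸ hcl x hx h1) hv
    · exact h2.symm
  constructor
  · rintro ⟨h1, h2, h3⟩
    by_cases huv : u = v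
    · subst huv
      refine Or.inl ⟨rfl, h2, fun e => h3 ⟨Or.inl ⟨hva, e.symm⟩, ?_⟩⟩
      rw [e]; exact Or.inr hp
    · have hu : u ∈ S := h1.resolve_left huv
      refine Or.inr ⟨huv, ⟨hu, h2, fun e => h3 ⟨e.1, Or.inr e.2⟩⟩, fun e => h3 ⟨?_, ?_⟩⟩
      · exact Or.inr ⟨e.2 ▸ hva, by rw [e.1, e.2]⟩
      · rw [e.2]; exact Or.inl rfl
  · rintro (⟨rfl, h2, h3⟩ | ⟨h1, ⟨h2, h3, h4⟩, h5⟩)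
    · refine ⟨Or.inl rfl, h2, ?_⟩
      rintro ⟨h4, h5 | h5⟩
      · exact h2.ne h5.symm
      · exact h3 (F _ h5 h4.symm)
    · refine ⟨Or.inr h2, h3, ?_⟩
      rintro ⟨h6, rfl | h7⟩
      · exact h5 ⟨F _ h2 h6, rfl⟩
      · exact h4 ⟨h6, h7⟩

/-- pending darts are pairwise divergent -/
def PI (G : SimpleGraph V) (a : V) (par : V → V) (θ : V → V → ℝ) (key : V → List ℝ)
    (S : Set V) : Prop :=
  ∀ u k u' k', Pend G a par S u k → Pend G a par S u' k' → ¬ (u = u' ∧ k = k') →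
    dv (key u ++ [θ u k]) (key u' ++ [θ u' k']) ∨ dv (key u' ++ [θ u' k']) (key u ++ [θ u k])

lemma dv_same (h : Tour G a par rk θ key) {v k k' : V} (h1 : G.Adj v k) (h2 : G.Adj v k')
    (hne : k ≠ k') : dv (key v ++ [θ v k]) (key v ++ [θ v k']) ∨
      dv (key v ++ [θ v k']) (key v ++ [θ v k]) := by
  rcases lt_or_gt_of_ne (fun e => hne (h.inj v k k' h1 h2 e)) with q | q
  · exact Or.inl (dv_snoc _ q)
  · exact Or.inr (dv_snoc _ q)

lemma pi_root (h : Tour G a par rk θ key) : PI G a par θ key {a} := by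
  rintro u k u' k' ⟨rfl, h2, h3⟩ ⟨rfl, h2', h3'⟩ hne
  exact h.dv_same h2 h2' (fun e => hne ⟨rfl, e⟩)

lemma pend_par (h : Tour G a par rk θ key) {S : Set V} {v : V} (hv : v ∉ S) (hva : v ≠ a)
    (hp : par v ∈ S) : Pend G a par S (par v) v :=
  ⟨hp, (h.adj v hva).symm, fun e => hv e.2⟩

lemma pi_step (h : Tour G a par rk θ key) {S : Set V} {v : V} (ha : a ∈ S)
    (hcl : ∀ x ∈ S, x ≠ a → par x ∈ S) (hv : v ∉ S) (hva : v ≠ a) (hp : par v ∈ S)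
    (hS : PI G a par θ key S) : PI G a par θ key (insert v S) := by
  intro u k u' k' h1 h2 hne
  rw [h.pend_insert ha hcl hv hva hp] at h1 h2
  have hq := h.pend_par hv hva hp
  rcases h1 with ⟨rfl, a1, a2⟩ | ⟨a1, a2, a3⟩ <;> rcases h2 with ⟨rfl, b1, b2⟩ | ⟨b1, b2, b3⟩
  · exact h.dv_same a1 b1 (fun e => hne ⟨rfl, e⟩)
  · have := hS _ _ _ _ hq b2 (fun e => b3 ⟨e.1.symm, e.2.symm⟩)
    rw [← h.key_par u hva] at this
    exact this.imp (fun d => dv_pre d (List.prefix_append _ _) List.prefix_rfl)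
      (fun d => dv_pre d List.prefix_rfl (List.prefix_append _ _))
  · have := hS _ _ _ _ a2 hq a3
    rw [← h.key_par u' hva] at this
    exact this.imp (fun d => dv_pre d List.prefix_rfl (List.prefix_append _ _))
      (fun d => dv_pre d (List.prefix_append _ _) List.prefix_rfl)
  · exact hS _ _ _ _ a2 b2 hne

/-- comparison of an outside dart with a block -/
lemma block (h : Tour G a par rk θ key) {S : Set V} {v : V} (hv : v ∉ S) (hva : v ≠ a)
    (hp : par v ∈ S) (hS : PI G a par θ key S) {u k : V} (hu : Pend G a par S u k)
    (hne : ¬ (u = par v ∧ k = v)) :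
    (key u ++ [θ u k] < key v ∧ ∀ s, key u ++ [θ u k] < key v ++ [s]) ∨
    (key v < key u ++ [θ u k] ∧ ∀ s, key v ++ [s] < key u ++ [θ u k]) := by
  have := hS _ _ _ _ hu (h.pend_par hv hva hp) hne
  rw [← h.key_par v hva] at this
  refine this.imp (fun d => ⟨dv_lt d, fun s => ?_⟩) (fun d => ⟨dv_lt d, fun s => ?_⟩)
  · exact dv_lt (dv_pre d List.prefix_rfl (List.prefix_append _ _))
  · exact dv_lt (dv_pre d (List.prefix_append _ _) List.prefix_rfl)

lemma snoc_lt {k : List ℝ} {a b : ℝ} : k ++ [a] < k ++ [b] ↔ a < b := by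
  constructor
  · intro h
    by_contra h'
    rcases (not_lt.1 h').lt_or_eq with q | q
    · exact absurd h (not_lt.2 (dv_lt (dv_snoc k q)).le)
    · rw [q] at h; exact lt_irrefl _ h
  · intro h; exact dv_lt (dv_snoc k h)

end Tour

end PD2_sec

section PD3_sec

namespace Tour
variable {V : Type u} {G : SimpleGraph V} {a : V} {par : V → V} {rk : V → ℕ}
    {θ : V → V → ℝ} {key : V → List ℝ}

/-- the invariant for a cycle -/
def CI (G : SimpleGraph V) (a : V) (par : V → V) (θ : V → V → ℝ) (key : V → List ℝ)
    {n : ℕ} (c : ZMod n → V) (Sd : V → V → Prop) (S : Set V) : Prop :=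
  ((∀ i, c i ∉ S) → ∃ b : Prop, ∀ u h, Pend G a par S u h → (Sd u h ↔ b)) ∧
  ((∃ i, c i ∈ S) → ∃ i j, Pend G a par S (c i) (c (i - 1)) ∧ Pend G a par S (c j) (c (j + 1)) ∧
    (∀ k, Pend G a par S (c k) (c (k - 1)) → k = i) ∧
    (∀ k, Pend G a par S (c k) (c (k + 1)) → k = j) ∧
    ∀ u h, Pend G a par S u h → ¬ (u = c i ∧ h = c (i - 1)) → ¬ (u = c j ∧ h = c (j + 1)) →
      (Sd u h ↔ cyc (key (c i) ++ [θ (c i) (c (i - 1))]) (key u ++ [θ u h])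
        (key (c j) ++ [θ (c j) (c (j + 1))])))

lemma cyc_snoc {k : List ℝ} {x y z : ℝ} : cyc (k ++ [x]) (k ++ [y]) (k ++ [z]) ↔ cyc x y z := by
  simp only [cyc, snoc_lt]

lemma lt_tr {α : Type*} [LinearOrder α] {x y y' : α} (h : (x < y ∧ x < y') ∨ (y < x ∧ y' < x)) :
    (x < y ↔ x < y') ∧ (y < x ↔ y' < x) := by
  rcases h with h | h
  · exact ⟨by simp [h], by simp [h.1.not_gt, h.2.not_gt]⟩
  · exact ⟨by simp [h.1.not_gt, h.2.not_gt], by simp [h]⟩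

set_option linter.unusedSimpArgs false in
set_option maxHeartbeats 1000000 in
lemma ci_all [Finite V] (h : Tour G a par rk θ key)
    (h0 : ∀ v, v ≠ a → θ v (par v) = 0)
    (hpos : ∀ v k, v ≠ a → G.Adj v k → k ≠ par v → 0 < θ v k)
    {n : ℕ} (hn : 3 ≤ n) (c : ZMod n → V) (hc : Function.Injective c)
    (hadj : ∀ i, G.Adj (c i) (c (i + 1)))
    (Sd : V → V → Prop)
    (s1 : ∀ u v, G.Adj u v → (∀ i, s(u, v) ≠ s(c i, c (i + 1))) → (Sd u v ↔ Sd v u))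
    (s2 : ∀ w, (∀ i, w ≠ c i) → ∀ x y, G.Adj w x → G.Adj w y → (Sd w x ↔ Sd w y))
    (s3 : ∀ i k, G.Adj (c i) k → k ≠ c (i - 1) → k ≠ c (i + 1) →
      (Sd (c i) k ↔ cyc (θ (c i) (c (i - 1))) (θ (c i) k) (θ (c i) (c (i + 1)))))
    (it : ZMod n) (tp : ∀ i, i ≠ it → c i ≠ a ∧ (par (c i) = c (i + 1) ∨ par (c i) = c (i - 1))) :
    CI G a par θ key c Sd Set.univ := by
  have hadj' : ∀ i, G.Adj (c i) (c (i - 1)) := fun i => by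
    have := hadj (i - 1); rw [sub_add_cancel] at this; exact this.symm
  have two : (2 : ZMod n) ≠ 0 := by
    intro e
    have : ((2 : ℕ) : ZMod n) = 0 := by exact_mod_cast e
    rw [ZMod.natCast_eq_zero_iff] at this
    exact absurd (Nat.le_of_dvd (by norm_num) this) (by omega)
  have pne : ∀ i, c (i - 1) ≠ c (i + 1) := fun i e => two (by
    have := hc e
    linear_combination - this)
  suffices H : PI G a par θ key Set.univ ∧ CI G a par θ key c Sd Set.univ from H.2
  refine closed_induction h.rk_lt (fun S => PI G a par θ key S ∧ CI G a par θ key c Sd S) ?_ ?_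
  · refine ⟨h.pi_root, fun hS => ⟨∃ x, G.Adj a x ∧ Sd a x, ?_⟩, ?_⟩
    · rintro u k ⟨rfl, q, -⟩
      refine ⟨fun e => ⟨k, q, e⟩, fun ⟨x, x1, x2⟩ => (s2 u (fun i e => hS i ?_) _ _ q x1).2 x2⟩
      exact e.symm
    · rintro ⟨i, hi⟩
      have hi : c i = a := hi
      have P : ∀ k, G.Adj a k → Pend G a par {a} a k := fun k hk =>
        ⟨rfl, hk, fun e => hk.ne e.2.symm⟩
      refine ⟨i, i, hi ▸ P _ (hi ▸ hadj' i), hi ▸ P _ (hi ▸ hadj i), ?_, ?_, ?_⟩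
      · rintro k ⟨e, -⟩; exact hc (e.trans hi.symm)
      · rintro k ⟨e, -⟩; exact hc (e.trans hi.symm)
      · rintro u k ⟨rfl, q, -⟩ n1 n2
        rw [← hi, cyc_snoc]
        exact s3 i k (hi ▸ q) (fun e => n1 ⟨hi.symm, e⟩) (fun e => n2 ⟨hi.symm, e⟩)
  · rintro S v ha hcl hv hva hp ⟨hPI, hA, hB⟩
    refine ⟨h.pi_step ha hcl hv hva hp hPI, ?_⟩
    have hq := h.pend_par hv hva hp
    have hvp := h.adj v hva
    have kp := h.key_par v hva
    have hpv : par v ≠ v := fun e => hv (e ▸ hp)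
    have pin : ∀ u k, Pend G a par (insert v S) u k ↔ _ := h.pend_insert ha hcl hv hva hp
    have blk : ∀ u k, Pend G a par S u k → ¬ (u = par v ∧ k = v) → _ := fun u k h1 h2 =>
      h.block hv hva hp hPI h1 h2
    by_cases hvC : ∃ i', v = c i'
    swap
    · push Not at hvC
      have e1 : ∀ k, G.Adj v k → (Sd v k ↔ Sd (par v) v) := fun k hk => by
        rw [s2 v hvC _ _ hk hvp]
        refine s1 _ _ hvp (fun i e => ?_)
        have : v ∈ s(c i, c (i + 1)) := by rw [← e]; simp
        rw [Sym2.mem_iff] at this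
        rcases this with e | e
        · exact hvC _ e
        · exact hvC _ e
      refine ⟨fun hS => ?_, fun ⟨i0, hi0⟩ => ?_⟩
      · obtain ⟨b, hb⟩ := hA (fun i hi => hS i (Or.inr hi))
        refine ⟨b, fun u k hk => ?_⟩
        rw [pin] at hk
        rcases hk with ⟨rfl, k1, k2⟩ | ⟨k1, k2, k3⟩
        · rw [e1 _ k1]; exact hb _ _ hq
        · exact hb _ _ k2
      · obtain ⟨i, j, b1, b2, b3, b4, b5⟩ := hB ⟨i0, hi0.resolve_left (hvC i0).symm⟩
        have g1 : ¬ (c i = par v ∧ c (i - 1) = v) := fun e => hvC _ e.2.symm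
        have g2 : ¬ (c j = par v ∧ c (j + 1) = v) := fun e => hvC _ e.2.symm
        refine ⟨i, j, (pin _ _).2 (Or.inr ⟨(hvC _).symm, b1, g1⟩),
          (pin _ _).2 (Or.inr ⟨(hvC _).symm, b2, g2⟩), fun k hk => ?_, fun k hk => ?_, ?_⟩
        · rw [pin] at hk
          rcases hk with ⟨k0, k1, k2⟩ | ⟨k1, k2, k3⟩
          · exact absurd k0.symm (hvC _)
          · exact b3 k k2
        · rw [pin] at hk
          rcases hk with ⟨k0, k1, k2⟩ | ⟨k1, k2, k3⟩
          · exact absurd k0.symm (hvC _)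
          · exact b4 k k2
        · intro u k hk n1 n2
          rw [pin] at hk
          rcases hk with ⟨rfl, k1, k2⟩ | ⟨k1, k2, k3⟩
          · rw [e1 _ k1, b5 _ _ hq (fun e => g1 ⟨e.1.symm, e.2.symm⟩)
              (fun e => g2 ⟨e.1.symm, e.2.symm⟩), ← kp]
            have x1 := lt_tr ((blk _ _ b1 g1).imp (fun q => ⟨q.1, q.2 (θ u k)⟩)
              (fun q => ⟨q.1, q.2 (θ u k)⟩))
            have x2 := lt_tr ((blk _ _ b2 g2).imp (fun q => ⟨q.1, q.2 (θ u k)⟩)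
              (fun q => ⟨q.1, q.2 (θ u k)⟩))
            simp only [cyc, x1.1, x1.2, x2.1, x2.2]
          · exact b5 _ _ k2 n1 n2
    · obtain ⟨i', rfl⟩ := hvC
      by_cases hS : ∃ i, c i ∈ S
      swap
      · push Not at hS
        obtain ⟨b, hb⟩ := hA hS
        have hpC : ∀ i, par (c i') ≠ c i := fun i e => hS i (e ▸ hp)
        have uq : ∀ k h', Pend G a par (insert (c i') S) (c k) h' → k = i' := fun k h' hk =>
          hc (hk.1.resolve_right (hS k))
        refine ⟨fun hS' => absurd (Or.inl rfl) (hS' i'), fun _ => ⟨i', i',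
          (pin _ _).2 (Or.inl ⟨rfl, hadj' _, (hpC _).symm⟩),
          (pin _ _).2 (Or.inl ⟨rfl, hadj _, (hpC _).symm⟩), fun k hk => uq _ _ hk,
          fun k hk => uq _ _ hk, fun u k hk n1 n2 => ?_⟩⟩
        rw [pin] at hk
        rcases hk with ⟨rfl, k1, k2⟩ | ⟨k1, k2, k3⟩
        · rw [cyc_snoc]
          exact s3 _ _ k1 (fun e => n1 ⟨rfl, e⟩) (fun e => n2 ⟨rfl, e⟩)
        · rw [hb _ _ k2, ← hb _ _ hq, s1 _ _ hvp.symm, s3 _ _ hvp (hpC _) (hpC _), h0 _ hva]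
          · have y1 := hpos _ _ hva (hadj i') (hpC _).symm
            have y2 := hpos _ _ hva (hadj' i') (hpC _).symm
            rcases blk _ _ k2 k3 with q | q
            · simp [cyc, q.2, (q.2 _).not_gt, y1, y1.not_gt, y2, y2.not_gt, snoc_lt]
            · simp [cyc, q.2, (q.2 _).not_gt, y1, y1.not_gt, y2, y2.not_gt, snoc_lt]
          · intro i e
            have : par (c i') ∈ s(c i, c (i + 1)) := by rw [← e]; simp
            rw [Sym2.mem_iff] at this
            rcases this with e | e
            · exact hpC _ e
            · exact hpC _ e
      · obtain ⟨i, j, b1, b2, b3, b4, b5⟩ := hB hS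
        have htop : c it ∈ S := by
          obtain ⟨i1, hi1, hm⟩ := Set.exists_min_image {i | c i ∈ S} (fun i => rk (c i))
            (by have : NeZero n := ⟨by omega⟩
                exact Set.toFinite _) hS
          by_cases e : i1 = it
          · rw [← e]; exact hi1
          · obtain ⟨w1, w2⟩ := tp i1 e
            have w3 := hcl _ hi1 w1
            have w4 := h.rk_lt _ w1
            rcases w2 with w2 | w2 <;> rw [w2] at w3 w4
            · exact absurd (hm _ w3) (not_le.2 w4)
            · exact absurd (hm _ w3) (not_le.2 w4)
        have hit : i' ≠ it := fun e => hv (e ▸ htop)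
        refine ⟨fun hS' => absurd (Or.inl rfl) (hS' i'), fun _ => ?_⟩
        rcases (tp i' hit).2 with hpa | hpa
        · rw [hpa] at hq pin blk
          have ei : i = i' + 1 := (b3 (i' + 1) (by rw [add_sub_cancel_right]; exact hq)).symm
          subst ei
          rw [add_sub_cancel_right] at b5
          have g2 : ¬ (c j = c (i' + 1) ∧ c (j + 1) = c i') := fun e => two (by
            linear_combination hc e.2 - hc e.1)
          have hjv : c j ≠ c i' := fun e => hv (e ▸ b2.1)
          have kp' : key (c (i' + 1)) ++ [θ (c (i' + 1)) (c i')] = key (c i') := by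
            rw [kp, hpa]
          rw [kp'] at b5
          refine ⟨i', j, (pin _ _).2 (Or.inl ⟨rfl, hadj' _, pne _⟩),
            (pin _ _).2 (Or.inr ⟨hjv, b2, g2⟩), fun k hk => ?_, fun k hk => ?_, fun u k hk n1 n2 => ?_⟩
          · rw [pin] at hk
            rcases hk with ⟨k0, k1, k2⟩ | ⟨k1, k2, k3⟩
            · exact hc k0
            · exfalso
              apply k3
              rw [b3 k k2, add_sub_cancel_right]; exact ⟨rfl, rfl⟩
          · rw [pin] at hk
            rcases hk with ⟨k0, k1, k2⟩ | ⟨k1, k2, k3⟩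
            · exact absurd (by rw [hc k0]) k2
            · exact b4 k k2
          · rw [pin] at hk
            have x2 := blk _ _ b2 g2
            rcases hk with ⟨rfl, k1, k2⟩ | ⟨k1, k2, k3⟩
            · have y1 := hpos _ _ hva k1 (hpa ▸ k2)
              have y2 := hpos _ _ hva (hadj' i') (hpa ▸ pne _)
              have y0 := h0 _ hva
              rw [hpa] at y0
              rw [s3 _ _ k1 (fun e => n1 ⟨rfl, e⟩) k2, y0]
              rcases x2 with q | q
              · simp [cyc, q.2, (q.2 _).not_gt, y1, y1.not_gt, y2, y2.not_gt, snoc_lt]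
              · simp [cyc, q.2, (q.2 _).not_gt, y1, y1.not_gt, y2, y2.not_gt, snoc_lt]
            · rw [b5 _ _ k2 k3 n2]
              have x1 := lt_tr ((blk _ _ k2 k3).imp (fun q => ⟨q.1, q.2 (θ (c i') (c (i' - 1)))⟩)
                (fun q => ⟨q.1, q.2 (θ (c i') (c (i' - 1)))⟩))
              have x2 := lt_tr (x2.imp (fun q => ⟨q.1, q.2 (θ (c i') (c (i' - 1)))⟩)
                (fun q => ⟨q.1, q.2 (θ (c i') (c (i' - 1)))⟩))
              simp only [cyc, x1.1, x1.2, x2.1, x2.2]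
        · rw [hpa] at hq pin blk
          have ei : j = i' - 1 := (b4 (i' - 1) (by rw [sub_add_cancel]; exact hq)).symm
          subst ei
          rw [sub_add_cancel] at b5
          have g2 : ¬ (c i = c (i' - 1) ∧ c (i - 1) = c i') := fun e => two (by
            linear_combination hc e.1 - hc e.2)
          have hjv : c i ≠ c i' := fun e => hv (e ▸ b1.1)
          have kp' : key (c (i' - 1)) ++ [θ (c (i' - 1)) (c i')] = key (c i') := by
            rw [kp, hpa]
          rw [kp'] at b5
          refine ⟨i, i', (pin _ _).2 (Or.inr ⟨hjv, b1, g2⟩),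
            (pin _ _).2 (Or.inl ⟨rfl, hadj _, (pne _).symm⟩),
            fun k hk => ?_, fun k hk => ?_, fun u k hk n1 n2 => ?_⟩
          · rw [pin] at hk
            rcases hk with ⟨k0, k1, k2⟩ | ⟨k1, k2, k3⟩
            · exact absurd (by rw [hc k0]) k2
            · exact b3 k k2
          · rw [pin] at hk
            rcases hk with ⟨k0, k1, k2⟩ | ⟨k1, k2, k3⟩
            · exact hc k0
            · exfalso
              apply k3
              rw [b4 k k2, sub_add_cancel]; exact ⟨rfl, rfl⟩
          · rw [pin] at hk
            have x2 := blk _ _ b1 g2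
            rcases hk with ⟨rfl, k1, k2⟩ | ⟨k1, k2, k3⟩
            · have y1 := hpos _ _ hva k1 (hpa ▸ k2)
              have y2 := hpos _ _ hva (hadj i') (hpa ▸ (pne _).symm)
              have y0 := h0 _ hva
              rw [hpa] at y0
              rw [s3 _ _ k1 k2 (fun e => n2 ⟨rfl, e⟩), y0]
              rcases x2 with q | q
              · simp [cyc, q.2, (q.2 _).not_gt, y1, y1.not_gt, y2, y2.not_gt, snoc_lt]
              · simp [cyc, q.2, (q.2 _).not_gt, y1, y1.not_gt, y2, y2.not_gt, snoc_lt]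
            · rw [b5 _ _ k2 n1 k3]
              have x1 := lt_tr ((blk _ _ k2 k3).imp (fun q => ⟨q.1, q.2 (θ (c i') (c (i' + 1)))⟩)
                (fun q => ⟨q.1, q.2 (θ (c i') (c (i' + 1)))⟩))
              have x2 := lt_tr (x2.imp (fun q => ⟨q.1, q.2 (θ (c i') (c (i' + 1)))⟩)
                (fun q => ⟨q.1, q.2 (θ (c i') (c (i' + 1)))⟩))
              simp only [cyc, x1.1, x1.2, x2.1, x2.2]

end Tour

end PD3_sec

section PD4_sec

/-- tree path -/
def TP {V : Type u} (a : V) (par : V → V) (rk : V → ℕ) (x y : V) : Prop :=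
  ∃ (m : ℕ) (f : ℕ → V) (t : ℕ), f 0 = x ∧ f m = y ∧ t ≤ m ∧
    (∀ i j, i ≤ m → j ≤ m → f i = f j → i = j) ∧
    (∀ j, j < t → f j ≠ a ∧ par (f j) = f (j + 1)) ∧
    (∀ j, t ≤ j → j < m → f (j + 1) ≠ a ∧ par (f (j + 1)) = f j) ∧
    (∀ j, j ≤ m → f j = x ∨ f j = y ∨ rk (f j) < max (rk x) (rk y))

lemma TP.symm {V : Type u} {a : V} {par : V → V} {rk : V → ℕ} {x y : V} (h : TP a par rk x y) :
    TP a par rk y x := by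
  obtain ⟨m, f, t, h0, h1, h2, h3, h4, h5, h6⟩ := h
  refine ⟨m, fun j => f (m - j), m - t, by simpa, by simpa, by omega, ?_, ?_, ?_, ?_⟩
  · intro i j hi hj e
    have := h3 _ _ (by omega) (by omega) e
    omega
  · intro j hj
    have := h5 (m - (j + 1)) (by omega) (by omega)
    rwa [show m - (j + 1) + 1 = m - j by omega] at this
  · intro j hj hj'
    have := h4 (m - (j + 1)) (by omega)
    rwa [show m - (j + 1) + 1 = m - j by omega] at this
  · intro j hj
    have := h6 (m - j) (by omega)
    rw [max_comm]; tauto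

lemma tp_exists {V : Type u} {a : V} {par : V → V} {rk : V → ℕ}
    (hrk : ∀ v, v ≠ a → rk (par v) < rk v) (x y : V) : TP a par rk x y := by
  have ra : ∀ n v, rk v = n → v ≠ a → rk a < rk v := by
    intro n
    induction n using Nat.strong_induction_on with
    | _ n ih =>
      intro v hv hva
      have := hrk v hva
      by_cases e : par v = a
      · rwa [e] at this
      · exact (ih _ (hv ▸ this) _ rfl e).trans this
  have key : ∀ n x y, rk x + rk y = n → TP a par rk x y := by
    intro n
    induction n using Nat.strong_induction_on with
    | _ n ih =>
      have main : ∀ x y, rk x + rk y = n → rk y ≤ rk x → TP a par rk x y := by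
        intro x y hn hle
        by_cases hxy : x = y
        · subst hxy
          exact ⟨0, fun _ => x, 0, rfl, rfl, le_rfl, by intros; omega, by intros; omega,
            by intros; omega, fun _ _ => Or.inl rfl⟩
        have hxa : x ≠ a := by
          rintro rfl
          have := ra _ y rfl (Ne.symm hxy)
          omega
        have hr := hrk x hxa
        obtain ⟨m, f, t, h0, h1, h2, h3, h4, h5, h6⟩ := ih _ (by omega) (par x) y rfl
        have hx : ∀ j, j ≤ m → f j ≠ x ∧ (f j = y ∨ rk (f j) < rk x) := by
          intro j hj
          rcases h6 j hj with e | e | e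
          · refine ⟨fun e' => ?_, Or.inr ?_⟩
            · rw [e', ] at e; rw [← e] at hr; omega
            · rw [e]; exact hr
          · exact ⟨fun e' => hxy (e' ▸ e), Or.inl e⟩
          · have : rk (f j) < rk x := lt_of_lt_of_le e (max_le hr.le hle)
            exact ⟨fun e' => by rw [e'] at this; omega, Or.inr this⟩
        refine ⟨m + 1, fun j => if j = 0 then x else f (j - 1), t + 1, by simp, by simpa, by omega,
          ?_, ?_, ?_, ?_⟩
        · intro i j hi hj e
          rcases i with _ | i <;> rcases j with _ | j
          · rfl
          · exact absurd (by simpa using e.symm) (hx j (by omega)).1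
          · exact absurd (by simpa using e) (hx i (by omega)).1
          · rw [h3 i j (by omega) (by omega) (by simpa using e)]
        · intro j hj
          rcases j with _ | j
          · simpa [hxa] using h0.symm
          · simpa using h4 j (by omega)
        · intro j hj hj'
          rcases j with _ | j
          · omega
          · simpa using h5 j (by omega) (by omega)
        · intro j hj
          rcases j with _ | j
          · left; simp
          · right
            rw [max_eq_left hle]
            simpa using (hx j (by omega)).2
      intro x y hn
      rcases le_total (rk y) (rk x) with e | e
      · exact main x y hn e
      · exact (main y x (by omega) e).symm
  exact key _ x y rfl

/-- angle relative to a reference -/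
noncomputable def rel (d : ℝ) : ℝ := if d < 0 then d + 8 else d

lemma rel_cyc {r x y z : ℝ} (hr : -4 < r ∧ r < 4) (hx : -4 < x ∧ x < 4) (hy : -4 < y ∧ y < 4)
    (hz : -4 < z ∧ z < 4) : cyc (rel (x - r)) (rel (y - r)) (rel (z - r)) ↔ cyc x y z := by
  unfold cyc rel
  split_ifs <;> grind

lemma rel_inj {r x y : ℝ} (hr : -4 < r ∧ r < 4) (hx : -4 < x ∧ x < 4) (hy : -4 < y ∧ y < 4)
    (h : rel (x - r) = rel (y - r)) : x = y := by
  unfold rel at h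
  split_ifs at h <;> grind

lemma rel_nonneg {r x : ℝ} (hr : -4 < r ∧ r < 4) (hx : -4 < x ∧ x < 4) : 0 ≤ rel (x - r) := by
  unfold rel
  split_ifs <;> grind

namespace Tour
variable {V : Type u} {G : SimpleGraph V} {a : V} {par : V → V} {rk : V → ℕ}
    {θ : V → V → ℝ} {key : V → List ℝ}

lemma nocross [Finite V] (h : Tour G a par rk θ key)
    (h0 : ∀ v, v ≠ a → θ v (par v) = 0)
    (hpos : ∀ v k, v ≠ a → G.Adj v k → k ≠ par v → 0 < θ v k)
    (ang : V → V → ℝ) (hR : Rot G ang)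
    (hθ : ∀ v x y z, G.Adj v x → G.Adj v y → G.Adj v z →
      (cyc (θ v x) (θ v y) (θ v z) ↔ cyc (ang v x) (ang v y) (ang v z)))
    {u v w z : V} (huv : G.Adj u v) (huv' : ¬ Te a par u v) (hwz : G.Adj w z)
    (hwz' : ¬ Te a par w z) (huw : u ≠ w) (hvw : v ≠ w) :
    cyc (key u ++ [θ u v]) (key w ++ [θ w z]) (key v ++ [θ v u]) ↔
    cyc (key u ++ [θ u v]) (key z ++ [θ z w]) (key v ++ [θ v u]) := by
  obtain ⟨m, f, t, f0, f1, f2, f3, f4, f5, -⟩ := tp_exists h.rk_lt u v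
  have step : ∀ j, j < m → Te a par (f j) (f (j + 1)) := by
    intro j hj
    by_cases e : j < t
    · exact Or.inl (f4 j e)
    · exact Or.inr (f5 j (by omega) hj)
  have teadj : ∀ x y, Te a par x y → G.Adj x y := by
    rintro x y (⟨q, rfl⟩ | ⟨q, rfl⟩)
    · exact h.adj x q
    · exact (h.adj y q).symm
  have hm : 2 ≤ m := by
    by_contra hm
    have : m = 0 ∨ m = 1 := by omega
    rcases this with rfl | rfl
    · exact huv.ne (f0.symm.trans f1)
    · have := step 0 (by omega)
      rw [f0, f1] at this
      exact huv' this
  have : NeZero (m + 1) := ⟨by omega⟩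
  let c : ZMod (m + 1) → V := fun i => f i.val
  have cv : ∀ j, j ≤ m → c (j : ZMod (m + 1)) = f j := fun j hj => by
    simp only [c]; rw [ZMod.val_natCast_of_lt (by omega)]
  have rep : ∀ i : ZMod (m + 1), ∃ j, j ≤ m ∧ i = (j : ZMod (m + 1)) := fun i =>
    ⟨i.val, by have := i.val_lt; omega, by simp⟩
  have hz0 : ((m : ℕ) : ZMod (m + 1)) + 1 = 0 := by
    have := ZMod.natCast_self (m + 1); push_cast at this; exact this
  have hc0 : c 0 = u := by have := cv 0 (by omega); rw [Nat.cast_zero] at this; rw [this, f0]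
  have hcm : c (m : ℕ) = v := by rw [cv m le_rfl, f1]
  have hm1 : (0 : ZMod (m + 1)) - 1 = (m : ℕ) := by linear_combination -hz0
  have hc : Function.Injective c := by
    intro i j e
    exact ZMod.val_injective _ (f3 _ _ (by have := i.val_lt; omega) (by have := j.val_lt; omega) e)
  have cst : ∀ i : ZMod (m + 1), (Te a par (c i) (c (i + 1)) ∨ i = (m : ℕ)) := by
    intro i
    obtain ⟨j, hj, rfl⟩ := rep i
    by_cases e : j = m
    · right; rw [e]
    · left
      have := cv (j + 1) (by omega)
      push_cast at this
      rw [this, cv j hj]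
      exact step j (by omega)
  have hadj : ∀ i, G.Adj (c i) (c (i + 1)) := by
    intro i
    rcases cst i with e | e
    · exact teadj _ _ e
    · rw [e, hz0, hcm, hc0]; exact huv.symm
  obtain ⟨Sd, s1, s2, s3⟩ := hR.side (m + 1) c (by omega) hc hadj
  have hadj' : ∀ i, G.Adj (c i) (c (i - 1)) := fun i => by
    have := hadj (i - 1); rw [sub_add_cancel] at this; exact this.symm
  have CI := h.ci_all h0 hpos (by omega) c hc hadj Sd s1 s2
    (fun i k q1 q2 q3 => (s3 i k q1 q2 q3).trans (hθ _ _ _ _ (hadj' i) q1 (hadj i)).symm)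
    (t : ℕ) (by
      intro i hi
      obtain ⟨j, hj, rfl⟩ := rep i
      have hjt : j ≠ t := fun e => hi (by rw [e])
      rw [cv j hj]
      rcases lt_or_gt_of_ne hjt with e | e
      · refine ⟨(f4 j e).1, Or.inl ?_⟩
        have := cv (j + 1) (by omega)
        push_cast at this
        rw [this]; exact (f4 j e).2
      · obtain ⟨j, rfl⟩ : ∃ k, j = k + 1 := ⟨j - 1, by omega⟩
        refine ⟨(f5 j (by omega) (by omega)).1, Or.inr ?_⟩
        push_cast
        rw [add_sub_cancel_right, cv j (by omega)]
        exact (f5 j (by omega) (by omega)).2)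
  obtain ⟨i, j, b1, b2, b3, b4, b5⟩ := CI.2 ⟨0, Set.mem_univ _⟩
  have e1 := b3 0 ⟨Set.mem_univ _, by rw [hm1, hc0, hcm]; exact huv, fun e => huv' (by
    have := e.1; rwa [hm1, hc0, hcm] at this)⟩
  have e2 := b4 (m : ℕ) ⟨Set.mem_univ _, by rw [hz0, hc0, hcm]; exact huv.symm, fun e => huv' (by
    have := e.1.symm; rwa [hz0, hc0, hcm] at this)⟩
  subst e1 e2
  rw [hm1, hz0, hc0, hcm] at b5
  rw [← b5 w z ⟨Set.mem_univ _, hwz, fun e => hwz' e.1⟩ (fun e => huw e.1.symm)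
    (fun e => hvw e.1.symm), ← b5 z w ⟨Set.mem_univ _, hwz.symm, fun e => hwz' e.1.symm⟩
    (fun e => hvw e.2.symm) (fun e => huw e.2.symm)]
  refine s1 _ _ hwz (fun i e => ?_)
  rcases cst i with q | q
  · rw [Sym2.eq_iff] at e
    rcases e with ⟨rfl, rfl⟩ | ⟨rfl, rfl⟩
    · exact hwz' q
    · exact hwz' q.symm
  · rw [q, hz0, hc0, hcm, Sym2.eq_iff] at e
    rcases e with ⟨e, -⟩ | ⟨e, -⟩
    · exact hvw e.symm
    · exact huw e.symm

end Tour

theorem subham_of_good {V : Type u} [Fintype V] (G : SimpleGraph V) (hcard : 3 ≤ Fintype.card V)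
    (ang : V → V → ℝ) (hR : Rot G ang) (a : V) (par : V → V) (rk : V → ℕ)
    (hadj : ∀ v, v ≠ a → G.Adj v (par v)) (hrk : ∀ v, v ≠ a → rk (par v) < rk v)
    (good : ∀ v x y h h', Te a par v x → Te a par v y → G.Adj v h → G.Adj v h' →
      cyc (ang v x) (ang v h) (ang v y) → cyc (ang v y) (ang v h') (ang v x) →
      Te a par v h ∨ Te a par v h') : G.IsSubhamiltonian := by
  classical
  have hex : ∃ ref : V → V, (∀ v, v ≠ a → ref v = par v) ∧
      ∀ v, (∃ x, Te a par v x) → Te a par v (ref v) := by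
    by_cases hx : ∃ x, Te a par a x
    · obtain ⟨x, hx⟩ := hx
      refine ⟨fun v => if v = a then x else par v, fun v hv => by simp [hv], fun v _ => ?_⟩
      by_cases e : v = a
      · subst e; simpa using hx
      · simp only [if_neg e]; exact Or.inl ⟨e, rfl⟩
    · refine ⟨par, fun _ _ => rfl, fun v hv => ?_⟩
      by_cases e : v = a
      · subst e; exact absurd hv hx
      · exact Or.inl ⟨e, rfl⟩
  obtain ⟨ref, r1, r2⟩ := hex
  have teadj : ∀ x y, Te a par x y → G.Adj x y := by
    rintro x y (⟨q, rfl⟩ | ⟨q, rfl⟩)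
    · exact hadj x q
    · exact (hadj y q).symm
  have rg : ∀ v x, G.Adj v x → -4 < ang v x ∧ ang v x < 4 := fun v x _ => ⟨hR.lo v x, hR.hi v x⟩
  let rr : V → ℝ := fun v => if ∃ x, Te a par v x then ang v (ref v) else 0
  have rrg : ∀ v, -4 < rr v ∧ rr v < 4 := by
    intro v
    simp only [rr]
    split_ifs with q
    · exact rg _ _ (teadj _ _ (r2 v q))
    · norm_num
  let θ : V → V → ℝ := fun v x => rel (ang v x - rr v)
  have θ0 : ∀ v, (∃ x, Te a par v x) → θ v (ref v) = 0 := by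
    intro v hv
    simp [θ, rr, hv, rel]
  have θn : ∀ v x, G.Adj v x → 0 ≤ θ v x := fun v x q => rel_nonneg (rrg v) (rg v x q)
  have θi : ∀ v x y, G.Adj v x → G.Adj v y → θ v x = θ v y → x = y := fun v x y q1 q2 e =>
    hR.inj v x y q1 q2 (rel_inj (rrg v) (rg _ _ q1) (rg _ _ q2) e)
  have θc : ∀ v x y z, G.Adj v x → G.Adj v y → G.Adj v z →
      (cyc (θ v x) (θ v y) (θ v z) ↔ cyc (ang v x) (ang v y) (ang v z)) :=
    fun v x y z q1 q2 q3 => rel_cyc (rrg v) (rg _ _ q1) (rg _ _ q2) (rg _ _ q3)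
  have θp : ∀ v x, (∃ x, Te a par v x) → G.Adj v x → x ≠ ref v → 0 < θ v x := by
    intro v x hv q hne
    refine lt_of_le_of_ne (θn v x q) (fun e => hne (θi v _ _ q (teadj _ _ (r2 v hv)) ?_))
    rw [θ0 v hv, e]
  have pT : ∀ v, v ≠ a → ∃ x, Te a par v x := fun v hv => ⟨par v, Or.inl ⟨hv, rfl⟩⟩
  obtain ⟨key, k0, k1⟩ := exists_key a par rk θ hrk
  have T : Tour G a par rk θ key := ⟨hadj, hrk, θi, k0, k1⟩
  let t : V → ℝ := fun v => if q : ∃ h0, G.Adj v h0 ∧ ¬ Te a par v h0 then θ v q.choose else -1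
  have ht1 : ∀ c, c ≠ a → t (par c) ≠ θ (par c) c := by
    intro c hc
    have hT : Te a par (par c) c := Or.inr ⟨hc, rfl⟩
    simp only [t]
    split_ifs with q
    · intro e
      have := θi _ _ _ q.choose_spec.1 (teadj _ _ hT) e
      apply q.choose_spec.2; rw [this]; exact hT
    · have := θn _ _ (teadj _ _ hT)
      intro e; linarith
  have gd : ∀ p c k k', Te a par p c → G.Adj p k → G.Adj p k' → ¬ Te a par p k → ¬ Te a par p k' →
      θ p k < θ p c → θ p k' < θ p c := by
    intro p c k k' hc hk hk' nk nk' hlt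
    by_contra hle
    have h1 : θ p c ≠ θ p k' := fun e => nk' (θi _ _ _ (teadj _ _ hc) hk' e ▸ hc)
    have h2 : θ p c < θ p k' := lt_of_le_of_ne (not_lt.1 hle) h1
    have hr := r2 p ⟨c, hc⟩
    have h3 : 0 < θ p k := θp p k ⟨c, hc⟩ hk (fun e => nk (e ▸ hr))
    rcases good p (ref p) c k k' hr hc hk hk' ((θc _ _ _ _ (teadj _ _ hr) hk (teadj _ _ hc)).1
      (Or.inl ⟨by rw [θ0 p ⟨c, hc⟩]; exact h3, hlt⟩))
      ((θc _ _ _ _ (teadj _ _ hc) hk' (teadj _ _ hr)).1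
      (Or.inr (Or.inr ⟨by rw [θ0 p ⟨c, hc⟩]; exact h3.trans hlt, h2⟩))) with e | e
    · exact nk e
    · exact nk' e
  have ht2 : ∀ c k, c ≠ a → G.Adj (par c) k → ¬ Te a par (par c) k →
      (t (par c) < θ (par c) c ↔ θ (par c) k < θ (par c) c) ∧ t (par c) ≠ θ (par c) c := by
    intro c k hc hk hk'
    refine ⟨?_, ht1 c hc⟩
    have hT : Te a par (par c) c := Or.inr ⟨hc, rfl⟩
    have q : ∃ h0, G.Adj (par c) h0 ∧ ¬ Te a par (par c) h0 := ⟨k, hk, hk'⟩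
    have e : t (par c) = θ (par c) q.choose := by simp only [t]; rw [dif_pos q]
    rw [e]
    exact ⟨gd _ _ _ _ hT q.choose_spec.1 hk q.choose_spec.2 hk',
      gd _ _ _ _ hT hk q.choose_spec.1 hk' q.choose_spec.2⟩
  refine subham_of_order G hcard (fun v => key v ++ [t v]) ?_ (Te a par) (fun u v => Te.symm) ?_ ?_
  · intro u v e
    exact T.key_inj (List.append_inj' e rfl).1
  · intro u v w z _ _ h1 h2
    exact T.page1 t ht1 u v w z h1 h2
  · rintro u v w z hu hw h1 h2 ⟨q1, q2, q3⟩
    have n1 : u ≠ w := fun e => by subst e; exact lt_irrefl _ q1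
    have n2 : v ≠ w := fun e => by subst e; exact lt_irrefl _ q2
    have n3 : v ≠ z := fun e => by subst e; exact lt_irrefl _ q3
    have m1 := T.marker t ht2 hu h1 hw h2 n1 q1
    have m2 := T.marker t ht2 hw h2 hu.symm (fun e => h1 e.symm) n2.symm q2
    have m3 := T.marker t ht2 hu.symm (fun e => h1 e.symm) hw.symm (fun e => h2 e.symm) n3 q3
    have := (T.nocross (fun v hv => by rw [← r1 v hv]; exact θ0 v (pT v hv))
      (fun v k hv hk hne => θp v k (pT v hv) hk (r1 v hv ▸ hne)) ang hR θc hu h1 hw h2 n1 n2).1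
      (Or.inl ⟨m1, m2⟩)
    rcases this with e | e | e
    · exact absurd (m3.trans e.2) (lt_irrefl _)
    · exact absurd (m3.trans e.1) (lt_irrefl _)
    · exact absurd (m1.trans (m2.trans e.1)) (lt_irrefl _)

end PD4_sec

section PB_sec

section ear
variable {V : Type u} {G : SimpleGraph V}

/-- reachability inside a set -/
def Rc (G : SimpleGraph V) (A : Set V) (x y : V) : Prop :=
  x ∈ A ∧ Relation.ReflTransGen (fun p q => G.Adj p q ∧ q ∈ A) x y

/-- connected (or empty) set -/
def Cnn (G : SimpleGraph V) (A : Set V) : Prop := ∀ x ∈ A, ∀ y ∈ A, Rc G A x y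

/-- three-connectedness as absence of small cuts -/
def NoCut (G : SimpleGraph V) : Prop := ∀ (X : Set V) (x y u v : V), x ∈ X → y ∉ X → x ≠ u → x ≠ v →
  y ≠ u → y ≠ v → ∃ p ∈ X, ∃ q ∉ X, G.Adj p q ∧ q ≠ u ∧ q ≠ v

namespace Rc
variable {A B : Set V} {x y z : V}

lemma refl (h : x ∈ A) : Rc G A x x := ⟨h, .refl⟩

lemma trans (h : Rc G A x y) (h' : Rc G A y z) : Rc G A x z := ⟨h.1, h.2.trans h'.2⟩

lemma mem (h : Rc G A x y) : y ∈ A := by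
  rcases h.2.cases_tail with e | ⟨b, -, hb⟩
  · exact e ▸ h.1
  · exact hb.2

lemma adj (h : Rc G A x y) (h' : G.Adj y z) (hz : z ∈ A) : Rc G A x z := ⟨h.1, h.2.tail ⟨h', hz⟩⟩

lemma mono (h : Rc G A x y) (hAB : A ⊆ B) : Rc G B x y :=
  ⟨hAB h.1, Relation.ReflTransGen.mono (fun _ _ (q : G.Adj _ _ ∧ _) => ⟨q.1, hAB q.2⟩) _ _ h.2⟩

lemma symm (h : Rc G A x y) : Rc G A y x := by
  obtain ⟨h1, h2⟩ := h
  induction h2 with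
  | refl => exact refl h1
  | tail a b ih => exact (refl b.2).adj b.1.symm (mem ⟨h1, a⟩) |>.trans ih

lemma cut (h : Rc G A x y) {X : Set V} (hx : x ∈ X) (hy : y ∉ X) :
    ∃ p ∈ X, ∃ q ∉ X, G.Adj p q ∧ p ∈ A ∧ q ∈ A := by
  obtain ⟨h1, h2⟩ := h
  induction h2 with
  | refl => exact absurd hx hy
  | @tail b c a bc ih =>
    by_cases hb : b ∈ X
    · exact ⟨b, hb, c, hy, bc.1, mem ⟨h1, a⟩, bc.2⟩
    · exact ih hb

lemma comp (h : Rc G A x y) : Rc G {y | Rc G A x y} x y := by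
  obtain ⟨h1, h2⟩ := h
  induction h2 with
  | refl => exact refl (refl h1)
  | tail a b ih => exact ih.adj b.1 (adj ⟨h1, a⟩ b.1 b.2)

lemma path (h : Rc G A x y) : ∃ (m : ℕ) (z : ℕ → V), z 0 = x ∧ z m = y ∧ (∀ i ≤ m, z i ∈ A) ∧
    ∀ i < m, G.Adj (z i) (z (i + 1)) := by
  obtain ⟨h1, h2⟩ := h
  induction h2 with
  | refl => exact ⟨0, fun _ => x, rfl, rfl, fun _ _ => h1, fun i hi => absurd hi (by omega)⟩
  | @tail b c a bc ih =>
    obtain ⟨m, z, z0, z1, z2, z3⟩ := ih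
    refine ⟨m + 1, fun i => if i ≤ m then z i else c, by simpa, by simp, fun i hi => ?_,
      fun i hi => ?_⟩
    · dsimp only; split_ifs with e
      · exact z2 i e
      · exact bc.2
    · dsimp only
      rw [if_pos (by omega)]
      split_ifs with e
      · exact z3 i (by omega)
      · have : i = m := by omega
        rw [this, z1]; exact bc.1

end Rc

lemma rc_seq {A : Set V} {z : ℕ → V} {a b : ℕ} (hab : a ≤ b) (h1 : ∀ i, a ≤ i → i ≤ b → z i ∈ A)
    (h2 : ∀ i, a ≤ i → i < b → G.Adj (z i) (z (i + 1))) : Rc G A (z a) (z b) := by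
  induction b, hab using Nat.le_induction with
  | base => exact .refl (h1 a le_rfl le_rfl)
  | succ b hb ih =>
    exact (ih (fun i q1 q2 => h1 i q1 (by omega)) (fun i q1 q2 => h2 i q1 (by omega))).adj
      (h2 b hb (by omega)) (h1 _ (by omega) le_rfl)

/-- candidate ears -/
structure Ear (G : SimpleGraph V) (S : Set V) (r : V) where
  m : ℕ
  z : ℕ → V
  wl : V
  wr : V
  hz : ∀ i ≤ m, z i ∈ Sᶜ \ {r}
  hadj : ∀ i < m, G.Adj (z i) (z (i + 1))
  hl : wl ∈ S
  hr : wr ∈ S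
  hne : wl ≠ wr
  al : G.Adj (z 0) wl
  ar : G.Adj (z m) wr

/-- vertices of an ear -/
def Ear.Z {S : Set V} {r : V} (e : Ear G S r) : Set V := {x | ∃ i ≤ e.m, e.z i = x}
/-- main component -/
def Ear.D {S : Set V} {r : V} (e : Ear G S r) : Set V := {y | Rc G (Sᶜ \ e.Z) r y}

lemma ear_of_rc {S : Set V} {r : V} {A : Set V} (hA : A ⊆ Sᶜ \ {r}) {x y s s' : V}
    (h : Rc G A x y) (h1 : G.Adj x s) (h2 : G.Adj y s') (hs : s ∈ S) (hs' : s' ∈ S) (hne : s ≠ s') :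
    ∃ e : Ear G S r, e.Z ⊆ A := by
  obtain ⟨m, z, z0, z1, z2, z3⟩ := h.path
  refine ⟨⟨m, z, s, s', fun i hi => hA (z2 i hi), z3, hs, hs', hne, z0 ▸ h1, z1 ▸ h2⟩, ?_⟩
  rintro _ ⟨i, hi, rfl⟩
  exact z2 i hi

theorem ear_lemma [Finite V] (hG : NoCut G) (S : Set V) (hcon : Cnn G Sᶜ) (hne : Sᶜ.Nonempty)
    (h2 : ∀ u, ∃ s ∈ S, s ≠ u) :
    ∃ (m : ℕ) (z : ℕ → V) (wl wr : V), (∀ i ≤ m, z i ∉ S) ∧ (∀ i < m, G.Adj (z i) (z (i + 1))) ∧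
      wl ∈ S ∧ wr ∈ S ∧ wl ≠ wr ∧ G.Adj (z 0) wl ∧ G.Adj (z m) wr ∧
      (∀ i j, i ≤ m → j ≤ m → z i = z j → i = j) ∧
      (∀ i j, i < j → j ≤ m → G.Adj (z i) (z j) → j = i + 1) ∧
      (1 ≤ m → ∀ j ≤ m, ∀ s ∈ S, G.Adj (z j) s → (j = 0 ∧ s = wl) ∨ (j = m ∧ s = wr)) ∧
      Cnn G (S ∪ {x | ∃ i ≤ m, z i = x})ᶜ := by
  classical
  obtain ⟨r, hr⟩ := hne
  by_cases hR : ∀ x ∈ Sᶜ, x = r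
  · -- single vertex
    have tch : ∀ u, ∃ s ∈ S, s ≠ u ∧ G.Adj r s := by
      intro u
      by_cases hu : u = r
      · obtain ⟨s, hs, -⟩ := h2 r
        have hsr : s ≠ r := fun e => hr (e ▸ hs)
        obtain ⟨s', hs', hss⟩ := h2 s
        have hsr' : s' ≠ r := fun e => hr (e ▸ hs')
        obtain ⟨p, hp, q, hq, hpq, hqu, -⟩ := hG {r} r s' s s rfl hsr' hsr.symm hsr.symm hss hss
        have hp : p = r := hp
        refine ⟨q, ?_, ?_, hp ▸ hpq⟩
        · by_contra e; exact hq (hR q e)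
        · rw [hu]; exact hq
      · obtain ⟨s', hs', hss⟩ := h2 u
        have hsr' : s' ≠ r := fun e => hr (e ▸ hs')
        obtain ⟨p, hp, q, hq, hpq, hqu, -⟩ := hG {r} r s' u u rfl hsr' (Ne.symm hu) (Ne.symm hu) hss hss
        have hp : p = r := hp
        refine ⟨q, ?_, hqu, hp ▸ hpq⟩
        by_contra e; exact hq (hR q e)
    obtain ⟨s, hs, -, hrs⟩ := tch r
    obtain ⟨s', hs', hne, hrs'⟩ := tch s
    refine ⟨0, fun _ => r, s, s', fun _ _ => hr, by omega, hs, hs', hne.symm, hrs, hrs', by omega,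
      by omega, by omega, ?_⟩
    intro x hx
    exact absurd (Or.inr ⟨0, le_rfl, (hR x (fun e => hx (Or.inl e))).symm⟩) hx
  push Not at hR
  obtain ⟨x0, hx0, hx0r⟩ := hR
  have hex : Nonempty (Ear G S r) := by
    let C := {y | Rc G (Sᶜ \ {r}) x0 y}
    have hC : x0 ∈ C := Rc.refl ⟨hx0, hx0r⟩
    have tch : ∀ u ∈ S, ∃ s ∈ S, s ≠ u ∧ ∃ x ∈ C, G.Adj x s := by
      intro u hu
      obtain ⟨s', hs', hss⟩ := h2 u
      obtain ⟨p, hp, q, hq, hpq, hqu, hqr⟩ := hG C x0 s' u r hC (fun e => e.mem.1 hs')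
        (fun e => hx0 (e ▸ hu)) hx0r hss (fun e => hr (e ▸ hs'))
      refine ⟨q, ?_, hqu, p, hp, hpq⟩
      by_contra e
      exact hq (hp.adj hpq ⟨e, hqr⟩)
    obtain ⟨s0, hs0, -⟩ := h2 r
    obtain ⟨s, hs, -, x, hx, hxs⟩ := tch s0 hs0
    obtain ⟨s', hs', hne, y, hy, hys⟩ := tch s hs
    obtain ⟨e, -⟩ := ear_of_rc (G := G) (S := S) (r := r) subset_rfl (hx.symm.trans hy) hxs hys hs hs' hne.symm
    exact ⟨e⟩
  let f : Ear G S r → ℕ ×ₗ ℕ := fun e => toLex (Nat.card V - e.D.ncard, e.m)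
  obtain ⟨e, -, he⟩ := (InvImage.wf f (wellFounded_lt)).has_min Set.univ ⟨hex.some, trivial⟩
  have cardle : ∀ X : Set V, X.ncard ≤ Nat.card V := fun X => by
    rw [← Set.ncard_univ]; exact Set.ncard_le_ncard (Set.subset_univ _)
  have opt1 : ∀ e' : Ear G S r, e.D ⊆ e'.D → e'.D = e.D := by
    intro e' h
    by_contra hne
    have hlt := Set.ncard_lt_ncard (h.ssubset_of_ne (Ne.symm hne))
    refine he e' trivial (Prod.Lex.toLex_lt_toLex.2 (Or.inl ?_))
    have := cardle e'.D
    dsimp only; omega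
  have opt2 : ∀ e' : Ear G S r, e'.Z ⊆ e.Z → e.m ≤ e'.m := by
    intro e' h
    have h1 : e'.D = e.D := opt1 e' (fun y hy => hy.mono (fun x hx => ⟨hx.1, fun q => hx.2 (h q)⟩))
    by_contra hlt
    refine he e' trivial (Prod.Lex.toLex_lt_toLex.2 (Or.inr ⟨?_, by dsimp only; omega⟩))
    dsimp only; rw [h1]
  clear he
  obtain ⟨m, z, wl, wr, hz, hadj, hl, hr', hne, al, ar⟩ := e
  set e : Ear G S r := ⟨m, z, wl, wr, hz, hadj, hl, hr', hne, al, ar⟩ with he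
  have opt2' : ∀ (m' : ℕ) (z' : ℕ → V) (wl' wr' : V), (∀ i ≤ m', ∃ j ≤ m, z j = z' i) → (∀ i < m', G.Adj (z' i) (z' (i + 1))) →
      wl' ∈ S → wr' ∈ S → wl' ≠ wr' → G.Adj (z' 0) wl' → G.Adj (z' m') wr' → m ≤ m' := by
    intro m' z' wl' wr' q1 q2 q3 q4 q5 q6 q7
    refine opt2 ⟨m', z', wl', wr', fun i hi => ?_, q2, q3, q4, q5, q6, q7⟩ ?_
    · obtain ⟨j, hj, e⟩ := q1 i hi
      exact e ▸ hz j hj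
    · rintro _ ⟨i, hi, rfl⟩
      exact q1 i hi
  have inj : ∀ i j, i < j → j ≤ m → z i ≠ z j := by
    intro i j hij hj e
    have := opt2' (m - (j - i)) (fun t => if t ≤ i then z t else z (t + (j - i))) wl wr
      (fun t ht => ?_) (fun t ht => ?_) hl hr' hne (by simpa) ?_
    · omega
    · split_ifs with q
      · exact ⟨t, by omega, rfl⟩
      · exact ⟨_, by omega, rfl⟩
    · skip
      split_ifs with q1 q2 q2
      · exact hadj t (by omega)
      · have : t = i := by omega
        rw [this, e, show i + 1 + (j - i) = j + 1 by omega]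
        exact hadj j (by omega)
      · omega
      · rw [show t + 1 + (j - i) = t + (j - i) + 1 by omega]
        exact hadj _ (by omega)
    · skip
      split_ifs with q
      · have h1 : m - (j - i) = i := by omega
        have h2 : m = j := by omega
        rw [h1, e, ← h2]; exact ar
      · rw [show m - (j - i) + (j - i) = m by omega]; exact ar
  have ind : ∀ i j, i < j → j ≤ m → G.Adj (z i) (z j) → j = i + 1 := by
    intro i j hij hj e
    have := opt2' (m - (j - i - 1)) (fun t => if t ≤ i then z t else z (t + (j - i - 1))) wl wr
      (fun t ht => ?_) (fun t ht => ?_) hl hr' hne (by simpa) ?_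
    · omega
    · split_ifs with q
      · exact ⟨t, by omega, rfl⟩
      · exact ⟨_, by omega, rfl⟩
    · skip
      split_ifs with q1 q2 q2
      · exact hadj t (by omega)
      · have : t = i := by omega
        rw [this, show i + 1 + (j - i - 1) = j by omega]
        exact e
      · omega
      · rw [show t + 1 + (j - i - 1) = t + (j - i - 1) + 1 by omega]
        exact hadj _ (by omega)
    · skip
      rw [if_neg (by omega), show m - (j - i - 1) + (j - i - 1) = m by omega]; exact ar
  have sl : ∀ j ≤ m, ∀ s ∈ S, G.Adj (z j) s → s ≠ wl → j = m := by
    intro j hj s hs h1 h2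
    have := opt2' j z wl s (fun i hi => ⟨i, by omega, rfl⟩) (fun i hi => hadj i (by omega)) hl hs
      h2.symm al h1
    omega
  have sr : ∀ j ≤ m, ∀ s ∈ S, G.Adj (z j) s → s ≠ wr → j = 0 := by
    intro j hj s hs h1 h2
    have := opt2' (m - j) (fun t => z (t + j)) s wr (fun i hi => ⟨_, by omega, rfl⟩)
      (fun i hi => by
        rw [show i + 1 + j = i + j + 1 by omega]; exact hadj _ (by omega))
      hs hr' h2 (by simpa) (by simpa [Nat.sub_add_cancel hj])
    omega
  have zZ : ∀ i, i ≤ m → z i ∈ e.Z := fun i hi => ⟨i, hi, rfl⟩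
  have hrD : r ∈ e.D := Rc.refl ⟨hr, fun ⟨i, hi, q⟩ => (hz i hi).2 q⟩
  have DS : ∀ y ∈ e.D, y ∉ S := fun y hy => hy.mem.1
  have DZ : ∀ y ∈ e.D, y ∉ e.Z := fun y hy => hy.mem.2
  -- attachments
  let At : ℕ → Prop := fun k => k ≤ m ∧ ∃ d ∈ e.D, G.Adj d (z k)
  have hAt : ∀ d ∈ e.D, ∀ y, y ∉ S → y ∉ e.D → G.Adj d y → ∃ k, At k ∧ z k = y := by
    intro d hd y hy hyD h1
    by_cases hZ : y ∈ e.Z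
    · obtain ⟨k, hk, rfl⟩ := hZ
      exact ⟨k, ⟨hk, d, hd, h1⟩, rfl⟩
    · exact absurd (hd.adj h1 ⟨hy, hZ⟩) hyD
  let Y : Set V := Sᶜ \ e.D
  have zY : ∀ i, i ≤ m → z i ∈ Y := fun i hi => ⟨(hz i hi).1, fun q => DZ _ q (zZ i hi)⟩
  have gain : ∀ k, At k → ∀ x y s s', Rc G (Y \ {z k}) x y → G.Adj x s → G.Adj y s' → s ∈ S →
      s' ∈ S → s = s' := by
    intro k hk x y s s' hxy h1 h2 hs hs'
    by_contra hss
    obtain ⟨e', he'⟩ := ear_of_rc (G := G) (S := S) (r := r) (A := Y \ {z k})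
      (fun p hp => ⟨hp.1.1, fun q => hp.1.2 (by rw [show p = r from q]; exact hrD)⟩) hxy h1 h2 hs hs' hss
    have h3 : e.D ⊆ e'.D := by
      intro y hy
      refine (Rc.comp hy).mono ?_
      intro p hp
      exact ⟨DS p hp, fun q => (he' q).1.2 hp⟩
    obtain ⟨hkm, d, hd, hdk⟩ := hk
    have h4 : z k ∈ e'.D := (h3 hd).adj hdk ⟨(zY k hkm).1, fun q => (he' q).2 rfl⟩
    rw [opt1 e' h3] at h4
    exact (zY k hkm).2 h4
  have rightseq : ∀ k j, k < j → j ≤ m → Rc G (Y \ {z k}) (z j) (z m) := fun k j hkj hj =>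
    rc_seq hj (fun i q1 q2 => ⟨zY i q2, fun q => inj k i (by omega) q2 (Eq.symm q)⟩)
      (fun i q1 q2 => hadj i q2)
  have leftseq : ∀ k j, j < k → k ≤ m → Rc G (Y \ {z k}) (z j) (z 0) := fun k j hkj hj =>
    (rc_seq (A := Y \ {z k}) (Nat.zero_le j) (fun i q1 q2 => ⟨zY i (by omega), fun q => inj i k (by omega) hj q⟩)
      (fun i q1 q2 => hadj i (by omega))).symm
  have reach : ∀ k, At k → ∀ y ∈ Y, y ≠ z k → ∃ j, At j ∧ j ≠ k ∧ Rc G (Y \ {z k}) y (z j) := by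
    intro k hk y hy hyk
    by_contra hno
    push Not at hno
    let X := {p | Rc G (Y \ {z k}) y p}
    have hyX : y ∈ X := Rc.refl ⟨hy, hyk⟩
    have hrX : r ∉ X := fun q => q.mem.1.2 hrD
    have out : ∀ p ∈ X, ∀ q ∉ X, G.Adj p q → q ≠ z k → q ∈ S := by
      intro p hp q hq hpq hqk
      by_contra hqS
      by_cases hqD : q ∈ e.D
      · obtain ⟨j, hj, hjp⟩ := hAt q hqD p hp.mem.1.1 hp.mem.1.2 hpq.symm
        refine hno j hj (fun q => ?_) (hjp ▸ hp)
        exact hp.mem.2 (by rw [← hjp, q]; rfl)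
      · exact hq (hp.adj hpq ⟨⟨hqS, hqD⟩, hqk⟩)
    have hrk : r ≠ z k := fun q => (hz k hk.1).2 q.symm
    obtain ⟨p, hp, q, hq, hpq, hqk, -⟩ := hG X y r (z k) (z k) hyX hrX hyk hyk hrk hrk
    have hqS := out p hp q hq hpq hqk
    obtain ⟨p', hp', q', hq', hpq', hqk', hqq⟩ := hG X y r (z k) q hyX hrX hyk
      (fun q => hy.1 (q ▸ hqS)) hrk (fun e => hr (e ▸ hqS))
    exact hqq (gain k hk _ _ _ _ (hp'.symm.trans hp) hpq' hpq (out p' hp' q' hq' hpq' hqk') hqS)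
  have nlr : ∀ k, At k → ∀ y, Rc G (Y \ {z k}) y (z 0) → Rc G (Y \ {z k}) y (z m) → False :=
    fun k hk y h1 h2 => hne (gain k hk _ _ _ _ (h1.symm.trans h2) al ar hl hr')
  have lor : ∀ k, At k → ∀ y ∈ Y, y ≠ z k → Rc G (Y \ {z k}) y (z 0) ∨ Rc G (Y \ {z k}) y (z m) := by
    intro k hk y hy hyk
    obtain ⟨j, hj, hjk, hr⟩ := reach k hk y hy hyk
    rcases lt_or_gt_of_ne hjk with q | q
    · exact Or.inl (hr.trans (leftseq k j q hk.1))
    · exact Or.inr (hr.trans (rightseq k j q hj.1))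
  have at_ex : ∃ k, At k := by
    obtain ⟨p, hp, q, hq, hpq, h1, h2⟩ := (hcon r hr (z 0) (hz 0 (by omega)).1).cut hrD
      (fun q => (zY 0 (by omega)).2 q)
    obtain ⟨k, hk, -⟩ := hAt p hp q h2 hq hpq
    exact ⟨k, hk⟩
  have atfin : {k | At k}.Finite := (Set.finite_Iic m).subset (fun k hk => hk.1)
  have at_m : At m := by
    obtain ⟨k, hk, hmax⟩ := Set.exists_max_image {k | At k} id atfin at_ex
    by_cases hkm : k = m
    · exact hkm ▸ hk
    · have hk1 : At k := hk
      have := hk1.1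
      obtain ⟨j, hj, hjk, hrc⟩ := reach k hk (z m) (zY m le_rfl) (fun q => inj k m (by omega) le_rfl q.symm)
      have : j < k := lt_of_le_of_ne (hmax j hj) hjk
      exact (nlr k hk (z m) (hrc.trans (leftseq k j this hk1.1)) (rightseq k m (by omega) le_rfl)).elim
  have at_0 : At 0 := by
    obtain ⟨k, hk, hmin⟩ := Set.exists_min_image {k | At k} id atfin at_ex
    by_cases hkm : k = 0
    · exact hkm ▸ hk
    · have hk1 : At k := hk
      obtain ⟨j, hj, hjk, hrc⟩ := reach k hk (z 0) (zY 0 (by omega)) (fun q => inj 0 k (by omega) hk1.1 q)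
      have : k < j := lt_of_le_of_ne (hmin j hj) (Ne.symm hjk)
      exact (nlr k hk (z 0) (leftseq k 0 (by omega) hk1.1) (hrc.trans (rightseq k j this hj.1))).elim
  have hW : ∀ w ∈ Y, w ∉ e.Z → False := by
    intro w hw hwZ
    have wz : ∀ k, k ≤ m → w ≠ z k := fun k hk q => hwZ (q ▸ zZ k hk)
    have wS : ∀ w ∈ Y, w ∉ e.Z → ∀ s ∈ S, ¬ G.Adj w s := by
      intro w hw hwZ s hs hws
      have wz : ∀ k, k ≤ m → w ≠ z k := fun k hk q => hwZ (q ▸ zZ k hk)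
      have h1 := (lor m at_m w hw (wz m le_rfl)).resolve_right (fun q => q.mem.2 rfl)
      have h2 := (lor 0 at_0 w hw (wz 0 (by omega))).resolve_left (fun q => q.mem.2 rfl)
      have e1 := gain m at_m _ _ _ _ h1 hws al hs hl
      have e2 := gain 0 at_0 _ _ _ _ h2 hws ar hs hr'
      exact hne (e1.symm.trans e2)
    have h0 := (lor 0 at_0 w hw (wz 0 (by omega))).resolve_left (fun q => q.mem.2 rfl)
    obtain ⟨α, hα, hαmax⟩ := Set.exists_max_image {k | At k ∧ Rc G (Y \ {z k}) w (z m)} id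
      (atfin.subset (fun k hk => hk.1)) ⟨0, at_0, h0⟩
    have hα1 : At α := hα.1
    have hαm : α < m := lt_of_le_of_ne hα1.1 (fun q => hα.2.mem.2 (by rw [q]; rfl))
    obtain ⟨β, hβ, hβmin⟩ := Set.exists_min_image {k | At k ∧ α < k} id
      (atfin.subset (fun k hk => hk.1)) ⟨m, at_m, hαm⟩
    have hβ1 : At β := hβ.1
    have hαβ : α < β := hβ.2
    have hβl : Rc G (Y \ {z β}) w (z 0) := (lor β hβ1 w hw (wz β hβ1.1)).resolve_right (fun q => by
      have := hαmax β ⟨hβ1, q⟩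
      simp only [id] at this; omega)
    let X := {p | Rc G (Y \ {z α, z β}) w p}
    have hwX : w ∈ X := Rc.refl ⟨hw, by
      rintro (q | q)
      · exact wz α hα1.1 q
      · exact wz β hβ1.1 q⟩
    have hrX : r ∉ X := fun q => q.mem.1.2 hrD
    have noat : ∀ γ, At γ → z γ ∉ X := by
      intro γ hγ hX
      rcases lt_trichotomy γ α with q | q | q
      · refine nlr α hα1 w ?_ hα.2
        exact (Rc.mono (B := Y \ {z α}) hX (fun p hp => ⟨hp.1, fun q => hp.2 (Or.inl q)⟩)).trans (leftseq α γ q hα1.1)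
      · exact hX.mem.2 (Or.inl (by rw [q]))
      · rcases lt_trichotomy γ β with q' | q' | q'
        · have := hβmin γ ⟨hγ, q⟩
          simp only [id] at this; omega
        · exact hX.mem.2 (Or.inr (by rw [q']; rfl))
        · refine nlr β hβ1 w hβl ?_
          exact (Rc.mono (B := Y \ {z β}) hX (fun p hp => ⟨hp.1, fun q => hp.2 (Or.inr q)⟩)).trans
            (rightseq β γ q' hγ.1)
    obtain ⟨p, hp, q, hq, hpq, hq1, hq2⟩ := hG X w r (z α) (z β) hwX hrX (wz α hα1.1) (wz β hβ1.1)
      (fun q => (hz α hα1.1).2 q.symm) (fun q => (hz β hβ1.1).2 q.symm)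
    have hpY : p ∈ Y := hp.mem.1
    by_cases hqS : q ∈ S
    · by_cases hpZ : p ∈ e.Z
      · obtain ⟨j, hj, rfl⟩ := hpZ
        by_cases hql : q = wl
        · have : j = 0 := sr j hj q hqS hpq (hql ▸ hne)
          subst this
          exact noat _ at_0 hp
        · have : j = m := sl j hj q hqS hpq hql
          subst this
          exact noat _ at_m hp
      · exact wS p hpY hpZ q hqS hpq
    · by_cases hqD : q ∈ e.D
      · obtain ⟨j, hj, hjp⟩ := hAt q hqD p hpY.1 hpY.2 hpq.symm
        exact noat j hj (hjp ▸ hp)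
      · refine hq (Rc.adj hp hpq ⟨⟨hqS, hqD⟩, ?_⟩)
        rintro (q | q)
        · exact hq1 q
        · exact hq2 q
  refine ⟨m, z, wl, wr, fun i hi => (hz i hi).1, hadj, hl, hr', hne, al, ar, ?_, ind, ?_, ?_⟩
  · intro i j hi hj q
    rcases lt_trichotomy i j with h | h | h
    · exact absurd q (inj i j h hj)
    · exact h
    · exact absurd q.symm (inj j i h hi)
  · intro hm j hj s hs hjs
    by_cases h1 : s = wl
    · exact Or.inl ⟨sr j hj s hs hjs (h1 ▸ hne), h1⟩
    · have h2 := sl j hj s hs hjs h1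
      refine Or.inr ⟨h2, ?_⟩
      by_contra h3
      have := sr j hj s hs hjs h3
      omega
  · have hsub : ∀ x, x ∉ S → x ∉ e.Z → x ∈ e.D := fun x h1 h2 => by
      by_contra h3; exact hW x ⟨h1, h3⟩ h2
    intro x hx y hy
    have hx' := hsub x (fun q => hx (Or.inl q)) (fun q => hx (Or.inr q))
    have hy' := hsub y (fun q => hy (Or.inl q)) (fun q => hy (Or.inr q))
    exact (Rc.trans (Rc.symm hx') hy').mono (fun p hp => by
      rintro (q | q)
      · exact hp.1 q
      · exact hp.2 q)

end ear

end PB_sec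

section PC1_sec

section good
variable {V : Type u} {G : SimpleGraph V} {ang : V → V → ℝ}

/-- opposite neighbours -/
def Opp (G : SimpleGraph V) (ang : V → V → ℝ) (v x y : V) : Prop :=
  ∃ h h', G.Adj v h ∧ G.Adj v h' ∧ cyc (ang v x) (ang v h) (ang v y) ∧
    cyc (ang v y) (ang v h') (ang v x)

/-- bad tree neighbourhoods -/
def Bd (G : SimpleGraph V) (ang : V → V → ℝ) (v : V) (N : Set V) : Prop :=
  ∃ x ∈ N, ∃ y ∈ N, ∃ h h', G.Adj v h ∧ G.Adj v h' ∧ h ∉ N ∧ h' ∉ N ∧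
    cyc (ang v x) (ang v h) (ang v y) ∧ cyc (ang v y) (ang v h') (ang v x)

lemma Opp.symm {v x y : V} (h : Opp G ang v x y) : Opp G ang v y x := by
  obtain ⟨h, h', a, b, c, d⟩ := h
  exact ⟨h', h, b, a, d, c⟩

lemma cyc_ne {a b c : ℝ} (h : cyc a b c) : a ≠ b ∧ b ≠ c ∧ a ≠ c := by
  unfold cyc at h
  refine ⟨?_, ?_, ?_⟩ <;> rintro rfl <;> grind

lemma cyc_asymm {a b c : ℝ} (h : cyc a b c) (h' : cyc c b a) : False := by
  unfold cyc at h h'; grind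

lemma cover [Finite V] (hd : ∀ v, (G.neighborSet v).ncard ≤ 4) {v x y h h' : V}
    (ax : G.Adj v x) (ay : G.Adj v y) (ah : G.Adj v h) (ah' : G.Adj v h')
    (c1 : cyc (ang v x) (ang v h) (ang v y)) (c2 : cyc (ang v y) (ang v h') (ang v x))
    {k : V} (ak : G.Adj v k) : k = x ∨ k = y ∨ k = h ∨ k = h' := by
  classical
  by_contra hk
  push Not at hk
  obtain ⟨k1, k2, k3, k4⟩ := hk
  have hh : h ≠ h' := by rintro rfl; exact cyc_asymm c1 c2
  obtain ⟨n1, n2, n3⟩ := cyc_ne c1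
  obtain ⟨m1, m2, -⟩ := cyc_ne c2
  have e1 : x ≠ h := fun e => n1 (by rw [e])
  have e2 : h ≠ y := fun e => n2 (by rw [e])
  have e3 : x ≠ y := fun e => n3 (by rw [e])
  have e4 : y ≠ h' := fun e => m1 (by rw [e])
  have e5 : h' ≠ x := fun e => m2 (by rw [e])
  have hs : (({k, x, y, h, h'} : Finset V) : Set V) ⊆ G.neighborSet v := by
    intro p hp
    simp only [Finset.coe_insert, Finset.coe_singleton, Set.mem_insert_iff, Set.mem_singleton_iff] at hp
    rcases hp with rfl | rfl | rfl | rfl | rfl <;> assumption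
  have := Set.ncard_le_ncard hs
  rw [Set.ncard_coe_finset] at this
  have h5 : ({k, x, y, h, h'} : Finset V).card = 5 := by
    rw [Finset.card_insert_of_notMem, Finset.card_insert_of_notMem, Finset.card_insert_of_notMem,
      Finset.card_insert_of_notMem, Finset.card_singleton]
    all_goals simp only [Finset.mem_insert, Finset.mem_singleton]
    all_goals tauto
  have := hd v
  omega

lemma bd_pair [Finite V] (hd : ∀ v, (G.neighborSet v).ncard ≤ 4) {v : V} {N : Set V}
    (hN : ∀ x ∈ N, G.Adj v x) (h : Bd G ang v N) :
    ∃ x y, x ≠ y ∧ N = {x, y} ∧ Opp G ang v x y := by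
  obtain ⟨x, hx, y, hy, h, h', ah, ah', nh, nh', c1, c2⟩ := h
  refine ⟨x, y, fun e => (cyc_ne c1).2.2 (by rw [e]), ?_, h, h', ah, ah', c1, c2⟩
  ext k
  constructor
  · intro hk
    rcases cover hd (hN x hx) (hN y hy) ah ah' c1 c2 (hN k hk) with e | e | e | e
    · exact Or.inl e
    · exact Or.inr e
    · exact absurd (e ▸ hk) nh
    · exact absurd (e ▸ hk) nh'
  · rintro (e | e)
    · exact e ▸ hx
    · exact (show k = y from e) ▸ hy

lemma opp_unique [Finite V] (hd : ∀ v, (G.neighborSet v).ncard ≤ 4) {v x y y' : V}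
    (ax : G.Adj v x) (ay : G.Adj v y) (ay' : G.Adj v y')
    (h1 : Opp G ang v x y) (h2 : Opp G ang v x y') : y = y' := by
  obtain ⟨h, h', ah, ah', c1, c2⟩ := h1
  obtain ⟨k, k', ak, ak', d1, d2⟩ := h2
  have q := cover hd ax ay ah ah' c1 c2 ay'
  have q1 := cover hd ax ay ah ah' c1 c2 ak
  have q2 := cover hd ax ay ah ah' c1 c2 ak'
  unfold cyc at *
  rcases q with rfl | rfl | rfl | rfl
  · grind
  · rfl
  · exfalso
    rcases q1 with rfl | rfl | rfl | rfl <;> grind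
  · exfalso
    rcases q2 with rfl | rfl | rfl | rfl <;> grind

lemma bd_one [Finite V] (hd : ∀ v, (G.neighborSet v).ncard ≤ 4) {v l : V} {C : Set V}
    (hC : ∀ x ∈ C, G.Adj v x) (hl : G.Adj v l) (hlC : l ∉ C) (h : Bd G ang v (insert l C)) :
    ∃ q, C = {q} ∧ Opp G ang v q l := by
  obtain ⟨x, y, hne, e, ho⟩ := bd_pair hd (by rintro x (rfl | q); exacts [hl, hC x q]) h
  have hm : l ∈ ({x, y} : Set V) := e ▸ Set.mem_insert _ _
  rcases hm with rfl | hm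
  · refine ⟨y, ?_, ho.symm⟩
    ext k
    have := Set.ext_iff.1 e k
    simp only [Set.mem_insert_iff, Set.mem_singleton_iff] at this ⊢
    constructor
    · intro hk
      exact (this.1 (Or.inr hk)).resolve_left (fun e => hlC (e ▸ hk))
    · rintro rfl
      exact (this.2 (Or.inr rfl)).resolve_left (Ne.symm hne)
  · obtain rfl : l = y := hm
    refine ⟨x, ?_, ho⟩
    ext k
    have := Set.ext_iff.1 e k
    simp only [Set.mem_insert_iff, Set.mem_singleton_iff] at this ⊢
    constructor
    · intro hk
      exact (this.1 (Or.inr hk)).resolve_right (fun e => hlC (e ▸ hk))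
    · rintro rfl
      exact (this.2 (Or.inl rfl)).resolve_left hne

lemma bd_two [Finite V] (hd : ∀ v, (G.neighborSet v).ncard ≤ 4) {v l r : V} {C : Set V}
    (hC : ∀ x ∈ C, G.Adj v x) (hl : G.Adj v l) (hr : G.Adj v r) (hlr : l ≠ r)
    (h : Bd G ang v (insert l (insert r C))) : Opp G ang v l r := by
  obtain ⟨x, y, hne, e, ho⟩ := bd_pair hd (by rintro x (rfl | rfl | q); exacts [hl, hr, hC x q]) h
  have hm : l ∈ ({x, y} : Set V) := e ▸ Set.mem_insert _ _
  have hm' : r ∈ ({x, y} : Set V) := e ▸ Set.mem_insert_of_mem _ (Set.mem_insert _ _)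
  rcases hm with rfl | hm <;> rcases hm' with rfl | hm'
  · exact absurd rfl hlr
  · rwa [show r = y from hm']
  · rw [show l = y from hm]; exact ho.symm
  · exact absurd ((show l = y from hm).trans (show r = y from hm').symm) hlr

/-- children -/
def Ch (S : Set V) (par : V → V) (v : V) : Set V := {c | c ∉ S ∧ par c = v}

/-- tree neighbourhood of a chain vertex -/
def Nb (C : V → Set V) (y : ℕ → V) (i j : ℕ) : Set V :=
  C (y j) ∪ {x | (x = y (j - 1) ∧ j ≠ i + 1) ∨ (x = y (j + 1) ∧ j ≠ i)}

/-- neutral vertices -/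
def Ntr (G : SimpleGraph V) (ang : V → V → ℝ) (C : V → Set V) (v : V) : Prop :=
  (∃ x y, Opp G ang v x y) → ¬ ∃ q, C v = {q}

theorem chain_lemma [Finite V] (hd : ∀ v, (G.neighborSet v).ncard ≤ 4) (C : V → Set V)
    (y : ℕ → V) (n : ℕ) (hn : 1 ≤ n) (hC : ∀ j, 1 ≤ j → j ≤ n → ∀ x ∈ C (y j), G.Adj (y j) x)
    (hl : ∀ j, 1 ≤ j → j ≤ n → G.Adj (y j) (y (j - 1)) ∧ y (j - 1) ∉ C (y j))
    (hr : ∀ j, 1 ≤ j → j ≤ n → G.Adj (y j) (y (j + 1)) ∧ y (j + 1) ∉ C (y j))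
    (hlr : ∀ j, 1 ≤ j → j ≤ n → y (j - 1) ≠ y (j + 1))
    (hno : 2 ≤ n → ∀ j, 1 ≤ j → j ≤ n → ¬ Opp G ang (y j) (y (j - 1)) (y (j + 1))) :
    let good := fun i => ∀ j, 1 ≤ j → j ≤ n → ¬ Bd G ang (y j) (Nb C y i j)
    (∃ i ≤ n, good i) ∧ (Ntr G ang C (y 1) → good 0 ∧ ∃ i, 1 ≤ i ∧ i ≤ n ∧ good i) ∧
      (Ntr G ang C (y n) → good n ∧ ∃ i, i < n ∧ good i) := by
  classical
  intro good
  let α := fun j => Bd G ang (y j) (insert (y (j - 1)) (C (y j)))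
  let β := fun j => Bd G ang (y j) (insert (y (j + 1)) (C (y j)))
  have hα : ∀ j, 1 ≤ j → j ≤ n → α j → ∃ q, C (y j) = {q} ∧ Opp G ang (y j) q (y (j - 1)) :=
    fun j h1 h2 h => bd_one hd (hC j h1 h2) (hl j h1 h2).1 (hl j h1 h2).2 h
  have hβ : ∀ j, 1 ≤ j → j ≤ n → β j → ∃ q, C (y j) = {q} ∧ Opp G ang (y j) q (y (j + 1)) :=
    fun j h1 h2 h => bd_one hd (hC j h1 h2) (hr j h1 h2).1 (hr j h1 h2).2 h
  have nab : ∀ j, 1 ≤ j → j ≤ n → α j → β j → False := by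
    intro j h1 h2 h3 h4
    obtain ⟨q, e, o⟩ := hα j h1 h2 h3
    obtain ⟨q', e', o'⟩ := hβ j h1 h2 h4
    have : q = q' := by rw [e] at e'; exact Set.singleton_injective e'
    subst this
    exact hlr j h1 h2 (opp_unique hd (hC j h1 h2 q (by rw [e]; rfl)) (hl j h1 h2).1 (hr j h1 h2).1 o o')
  have ntα : ∀ j, 1 ≤ j → j ≤ n → Ntr G ang C (y j) → ¬ α j := fun j h1 h2 h3 h4 => by
    obtain ⟨q, e, o⟩ := hα j h1 h2 h4
    exact h3 ⟨_, _, o⟩ ⟨q, e⟩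
  have ntβ : ∀ j, 1 ≤ j → j ≤ n → Ntr G ang C (y j) → ¬ β j := fun j h1 h2 h3 h4 => by
    obtain ⟨q, e, o⟩ := hβ j h1 h2 h4
    exact h3 ⟨_, _, o⟩ ⟨q, e⟩
  have hgood : ∀ i, i ≤ n → (1 ≤ i → ¬ α i) → (i < n → ¬ β (i + 1)) → good i := by
    intro i hi h1 h2 j hj1 hj2 hb
    by_cases e1 : j = i
    · subst e1
      refine h1 hj1 ?_
      have : Nb C y j j = insert (y (j - 1)) (C (y j)) := by
        ext x; simp [Nb, or_comm]
      rwa [this] at hb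
    · by_cases e2 : j = i + 1
      · subst e2
        refine h2 (by omega) ?_
        have : Nb C y i (i + 1) = insert (y (i + 1 + 1)) (C (y (i + 1))) := by
          ext x; simp [Nb, or_comm]
        rwa [this] at hb
      · have : Nb C y i j = insert (y (j - 1)) (insert (y (j + 1)) (C (y j))) := by
          ext x; simp [Nb, e1, e2]; tauto
        rw [this] at hb
        exact hno (by omega) j hj1 hj2 (bd_two hd (hC j hj1 hj2) (hl j hj1 hj2).1 (hr j hj1 hj2).1
          (hlr j hj1 hj2) hb)
  -- scanning from the right
  have scan : ∀ i, i ≤ n → (i < n → ¬ β (i + 1)) → ∃ i' ≤ i, good i' ∧ (1 ≤ i → ¬ α 1 → 1 ≤ i') := by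
    intro i
    induction i with
    | zero => intro h1 h2; exact ⟨0, le_rfl, hgood 0 h1 (by omega) h2, by omega⟩
    | succ i ih =>
      intro h1 h2
      by_cases h3 : α (i + 1)
      · obtain ⟨i', hi', g1, g2⟩ := ih (by omega) (fun _ => nab _ (by omega) h1 h3)
        refine ⟨i', by omega, g1, fun _ h4 => ?_⟩
        by_cases e : i = 0
        · subst e; exact absurd h3 h4
        · exact g2 (by omega) h4
      · exact ⟨i + 1, le_rfl, hgood _ h1 (fun _ => h3) h2, fun _ _ => by omega⟩
  obtain ⟨i, hi, g, g'⟩ := scan n le_rfl (by omega)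
  refine ⟨⟨i, hi, g⟩, fun hN => ⟨hgood 0 (by omega) (by omega) (fun _ => ntβ 1 le_rfl hn hN),
    i, g' hn (ntα 1 le_rfl hn hN), hi, g⟩, fun hN => ⟨hgood n le_rfl (fun _ => ntα n hn le_rfl hN)
    (by omega), ?_⟩⟩
  obtain ⟨i', h1, h2, -⟩ := scan (n - 1) (by omega) (fun _ => by
    rw [Nat.sub_add_cancel hn]; exact ntβ n hn le_rfl hN)
  exact ⟨i', by omega, h2⟩

/-- forest condition -/
def Fst (G : SimpleGraph V) (S : Set V) (par : V → V) (rk : V → ℕ) : Prop :=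
  ∀ z, z ∉ S → G.Adj z (par z) ∧ (par z ∉ S → rk (par z) < rk z)

theorem glue (S : Set V) (y : ℕ → V) (n : ℕ) (h0 : y 0 ∈ S) (h1 : y (n + 1) ∈ S)
    (hy : ∀ j, 1 ≤ j → j ≤ n → y j ∉ S)
    (inj : ∀ i j, 1 ≤ i → i ≤ n → 1 ≤ j → j ≤ n → y i = y j → i = j)
    (adj : ∀ j, j ≤ n → G.Adj (y j) (y (j + 1)))
    (S' : Set V) (hS' : S' = S ∪ {x | ∃ j, 1 ≤ j ∧ j ≤ n ∧ y j = x})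
    (par' : V → V) (rk' : V → ℕ) (hF : Fst G S' par' rk') (i : ℕ) (hi : i ≤ n) :
    ∃ par rk, Fst G S par rk ∧
      (∀ j, 1 ≤ j → j ≤ n → insert (par (y j)) (Ch S par (y j)) = Nb (Ch S' par') y i j) ∧
      (∀ z, z ∉ S' → insert (par z) (Ch S par z) = insert (par' z) (Ch S' par' z)) ∧
      (∀ s ∈ S, Ch S par s = Ch S' par' s ∪
        {x | (x = y 1 ∧ s = y 0 ∧ 1 ≤ i) ∨ (x = y n ∧ s = y (n + 1) ∧ i < n)}) := by
  classical
  let idx : V → Option ℕ := fun x => if h : ∃ j, 1 ≤ j ∧ j ≤ n ∧ y j = x then some h.choose else none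
  let P : ℕ → V := fun j => if j ≤ i then y (j - 1) else y (j + 1)
  let par : V → V := fun x => if h : ∃ j, 1 ≤ j ∧ j ≤ n ∧ y j = x then P h.choose else par' x
  let rk : V → ℕ := fun x => if h : ∃ j, 1 ≤ j ∧ j ≤ n ∧ y j = x then
    (if h.choose ≤ i then h.choose else n + 1 - h.choose) else rk' x + n + 2
  have py : ∀ j, 1 ≤ j → j ≤ n → par (y j) = P j := by
    intro j q1 q2
    have h : ∃ k, 1 ≤ k ∧ k ≤ n ∧ y k = y j := ⟨j, q1, q2, rfl⟩
    simp only [par]; rw [dif_pos h]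
    rw [inj _ _ h.choose_spec.1 h.choose_spec.2.1 q1 q2 h.choose_spec.2.2]
  have ry : ∀ j, 1 ≤ j → j ≤ n → rk (y j) = if j ≤ i then j else n + 1 - j := by
    intro j q1 q2
    have h : ∃ k, 1 ≤ k ∧ k ≤ n ∧ y k = y j := ⟨j, q1, q2, rfl⟩
    simp only [rk]; rw [dif_pos h]
    rw [inj _ _ h.choose_spec.1 h.choose_spec.2.1 q1 q2 h.choose_spec.2.2]
  have po : ∀ x, x ∉ S' → par x = par' x ∧ rk x = rk' x + n + 2 := by
    intro x hx
    have : ¬ ∃ j, 1 ≤ j ∧ j ≤ n ∧ y j = x := fun q => hx (by rw [hS']; exact Or.inr q)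
    simp only [par, rk]; rw [dif_neg this, dif_neg this]; exact ⟨rfl, rfl⟩
  have cases' : ∀ x, x ∉ S → (∃ j, 1 ≤ j ∧ j ≤ n ∧ y j = x) ∨ x ∉ S' := by
    intro x hx
    by_cases h : ∃ j, 1 ≤ j ∧ j ≤ n ∧ y j = x
    · exact Or.inl h
    · right; rw [hS']; rintro (q | q)
      · exact hx q
      · exact h q
  have SS' : ∀ x, x ∉ S' → x ∉ S := fun x hx q => hx (by rw [hS']; exact Or.inl q)
  have yS' : ∀ j, 1 ≤ j → j ≤ n → y j ∈ S' := fun j q1 q2 => by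
    rw [hS']; exact Or.inr ⟨j, q1, q2, rfl⟩
  have chd : ∀ v, Ch S par v = Ch S' par' v ∪ {x | ∃ j, 1 ≤ j ∧ j ≤ n ∧ y j = x ∧ P j = v} := by
    intro v
    ext x
    constructor
    · rintro ⟨q1, q2⟩
      rcases cases' x q1 with ⟨j, a1, a2, rfl⟩ | q
      · exact Or.inr ⟨j, a1, a2, rfl, by rw [← py j a1 a2, q2]⟩
      · exact Or.inl ⟨q, by rw [← (po x q).1, q2]⟩
    · rintro (⟨q1, q2⟩ | ⟨j, a1, a2, rfl, a4⟩)
      · exact ⟨SS' x q1, by rw [(po x q1).1, q2]⟩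
      · exact ⟨hy j a1 a2, by rw [py j a1 a2, a4]⟩
  have Pm : ∀ k, 1 ≤ k → k ≤ n → P k ∈ S' := by
    intro k q1 q2
    simp only [P]
    split_ifs with q
    · by_cases e : k = 1
      · subst e; rw [hS']; exact Or.inl h0
      · exact yS' _ (by omega) (by omega)
    · by_cases e : k = n
      · subst e; rw [hS']; exact Or.inl h1
      · exact yS' _ (by omega) (by omega)
  have yne : ∀ j k, 1 ≤ j → j ≤ n → k ≤ n + 1 → y k = y j → k = j := by
    intro j k q1 q2 q3 e
    by_cases k0 : k = 0
    · subst k0; exact absurd (e ▸ h0) (hy j q1 q2)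
    · by_cases k1 : k = n + 1
      · subst k1; exact absurd (e ▸ h1) (hy j q1 q2)
      · exact inj k j (by omega) (by omega) q1 q2 e
  refine ⟨par, rk, ?_, ?_, ?_, ?_⟩
  · intro z hz
    rcases cases' z hz with ⟨j, a1, a2, rfl⟩ | q
    · rw [py j a1 a2, ry j a1 a2]
      simp only [P]
      split_ifs with q
      · refine ⟨?_, fun hS => ?_⟩
        · have := adj (j - 1) (by omega)
          rw [Nat.sub_add_cancel a1] at this
          exact this.symm
        · have : j ≠ 1 := fun e => hS (by rw [e]; exact h0)
          rw [ry _ (by omega) (by omega), if_pos (by omega)]; omega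
      · refine ⟨adj j a2, fun hS => ?_⟩
        have : j ≠ n := fun e => hS (by rw [e]; exact h1)
        rw [ry _ (by omega) (by omega), if_neg (by omega)]; omega
    · rw [(po z q).1, (po z q).2]
      refine ⟨(hF z q).1, fun hS => ?_⟩
      rcases cases' _ hS with ⟨j, a1, a2, e⟩ | q'
      · rw [← e, ry j a1 a2]
        split_ifs <;> omega
      · rw [(po _ q').2]
        have := (hF z q).2 q'
        omega
  · intro j a1 a2
    rw [chd, py j a1 a2]
    ext x
    simp only [Nb, Set.mem_insert_iff, Set.mem_union, Set.mem_setOf_eq]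
    constructor
    · rintro (rfl | q | ⟨k, b1, b2, rfl, b4⟩)
      · right
        simp only [P]
        split_ifs with q
        · exact Or.inl ⟨rfl, by omega⟩
        · exact Or.inr ⟨rfl, by omega⟩
      · exact Or.inl q
      · right
        simp only [P] at b4
        split_ifs at b4 with q
        · have := yne j _ a1 a2 (by omega) b4
          right; exact ⟨by rw [← this, Nat.sub_add_cancel b1], by omega⟩
        · have := yne j _ a1 a2 (by omega) b4
          left; exact ⟨by rw [← this]; rfl, by omega⟩
    · rintro (q | ⟨rfl, q⟩ | ⟨rfl, q⟩)
      · exact Or.inr (Or.inl q)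
      · by_cases e : j ≤ i
        · left; simp only [P]; rw [if_pos e]
        · right; right
          refine ⟨j - 1, by omega, by omega, rfl, ?_⟩
          simp only [P]; rw [if_neg (by omega), Nat.sub_add_cancel a1]
      · by_cases e : j ≤ i
        · right; right
          refine ⟨j + 1, by omega, by omega, rfl, ?_⟩
          simp only [P]; rw [if_pos (by omega)]; rfl
        · left; simp only [P]; rw [if_neg e]
  · intro z hz
    rw [chd, (po z hz).1]
    ext x
    simp only [Set.mem_insert_iff, Set.mem_union, Set.mem_setOf_eq]
    have : ¬ ∃ j, 1 ≤ j ∧ j ≤ n ∧ y j = x ∧ P j = z := by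
      rintro ⟨k, b1, b2, rfl, b4⟩
      exact hz (b4 ▸ Pm k b1 b2)
    simp only [this, or_false]
  · intro s hs
    rw [chd]
    ext x
    simp only [Set.mem_union, Set.mem_setOf_eq]
    refine or_congr Iff.rfl ⟨?_, ?_⟩
    · rintro ⟨k, b1, b2, rfl, b4⟩
      simp only [P] at b4
      split_ifs at b4 with q
      · by_cases e : k = 1
        · subst e; exact Or.inl ⟨rfl, b4.symm, q⟩
        · exact absurd (b4 ▸ hs) (hy _ (by omega) (by omega))
      · by_cases e : k = n
        · subst e; exact Or.inr ⟨rfl, b4.symm, by omega⟩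
        · exact absurd (b4 ▸ hs) (hy _ (by omega) (by omega))
    · rintro (⟨rfl, rfl, q⟩ | ⟨rfl, rfl, q⟩)
      · exact ⟨1, le_rfl, by omega, rfl, by simp only [P]; rw [if_pos q]⟩
      · exact ⟨n, by omega, le_rfl, rfl, by simp only [P]; rw [if_neg (by omega)]⟩

end good

end PC1_sec

section PC2_sec

section side
variable {V : Type u} {G : SimpleGraph V} {ang : V → V → ℝ}

lemma Rc.ipath {A : Set V} {x y : V} (h : Rc G A x y) : ∃ (m : ℕ) (z : ℕ → V), z 0 = x ∧ z m = y ∧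
    (∀ i ≤ m, z i ∈ A) ∧ (∀ i < m, G.Adj (z i) (z (i + 1))) ∧
    ∀ i j, i ≤ m → j ≤ m → z i = z j → i = j := by
  classical
  let P := fun m : ℕ => ∃ z : ℕ → V, z 0 = x ∧ z m = y ∧
    (∀ i ≤ m, z i ∈ A) ∧ (∀ i < m, G.Adj (z i) (z (i + 1)))
  have hP : ∃ m, P m := by obtain ⟨m, z, hz⟩ := h.path; exact ⟨m, z, hz⟩
  obtain ⟨z, z0, z1, z2, z3⟩ := Nat.find_spec hP
  have key : ∀ i j, i < j → j ≤ Nat.find hP → z i ≠ z j := by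
    intro i j hij hj e
    have hlt : Nat.find hP - (j - i) < Nat.find hP := by omega
    refine Nat.find_min hP hlt ⟨fun t => if t ≤ i then z t else z (t + (j - i)), ?_, ?_, ?_, ?_⟩
    · simp [z0]
    · by_cases h : Nat.find hP - (j - i) ≤ i
      · have : Nat.find hP = j := by omega
        have h2 : Nat.find hP - (j - i) = i := by omega
        simp only [h2, le_refl, if_true]
        rw [e, ← this, z1]
      · simp only [h, if_false]
        rw [show Nat.find hP - (j - i) + (j - i) = Nat.find hP by omega, z1]
    · intro t ht
      dsimp only
      split_ifs
      · exact z2 _ (by omega)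
      · exact z2 _ (by omega)
    · intro t ht
      dsimp only
      by_cases h1 : t + 1 ≤ i
      · rw [if_pos (by omega), if_pos h1]; exact z3 _ (by omega)
      · by_cases h2 : t ≤ i
        · have : t = i := by omega
          subst this
          rw [if_pos h2, if_neg h1, e, show t + 1 + (j - t) = j + 1 by omega]
          exact z3 _ (by omega)
        · rw [if_neg h2, if_neg h1, show t + 1 + (j - i) = t + (j - i) + 1 by omega]
          exact z3 _ (by omega)
  refine ⟨_, z, z0, z1, z2, z3, fun i j hi hj e => ?_⟩
  rcases lt_trichotomy i j with h | h | h
  · exact absurd e (key i j h hj)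
  · exact h
  · exact absurd e.symm (key j i h hi)

lemma same_side_c (hR : Rot G ang) {n : ℕ} (c : ZMod n → V) (hn : 3 ≤ n) (ci : Function.Injective c)
    (ca : ∀ i, G.Adj (c i) (c (i + 1))) (Q : Set V) (hQ : Cnn G Q) (hcQ : ∀ i, c i ∉ Q)
    (i : ZMod n) (hi : ∀ h, G.Adj (c i) h → h ≠ c (i - 1) → h ≠ c (i + 1) → h ∈ Q) :
    ¬ Opp G ang (c i) (c (i - 1)) (c (i + 1)) := by
  rintro ⟨h, h', ah, ah', c1, c2⟩
  obtain ⟨S, s1, s2, s3⟩ := hR.side n c hn ci ca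
  have n1 := cyc_ne c1
  have n2 := cyc_ne c2
  have a1 : h ≠ c (i - 1) := fun e => n1.1 (by rw [e])
  have a2 : h ≠ c (i + 1) := fun e => n1.2.1 (by rw [e])
  have b1 : h' ≠ c (i - 1) := fun e => n2.2.1 (by rw [e])
  have b2 : h' ≠ c (i + 1) := fun e => n2.1 (by rw [e])
  have hq := hi h ah a1 a2
  have hq' := hi h' ah' b1 b2
  have off : ∀ u v, u ∈ Q → ∀ i, s(u, v) ≠ s(c i, c (i + 1)) := by
    intro u v hu i e
    rw [Sym2.eq_iff] at e
    rcases e with e | e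
    · exact hcQ _ (e.1 ▸ hu)
    · exact hcQ _ (e.1 ▸ hu)
  have base : ∀ w ∈ Q, ∀ x y, G.Adj w x → G.Adj w y → (S w x ↔ S w y) := fun w hw =>
    s2 w (fun i e => hcQ i (e ▸ hw))
  have conn : ∀ z, Rc G Q h z → ∀ x y, G.Adj h x → G.Adj z y → (S h x ↔ S z y) := by
    rintro z ⟨-, hz⟩
    induction hz with
    | refl => exact base h hq
    | @tail p q hp hpq ih =>
      intro x y ax ay
      rw [ih x q ax hpq.1, s1 p q hpq.1 (off p q (Rc.mem ⟨hq, hp⟩))]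
      exact base q hpq.2 _ _ hpq.1.symm ay
  have e := conn h' (hQ h hq h' hq') (c i) (c i) ah.symm ah'.symm
  rw [s1 _ _ ah.symm (off _ _ hq), s1 _ _ ah'.symm (off _ _ hq'), s3 i h ah a1 a2,
    s3 i h' ah' b1 b2] at e
  exact cyc_asymm (e.1 c1) c2

lemma same_side (hR : Rot G ang) (f : ℕ → V) (m : ℕ) (hm : 2 ≤ m)
    (finj : ∀ i j, i ≤ m → j ≤ m → f i = f j → i = j)
    (fadj : ∀ i < m, G.Adj (f i) (f (i + 1))) (fcl : G.Adj (f m) (f 0))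
    (Q : Set V) (hQ : Cnn G Q) (hcQ : ∀ i ≤ m, f i ∉ Q)
    (j : ℕ) (hj : j ≤ m) (l r : V) (hl : l = f (if j = 0 then m else j - 1))
    (hr : r = f (if j = m then 0 else j + 1))
    (hi : ∀ h, G.Adj (f j) h → h ≠ l → h ≠ r → h ∈ Q) :
    ¬ Opp G ang (f j) l r := by
  let c : ZMod (m + 1) → V := fun i => f i.val
  have cv : ∀ j, j ≤ m → c (j : ZMod (m + 1)) = f j := fun j hj => by
    simp only [c, ZMod.val_natCast, Nat.mod_eq_of_lt (Nat.lt_succ_of_le hj)]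
  have rep : ∀ i : ZMod (m + 1), ∃ j, j ≤ m ∧ i = (j : ZMod (m + 1)) := fun i =>
    ⟨i.val, Nat.lt_succ_iff.1 (ZMod.val_lt i), (ZMod.natCast_zmod_val i).symm⟩
  have hz0 : ((m : ℕ) : ZMod (m + 1)) + 1 = 0 := by
    have := ZMod.natCast_self (m + 1); rwa [Nat.cast_add, Nat.cast_one] at this
  have hc0 : c 0 = f 0 := by have := cv 0 (by omega); rwa [Nat.cast_zero] at this
  have nx : ∀ j ≤ m, c ((j : ZMod (m + 1)) + 1) = f (if j = m then 0 else j + 1) := by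
    intro j hj
    split_ifs with h
    · rw [h, hz0, hc0]
    · rw [← cv (j + 1) (by omega), Nat.cast_add, Nat.cast_one]
  have pv : ∀ j ≤ m, c ((j : ZMod (m + 1)) - 1) = f (if j = 0 then m else j - 1) := by
    intro j hj
    split_ifs with h
    · rw [h, Nat.cast_zero, ← cv m le_rfl]; congr 1; linear_combination -hz0
    · rw [← cv (j - 1) (by omega), Nat.cast_sub (by omega), Nat.cast_one]
  have := same_side_c hR c (by omega) ?_ ?_ Q hQ ?_ (j : ZMod (m + 1)) ?_
  · rwa [cv j hj, nx j hj, pv j hj, ← hl, ← hr] at this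
  · intro a b e
    obtain ⟨i, hi, rfl⟩ := rep a
    obtain ⟨k, hk, rfl⟩ := rep b
    rw [cv i hi, cv k hk] at e
    rw [finj i k hi hk e]
  · intro a
    obtain ⟨i, hi, rfl⟩ := rep a
    rw [cv i hi, nx i hi]
    split_ifs with h
    · rw [h]; exact fcl
    · exact fadj i (by omega)
  · intro a
    obtain ⟨i, hi, rfl⟩ := rep a
    rw [cv i hi]; exact hcQ i hi
  · rw [cv j hj, nx j hj, pv j hj, ← hl, ← hr]; exact hi

end side

end PC2_sec

section PC3_sec

section claim
variable {V : Type u} {G : SimpleGraph V} {ang : V → V → ℝ}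

lemma union_ne_sing {A : Set V} {p q : V} {T : Set V} (hA : A = {q}) (hp : p ∈ T) (hpq : p ∉ A) :
    ¬ ∃ r, A ∪ T = {r} := by
  rintro ⟨r, hr⟩
  have h1 : q ∈ ({r} : Set V) := hr ▸ Or.inl (hA ▸ rfl)
  have h2 : p ∈ ({r} : Set V) := hr ▸ Or.inr hp
  apply hpq
  rw [hA, show p = r from h2]
  exact (show q = r from h1).symm

theorem claim [Finite V] (hG : NoCut G) (hR : Rot G ang) (hd : ∀ v, (G.neighborSet v).ncard ≤ 4) :
    ∀ (k : ℕ) (S : Set V) (w : V), Sᶜ.ncard = k → Cnn G S → Cnn G Sᶜ → (∀ u, ∃ s ∈ S, s ≠ u) →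
      w ∈ S → ∃ par rk, Fst G S par rk ∧ (∀ z, z ∉ S → ¬ Bd G ang z (insert (par z) (Ch S par z))) ∧
        Ntr G ang (Ch S par) w := by
  classical
  intro k
  induction k using Nat.strong_induction_on with
  | _ k ih =>
  intro S w hk hS hSc h2 hw
  rcases Set.eq_empty_or_nonempty Sᶜ with he | hne
  · have hall : ∀ z, z ∈ S := fun z => by
      by_contra h
      have : z ∈ Sᶜ := h
      rw [he] at this; exact this
    refine ⟨id, fun _ => 0, fun z hz => absurd (hall z) hz, fun z hz => absurd (hall z) hz, ?_⟩
    rintro - ⟨q, hq⟩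
    have : q ∈ Ch S id w := hq ▸ rfl
    exact this.1 (hall q)
  obtain ⟨m, z, wl, wr, z1, z2, hwl, hwr, hlr, al, ar, zi, zc, zS, hcn⟩ := ear_lemma hG S hSc hne h2
  let n := m + 1
  let y : ℕ → V := fun t => if t = 0 then wl else if t ≤ m + 1 then z (t - 1) else wr
  have y0 : y 0 = wl := by simp [y]
  have yl : y (n + 1) = wr := by simp [y, n]
  have yz : ∀ j, 1 ≤ j → j ≤ n → y j = z (j - 1) := by
    intro j h1 h2; simp only [y]; rw [if_neg (by omega), if_pos h2]
  have yS : ∀ j, 1 ≤ j → j ≤ n → y j ∉ S := by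
    intro j h1 h2; rw [yz j h1 h2]; exact z1 _ (by omega)
  have yadj : ∀ j, j ≤ n → G.Adj (y j) (y (j + 1)) := by
    intro j hj
    rcases Nat.eq_zero_or_pos j with h | h
    · subst h; rw [y0, yz 1 le_rfl (by omega)]; exact al.symm
    · rcases hj.lt_or_eq with h' | h'
      · rw [yz j h hj, yz (j + 1) (by omega) (by omega)]
        have := z2 (j - 1) (by omega)
        rwa [show j - 1 + 1 = j by omega] at this
      · rw [h', yl, yz n (by omega) le_rfl]; exact ar
  have yinj : ∀ i j, i ≤ n + 1 → j ≤ n + 1 → y i = y j → i = j := by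
    have key : ∀ i j, i < j → j ≤ n + 1 → y i ≠ y j := by
      intro i j hij hj e
      rcases Nat.eq_zero_or_pos i with h | h
      · subst h
        rcases hj.lt_or_eq with h' | h'
        · exact yS j hij (by omega) (by rw [← e, y0]; exact hwl)
        · subst h'; rw [y0, yl] at e; exact hlr e
      · rcases hj.lt_or_eq with h' | h'
        · rw [yz i h (by omega), yz j (by omega) (by omega)] at e
          have := zi _ _ (by omega) (by omega) e
          omega
        · subst h'; exact yS i h (by omega) (by rw [e, yl]; exact hwr)
    intro i j hi hj e
    rcases lt_trichotomy i j with h | h | h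
    · exact absurd e (key i j h hj)
    · exact h
    · exact absurd e.symm (key j i h hi)
  let S' : Set V := S ∪ {x | ∃ j, 1 ≤ j ∧ j ≤ n ∧ y j = x}
  have hS'eq : S' = S ∪ {x | ∃ i ≤ m, z i = x} := by
    ext x
    refine or_congr Iff.rfl ⟨?_, ?_⟩
    · rintro ⟨j, a, b, rfl⟩; exact ⟨j - 1, by omega, (yz j a b).symm⟩
    · rintro ⟨i, a, rfl⟩; exact ⟨i + 1, by omega, by omega, by rw [yz _ (by omega) (by omega)]; rfl⟩
  have hQ : Cnn G S'ᶜ := by rw [hS'eq]; exact hcn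
  have yS' : ∀ j, j ≤ n + 1 → y j ∈ S' := by
    intro j hj
    rcases Nat.eq_zero_or_pos j with h | h
    · subst h; rw [y0]; exact Or.inl hwl
    · rcases hj.lt_or_eq with h' | h'
      · exact Or.inr ⟨j, h, by omega, rfl⟩
      · subst h'; rw [yl]; exact Or.inl hwr
  have hS' : Cnn G S' := by
    have from0 : ∀ x ∈ S', Rc G S' wl x := by
      rintro x (hx | ⟨j, -, b, rfl⟩)
      · exact (hS wl hwl x hx).mono Set.subset_union_left
      · induction j with
        | zero => rw [y0]; exact Rc.refl (Or.inl hwl)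
        | succ j ihj => exact (ihj (by omega)).adj (yadj j (by omega)) (yS' _ (by omega))
    intro x hx x' hx'
    exact (from0 x hx).symm.trans (from0 x' hx')
  have hlt : S'ᶜ.ncard < k := by
    rw [← hk]
    apply Set.ncard_lt_ncard _ (Set.toFinite _)
    refine ⟨Set.compl_subset_compl.2 Set.subset_union_left, fun h => ?_⟩
    exact h (show y 1 ∈ Sᶜ from yS 1 le_rfl (by omega)) (yS' 1 (by omega))
  have hno : 2 ≤ n → ∀ j, 1 ≤ j → j ≤ n → ¬ Opp G ang (y j) (y (j - 1)) (y (j + 1)) := by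
    intro hn j j1 j2
    obtain ⟨q, p, p0, p1, pS, pa, pi⟩ := (hS wr hwr wl hwl).ipath
    have hq : 1 ≤ q := by
      rcases Nat.eq_zero_or_pos q with h | h
      · subst h; exact absurd (p1.symm.trans p0) hlr
      · exact h
    let f : ℕ → V := fun t => if t ≤ n then y t else p (t - n - 1)
    have fy : ∀ t, t ≤ n + 1 → f t = y t := by
      intro t ht
      simp only [f]
      split_ifs with h
      · rfl
      · have : t = n + 1 := by omega
        subst this
        rw [yl, show n + 1 - n - 1 = 0 by omega, p0]
    have fp : ∀ t, n < t → f t = p (t - n - 1) := fun t ht => by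
      simp only [f]; rw [if_neg (by omega)]
    have := same_side hR f (n + q) (by omega) ?_ ?_ ?_ S'ᶜ hQ ?_ j (by omega) (y (j - 1)) (y (j + 1))
      (by rw [if_neg (by omega), fy _ (by omega)]) (by rw [if_neg (by omega), fy _ (by omega)]) ?_
    · rwa [fy j (by omega)] at this
    · have key : ∀ i j, i < j → j ≤ n + q → f i ≠ f j := by
        intro i j hij hj e
        by_cases h1 : j ≤ n
        · rw [fy i (by omega), fy j (by omega)] at e
          have := yinj i j (by omega) (by omega) e
          omega
        · rw [fp j (by omega)] at e
          by_cases h2 : i ≤ n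
          · rw [fy i (by omega)] at e
            rcases Nat.eq_zero_or_pos i with h | h
            · subst h
              rw [y0, ← p1] at e
              have := pi _ _ le_rfl (by omega) e
              omega
            · exact yS i h h2 (e ▸ pS _ (by omega))
          · rw [fp i (by omega)] at e
            have := pi _ _ (by omega) (by omega) e
            omega
      intro i j hi hj e
      rcases lt_trichotomy i j with h | h | h
      · exact absurd e (key i j h hj)
      · exact h
      · exact absurd e.symm (key j i h hi)
    · intro i hi
      by_cases h : i ≤ n
      · rw [fy i (by omega), fy (i + 1) (by omega)]; exact yadj i h
      · rw [fp i (by omega), fp (i + 1) (by omega), show i + 1 - n - 1 = i - n - 1 + 1 by omega]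
        exact pa _ (by omega)
    · rw [fp _ (by omega), fy 0 (by omega), y0, ← p1]
      have := pa (q - 1) (by omega)
      rwa [show q - 1 + 1 = q by omega, show q - 1 = n + q - n - 1 by omega] at this
    · intro i hi hc
      apply hc
      by_cases h : i ≤ n
      · rw [fy i (by omega)]; exact yS' i (by omega)
      · rw [fp i (by omega)]; exact Or.inl (pS _ (by omega))
    · intro h ah hl hr hmem
      rw [fy j (by omega)] at ah
      rw [yz j j1 j2] at ah
      rcases hmem with hs | ⟨i, i1, i2, rfl⟩
      · rcases zS (by omega) (j - 1) (by omega) h hs ah with ⟨e, rfl⟩ | ⟨e, rfl⟩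
        · rw [e, y0] at hl; exact hl rfl
        · rw [show j + 1 = n + 1 by omega, yl] at hr; exact hr rfl
      · have hij : i ≠ j - 1 := fun e => hl (by rw [e])
        have hij' : i ≠ j + 1 := fun e => hr (by rw [e])
        rw [yz i i1 i2] at ah
        rcases lt_trichotomy i j with h | h | h
        · have := zc (i - 1) (j - 1) (by omega) (by omega) ah.symm
          omega
        · subst h; exact G.loopless.irrefl _ ah
        · have := zc (j - 1) (i - 1) (by omega) (by omega) ah
          omega
  have chain : ∀ par' rk', Fst G S' par' rk' →
      let good := fun i => ∀ j, 1 ≤ j → j ≤ n → ¬ Bd G ang (y j) (Nb (Ch S' par') y i j)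
      (∃ i ≤ n, good i) ∧ (Ntr G ang (Ch S' par') (y 1) → good 0 ∧ ∃ i, 1 ≤ i ∧ i ≤ n ∧ good i) ∧
      (Ntr G ang (Ch S' par') (y n) → good n ∧ ∃ i, i < n ∧ good i) := by
    intro par' rk' hF
    refine chain_lemma hd (Ch S' par') y n (by omega) ?_ ?_ ?_ ?_ hno
    · rintro j j1 j2 x ⟨hx, e⟩
      rw [← e]; exact (hF x hx).1.symm
    · intro j j1 j2
      have := (yadj (j - 1) (by omega)).symm
      rw [show j - 1 + 1 = j by omega] at this
      exact ⟨this, fun h => h.1 (yS' _ (by omega))⟩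
    · intro j j1 j2
      exact ⟨yadj j j2, fun h => h.1 (yS' _ (by omega))⟩
    · intro j j1 j2 e
      have := yinj _ _ (by omega) (by omega) e
      omega
  have h2' : ∀ u, ∃ s ∈ S', s ≠ u := fun u => by
    obtain ⟨s, a, b⟩ := h2 u; exact ⟨s, Or.inl a, b⟩
  have fin : ∀ par' rk', Fst G S' par' rk' →
      (∀ z, z ∉ S' → ¬ Bd G ang z (insert (par' z) (Ch S' par' z))) → ∀ i, i ≤ n →
      (∀ j, 1 ≤ j → j ≤ n → ¬ Bd G ang (y j) (Nb (Ch S' par') y i j)) →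
      ((∃ x y, Opp G ang w x y) → ¬ ∃ q, Ch S' par' w ∪
        {x | (x = y 1 ∧ w = y 0 ∧ 1 ≤ i) ∨ (x = y n ∧ w = y (n + 1) ∧ i < n)} = {q}) →
      ∃ par rk, Fst G S par rk ∧ (∀ z, z ∉ S → ¬ Bd G ang z (insert (par z) (Ch S par z))) ∧
        Ntr G ang (Ch S par) w := by
    intro par' rk' hF hb i hi hg hnt
    obtain ⟨par, rk, g1, g2, g3, g4⟩ := glue (G := G) S y n (y0 ▸ hwl) (yl ▸ hwr) yS
      (fun i j a b c d e => yinj i j (by omega) (by omega) e) yadj S' rfl par' rk' hF i hi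
    refine ⟨par, rk, g1, ?_, ?_⟩
    · intro v hv
      by_cases hv' : v ∈ S'
      · rcases hv' with h | ⟨j, j1, j2, rfl⟩
        · exact absurd h hv
        · rw [g2 j j1 j2]; exact hg j j1 j2
      · rw [g3 v hv']; exact hb v hv'
    · unfold Ntr
      rw [g4 w hw]; exact hnt
  have ynw : y 0 ≠ y (n + 1) := by rw [y0, yl]; exact hlr
  have nch : ∀ par' j, j ≤ n + 1 → y j ∉ Ch S' par' w := fun par' j hj h => h.1 (yS' j hj)
  by_cases e1 : w = y 0
  · obtain ⟨par', rk', hF, hb, hN⟩ := ih _ hlt S' (y 1) rfl hS' hQ h2' (yS' 1 (by omega))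
    obtain ⟨-, hc, -⟩ := chain par' rk' hF
    obtain ⟨c0, i, i1, i2, hi⟩ := hc hN
    by_cases hs : ∃ q, Ch S' par' w = {q}
    · obtain ⟨q, hq⟩ := hs
      refine fin par' rk' hF hb i i2 hi fun _ => ?_
      exact union_ne_sing hq (Or.inl ⟨rfl, e1, i1⟩) (nch par' 1 (by omega))
    · refine fin par' rk' hF hb 0 (by omega) c0 fun _ => ?_
      rwa [show {x | (x = y 1 ∧ w = y 0 ∧ 1 ≤ 0) ∨ (x = y n ∧ w = y (n + 1) ∧ 0 < n)} = (∅ : Set V) from ?_,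
        Set.union_empty]
      ext x
      constructor
      · rintro (⟨-, -, h⟩ | ⟨-, h, -⟩)
        · omega
        · exact absurd (e1.symm.trans h) ynw
      · exact fun h => absurd h (Set.notMem_empty _)
  by_cases e2 : w = y (n + 1)
  · obtain ⟨par', rk', hF, hb, hN⟩ := ih _ hlt S' (y n) rfl hS' hQ h2' (yS' n (by omega))
    obtain ⟨-, -, hc⟩ := chain par' rk' hF
    obtain ⟨c0, i, i1, hi⟩ := hc hN
    by_cases hs : ∃ q, Ch S' par' w = {q}
    · obtain ⟨q, hq⟩ := hs
      refine fin par' rk' hF hb i i1.le hi fun _ => ?_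
      exact union_ne_sing hq (Or.inr ⟨rfl, e2, i1⟩) (nch par' n (by omega))
    · refine fin par' rk' hF hb n le_rfl c0 fun _ => ?_
      rwa [show {x | (x = y 1 ∧ w = y 0 ∧ 1 ≤ n) ∨ (x = y n ∧ w = y (n + 1) ∧ n < n)} = (∅ : Set V) from ?_,
        Set.union_empty]
      ext x
      constructor
      · rintro (⟨-, h, -⟩ | ⟨-, -, h⟩)
        · exact absurd h e1
        · omega
      · exact fun h => absurd h (Set.notMem_empty _)
  · obtain ⟨par', rk', hF, hb, hN⟩ := ih _ hlt S' w rfl hS' hQ h2' (Or.inl hw)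
    obtain ⟨⟨i, i1, hi⟩, -, -⟩ := chain par' rk' hF
    refine fin par' rk' hF hb i i1 hi ?_
    rwa [show {x | (x = y 1 ∧ w = y 0 ∧ 1 ≤ i) ∨ (x = y n ∧ w = y (n + 1) ∧ i < n)} = (∅ : Set V) from ?_,
      Set.union_empty]
    ext x
    constructor
    · rintro (⟨-, h, -⟩ | ⟨-, h, -⟩)
      · exact absurd h e1
      · exact absurd h e2
    · exact fun h => absurd h (Set.notMem_empty _)

end claim

end PC3_sec

section PC4_sec

section init
variable {V : Type u} {G : SimpleGraph V} {ang : V → V → ℝ}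

set_option maxHeartbeats 1000000 in
theorem rot_subham [Fintype V] (hG : NoCut G) (hR : Rot G ang) (hd : ∀ v, (G.neighborSet v).ncard ≤ 4)
    (hcard : 3 < Fintype.card V) : G.IsSubhamiltonian := by
  classical
  have avoid : ∀ s : Finset V, s.card ≤ 3 → ∃ x, x ∉ s := by
    intro s hs
    by_contra h
    push Not at h
    have : s = Finset.univ := Finset.eq_univ_of_forall h
    rw [this, Finset.card_univ] at hs
    omega
  obtain ⟨a0, -⟩ := avoid ∅ (by simp)
  obtain ⟨c0, hc0⟩ := avoid {a0} (by simp)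
  obtain ⟨d0, hd0⟩ := avoid {a0, c0} (Finset.card_le_two.trans (by omega))
  simp only [Finset.mem_insert, Finset.mem_singleton, not_or] at hc0 hd0
  obtain ⟨p, hp, b0, hb0, hab, -, -⟩ := hG {a0} a0 c0 d0 d0 rfl hc0 (Ne.symm hd0.1) (Ne.symm hd0.1)
    (Ne.symm hd0.2) (Ne.symm hd0.2)
  obtain rfl : p = a0 := hp
  have hb0 : b0 ≠ p := hb0
  let S : Set V := {p, b0}
  have hSc : Cnn G Sᶜ := by
    intro x hx y hy
    by_contra hcon
    have hx' : x ≠ p ∧ x ≠ b0 := by simpa [S] using hx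
    have hy' : y ≠ p ∧ y ≠ b0 := by simpa [S] using hy
    obtain ⟨r, hr, q, hq, ad, q1, q2⟩ := hG {z | Rc G Sᶜ x z} x y p b0 (Rc.refl hx) hcon hx'.1 hx'.2
      hy'.1 hy'.2
    refine hq (Rc.adj hr ad ?_)
    simp [S, q1, q2]
  have h2 : ∀ u, ∃ s ∈ S, s ≠ u := by
    intro u
    by_cases h : p = u
    · exact ⟨b0, by simp [S], h ▸ hb0⟩
    · exact ⟨p, by simp [S], h⟩
  have hne : Sᶜ.Nonempty := by
    obtain ⟨x, hx⟩ := avoid {p, b0} (Finset.card_le_two.trans (by omega))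
    exact ⟨x, by simpa [S] using hx⟩
  obtain ⟨m, z, a, b, z1, z2, hwl, hwr, hlr, al, ar, zi, zc, zS, hcn⟩ := ear_lemma hG S hSc hne h2
  have hSab : S = {a, b} := by
    have h1 : a = p ∨ a = b0 := by simpa [S] using hwl
    have h2 : b = p ∨ b = b0 := by simpa [S] using hwr
    rcases h1 with rfl | rfl <;> rcases h2 with rfl | rfl
    · exact absurd rfl hlr
    · rfl
    · exact Set.pair_comm _ _
    · exact absurd rfl hlr
  have hAab : G.Adj b a := by
    have h1 : a = p ∨ a = b0 := by simpa [S] using hwl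
    have h2 : b = p ∨ b = b0 := by simpa [S] using hwr
    rcases h1 with rfl | rfl <;> rcases h2 with rfl | rfl
    · exact absurd rfl hlr
    · exact hab.symm
    · exact hab
    · exact absurd rfl hlr
  clear_value S
  subst hSab
  let n := m + 2
  let y : ℕ → V := fun t => if t = 0 then a else if t ≤ m + 1 then z (t - 1) else if t = m + 2 then b else a
  have y0 : y 0 = a := by simp [y]
  have yn : y n = b := by simp [y, n]
  have yl : y (n + 1) = a := by simp [y, n]
  have yz : ∀ j, 1 ≤ j → j < n → y j = z (j - 1) := by
    intro j h1 h2; simp only [y]; rw [if_neg (by omega), if_pos (by omega)]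
  have za : ∀ i ≤ m, z i ≠ a ∧ z i ≠ b := fun i hi =>
    ⟨fun e => z1 i hi (e ▸ hwl), fun e => z1 i hi (e ▸ hwr)⟩
  have yS : ∀ j, 1 ≤ j → j ≤ n → y j ≠ a := by
    intro j h1 h2
    rcases h2.lt_or_eq with h | h
    · rw [yz j h1 h]; exact (za _ (by omega)).1
    · rw [h, yn]; exact hlr.symm
  have yadj : ∀ j, j ≤ n → G.Adj (y j) (y (j + 1)) := by
    intro j hj
    rcases Nat.eq_zero_or_pos j with h | h
    · subst h; rw [y0, yz 1 le_rfl (by omega)]; exact al.symm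
    · rcases hj.lt_or_eq with h' | h'
      · rcases (show j + 1 ≤ n from h').lt_or_eq with h'' | h''
        · rw [yz j h h', yz (j + 1) (by omega) (by omega)]
          have := z2 (j - 1) (by omega)
          rwa [show j - 1 + 1 = j by omega] at this
        · rw [h'', yn, yz j h h', show j - 1 = m by omega]; exact ar
      · rw [h', yl, yn]; exact hAab
  have yinj : ∀ i j, i ≤ n → j ≤ n → y i = y j → i = j := by
    have key : ∀ i j, i < j → j ≤ n → y i ≠ y j := by
      intro i j hij hj e
      rcases Nat.eq_zero_or_pos i with h | h
      · subst h
        exact yS j hij hj (by rw [← e, y0])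
      · rcases hj.lt_or_eq with h' | h'
        · rw [yz i h (by omega), yz j (by omega) (by omega)] at e
          have := zi _ _ (by omega) (by omega) e
          omega
        · rw [h', yn, yz i h (by omega)] at e; exact (za _ (by omega)).2 e
    intro i j hi hj e
    rcases lt_trichotomy i j with h | h | h
    · exact absurd e (key i j h hj)
    · exact h
    · exact absurd e.symm (key j i h hi)
  have chord : ∀ i j, i < j → j ≤ n → G.Adj (y i) (y j) → j = i + 1 ∨ (i = 0 ∧ j = n) := by
    intro i j hij hj ad
    rcases hj.lt_or_eq with h' | h'
    · rw [yz j (by omega) h'] at ad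
      rcases Nat.eq_zero_or_pos i with h | h
      · subst h
        rw [y0] at ad
        rcases Nat.eq_zero_or_pos m with hm | hm
        · omega
        · rcases zS hm (j - 1) (by omega) a (Or.inl rfl) ad.symm with ⟨e, -⟩ | ⟨-, e⟩
          · omega
          · exact absurd e hlr
      · rw [yz i h (by omega)] at ad
        have := zc _ _ (by omega) (by omega) ad
        omega
    · rcases Nat.eq_zero_or_pos i with h | h
      · exact Or.inr ⟨h, h'⟩
      · rw [h', yn, yz i h (by omega)] at ad
        rcases Nat.eq_zero_or_pos m with hm | hm
        · omega
        · rcases zS hm (i - 1) (by omega) b (Or.inr rfl) ad with ⟨-, e⟩ | ⟨e, -⟩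
          · exact absurd e.symm hlr
          · omega
  let S' : Set V := {a} ∪ {x | ∃ j, 1 ≤ j ∧ j ≤ n ∧ y j = x}
  have hS'eq : S' = {a, b} ∪ {x | ∃ i ≤ m, z i = x} := by
    ext x
    constructor
    · rintro (e | ⟨j, j1, j2, rfl⟩)
      · exact Or.inl (Or.inl e)
      · rcases j2.lt_or_eq with h | h
        · exact Or.inr ⟨j - 1, by omega, (yz j j1 h).symm⟩
        · exact Or.inl (Or.inr (h ▸ yn))
    · rintro ((e | e) | ⟨i, i1, rfl⟩)
      · exact Or.inl e
      · exact Or.inr ⟨n, by omega, le_rfl, yn.trans (show x = b from e).symm⟩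
      · exact Or.inr ⟨i + 1, by omega, by omega, yz _ (by omega) (by omega)⟩
  have hQ : Cnn G S'ᶜ := by rw [hS'eq]; exact hcn
  have yS' : ∀ j, j ≤ n + 1 → y j ∈ S' := by
    intro j hj
    rcases Nat.eq_zero_or_pos j with h | h
    · subst h; exact Or.inl y0
    · rcases hj.lt_or_eq with h' | h'
      · exact Or.inr ⟨j, h, by omega, rfl⟩
      · subst h'; exact Or.inl yl
  have S'y : ∀ x ∈ S', ∃ j ≤ n, y j = x := by
    rintro x (e | ⟨j, -, j2, e⟩)
    · exact ⟨0, by omega, y0.trans (show x = a from e).symm⟩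
    · exact ⟨j, j2, e⟩
  have hS' : Cnn G S' := by
    have from0 : ∀ x ∈ S', Rc G S' a x := by
      intro x hx
      obtain ⟨j, b, rfl⟩ := S'y x hx
      clear hx
      induction j with
      | zero => rw [y0]; exact Rc.refl (Or.inl rfl)
      | succ j ihj => exact (ihj (by omega)).adj (yadj j (by omega)) (yS' _ (by omega))
    intro x hx x' hx'
    exact (from0 x hx).symm.trans (from0 x' hx')
  have nonopp : ∀ j ≤ n, ¬ Opp G ang (y j) (y (if j = 0 then n else j - 1))
      (y (if j = n then 0 else j + 1)) := by
    intro j hj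
    refine same_side hR y n (by omega) yinj (fun i hi => yadj i hi.le) ?_ S'ᶜ hQ
      (fun i hi h => h (yS' i (by omega))) j hj _ _ rfl rfl ?_
    · rw [y0, yn]; exact hAab
    · intro h ah h1 h2 hmem
      obtain ⟨i, i2, rfl⟩ := S'y h hmem
      rcases lt_trichotomy i j with e | e | e
      · rcases chord i j e hj ah.symm with e' | ⟨e1, e2⟩
        · rw [if_neg (by omega), e'] at h1; exact h1 rfl
        · rw [if_pos e2, e1] at h2; exact h2 rfl
      · subst e; exact G.loopless.irrefl _ ah
      · rcases chord j i e i2 ah with e' | ⟨e1, e2⟩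
        · rw [if_neg (by omega), e'] at h2; exact h2 rfl
        · rw [if_pos e1, e2] at h1; exact h1 rfl
  obtain ⟨par', rk', hF, hb, hN⟩ := claim hG hR hd _ S' a rfl hS' hQ (by
    intro u
    obtain ⟨s, h1, h2⟩ := h2 u
    exact ⟨s, by rw [hS'eq]; exact Or.inl h1, h2⟩) (Or.inl rfl)
  have hCh : ∀ v, ∀ x ∈ Ch S' par' v, G.Adj v x := by
    rintro v x ⟨hx, e⟩
    rw [← e]; exact (hF x hx).1.symm
  obtain ⟨⟨i, i1, hi⟩, -, -⟩ := chain_lemma (ang := ang) hd (Ch S' par') y n (by omega)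
    (fun j _ _ => hCh _) (by
      intro j j1 j2
      have := (yadj (j - 1) (by omega)).symm
      rw [show j - 1 + 1 = j by omega] at this
      exact ⟨this, fun h => h.1 (yS' _ (by omega))⟩) (by
      intro j j1 j2
      exact ⟨yadj j j2, fun h => h.1 (yS' _ (by omega))⟩) (by
      intro j j1 j2 e
      rcases j2.lt_or_eq with h | h
      · have := yinj _ _ (by omega) (by omega) e
        omega
      · rw [h, yl] at e; exact yS (n - 1) (by omega) (by omega) e) (by
      intro _ j j1 j2
      have := nonopp j j2
      rw [if_neg (by omega)] at this
      split_ifs at this with h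
      · rw [h, yl]; rwa [y0, h] at this
      · exact this)
  obtain ⟨par, rk, g1, g2, g3, g4⟩ := glue (G := G) {a} y n y0 yl yS
      (fun i j a b c d e => yinj i j (by omega) (by omega) e) yadj S' rfl par' rk' hF i i1
  have nba : ¬ Bd G ang a (Ch {a} par a) := by
    intro hbd
    rw [g4 a rfl] at hbd
    have A1 : G.Adj a (y 1) := y0 ▸ yadj 0 (by omega)
    have An : G.Adj a (y n) := by rw [yn]; exact hAab.symm
    have h0 := nonopp 0 (by omega)
    rw [if_pos rfl, if_neg (by omega), y0] at h0
    have n1 : y 1 ∉ Ch S' par' a := fun h => h.1 (yS' _ (by omega))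
    have nn : y n ∉ Ch S' par' a := fun h => h.1 (yS' _ (by omega))
    rcases Nat.eq_zero_or_pos i with e | e
    · rw [show Ch S' par' a ∪ {x | (x = y 1 ∧ a = y 0 ∧ 1 ≤ i) ∨ (x = y n ∧ a = y (n + 1) ∧ i < n)} =
        insert (y n) (Ch S' par' a) from ?_] at hbd
      · obtain ⟨q, hq, ho⟩ := bd_one hd (hCh a) An nn hbd
        exact hN ⟨_, _, ho⟩ ⟨q, hq⟩
      · ext x
        have : 0 < n := by omega
        simp [e, y0, yl, this, or_comm]
    · rcases i1.lt_or_eq with e' | e'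
      · rw [show Ch S' par' a ∪ {x | (x = y 1 ∧ a = y 0 ∧ 1 ≤ i) ∨ (x = y n ∧ a = y (n + 1) ∧ i < n)} =
          insert (y n) (insert (y 1) (Ch S' par' a)) from ?_] at hbd
        · refine h0 (bd_two hd (hCh a) An A1 ?_ hbd)
          intro e
          have := yinj _ _ le_rfl (by omega) e
          omega
        · ext x
          have : 1 ≤ i := e
          simp only [Set.mem_union, Set.mem_setOf_eq, Set.mem_insert_iff, y0, yl, this, e', and_true]
          tauto
      · rw [show Ch S' par' a ∪ {x | (x = y 1 ∧ a = y 0 ∧ 1 ≤ i) ∨ (x = y n ∧ a = y (n + 1) ∧ i < n)} =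
          insert (y 1) (Ch S' par' a) from ?_] at hbd
        · obtain ⟨q, hq, ho⟩ := bd_one hd (hCh a) A1 n1 hbd
          exact hN ⟨_, _, ho⟩ ⟨q, hq⟩
        · ext x
          have hn1 : 1 ≤ n := by omega
          simp only [Set.mem_union, Set.mem_setOf_eq, Set.mem_insert_iff, y0, yl, hn1, e', lt_irrefl,
            and_false, or_false, and_true]
          exact or_comm
  have nbv : ∀ v, v ≠ a → ¬ Bd G ang v (insert (par v) (Ch {a} par v)) := by
    intro v hv
    by_cases hv' : v ∈ S'
    · rcases hv' with h | ⟨j, j1, j2, rfl⟩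
      · exact absurd h hv
      · rw [g2 j j1 j2]; exact hi j j1 j2
    · rw [g3 v hv']; exact hb v hv'
  refine subham_of_good G (by omega) ang hR a par (fun v => if v = a then 0 else rk v + 1) ?_ ?_ ?_
  · intro v hv; exact (g1 v hv).1
  · intro v hv
    rw [if_neg hv]
    split_ifs with h
    · omega
    · have := (g1 v hv).2 h
      omega
  · intro v x x' h h' t1 t2 ah ah' c1 c2
    by_contra hcon
    push Not at hcon
    by_cases hv : v = a
    · subst hv
      have key : ∀ x, Te v par v x ↔ x ∈ Ch {v} par v := by
        intro x; simp [Te, Ch]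
      rw [key] at t1 t2
      rw [key, key] at hcon
      exact nba ⟨x, t1, x', t2, h, h', ah, ah', hcon.1, hcon.2, c1, c2⟩
    · have key : ∀ x, Te a par v x ↔ x ∈ insert (par v) (Ch {a} par v) := by
        intro x; simp [Te, Ch, hv, eq_comm]
      rw [key] at t1 t2
      rw [key, key] at hcon
      exact nbv v hv ⟨x, t1, x', t2, h, h', ah, ah', hcon.1, hcon.2, c1, c2⟩

theorem noCut_of_tri (h : G.IsTriconnected) : NoCut G := by
  intro X x y u v hx hy xu xv yu yv
  have hc := h.2.2 u v
  have hr := hc.preconnected ⟨x, xu, xv⟩ ⟨y, yu, yv⟩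
  obtain ⟨w⟩ := hr
  suffices H : ∀ (p q : {w | w ≠ u ∧ w ≠ v}) (_ : (G.induce {w | w ≠ u ∧ w ≠ v}).Walk p q),
      p.1 ∈ X → q.1 ∉ X → ∃ p ∈ X, ∃ q ∉ X, G.Adj p q ∧ q ≠ u ∧ q ≠ v from H _ _ w hx hy
  intro p q w
  induction w with
  | nil => exact fun a b => absurd a b
  | @cons p r q had _ ih =>
    intro hp hq
    by_cases hr : r.1 ∈ X
    · exact ih hr hq
    · exact ⟨p.1, hp, r.1, hr, had, r.2.1, r.2.2⟩

end init

end PC4_sec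

section PA1_sec

section wind

lemma neg_of_slit {u v : ℂ} (hv : v ≠ 0) (h : u / v ∉ Complex.slitPlane) :
    ∃ s : ℝ, 0 ≤ s ∧ u = -(s : ℂ) * v := by
  rw [Complex.mem_slitPlane_iff] at h
  push Not at h
  refine ⟨-(u / v).re, by linarith [h.1], ?_⟩
  have : u / v = ((u / v).re : ℂ) := Complex.ext (by simp) (by simp [h.2])
  push_cast
  rw [neg_neg, ← this, div_mul_cancel₀ _ hv]

lemma slit_of_notMem {a b p : ℂ} (h : p ∉ segment ℝ a b) : (b - p) / (a - p) ∈ Complex.slitPlane := by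
  by_contra hc
  have ha : a - p ≠ 0 := fun e => h (by rw [← sub_eq_zero.1 e]; exact left_mem_segment ℝ a b)
  obtain ⟨s, hs, e⟩ := neg_of_slit ha hc
  apply h
  have h1 : (1 + s : ℝ) ≠ 0 := by positivity
  refine ⟨s / (1 + s), 1 / (1 + s), by positivity, by positivity, by field_simp; ring, ?_⟩
  simp only [Complex.real_smul]
  have h2 : (1 + s : ℂ) ≠ 0 := by exact_mod_cast h1
  push_cast
  field_simp
  linear_combination e

lemma const_of_int {g : ℝ → ℝ} (hc : ContinuousOn g (Icc 0 1))
    (hi : ∀ t ∈ Ioo (0 : ℝ) 1, ∃ n : ℤ, g t = 2 * Real.pi * n) : g 0 = g 1 := by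
  have hpi := Real.pi_pos
  have key : ∀ s ∈ Ioo (0 : ℝ) 1, ∀ t ∈ Ioo (0 : ℝ) 1, g s = g t := by
    intro s hs t ht
    have hy := IsPreconnected.constant (s := Ioo (0 : ℝ) 1) isPreconnected_Ioo
      (f := fun t => ⌊g t / (2 * Real.pi) + 1 / 2⌋) ?_ hs ht
    · obtain ⟨n, hn⟩ := hi s hs
      obtain ⟨k, hk⟩ := hi t ht
      have e : ∀ n : ℤ, ⌊2 * Real.pi * n / (2 * Real.pi) + 1 / 2⌋ = n := by
        intro n
        rw [mul_div_cancel_left₀ _ (by positivity), Int.floor_intCast_add]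
        norm_num
      rw [hn, e, hk, e] at hy
      rw [hn, hk, hy]
    · intro r hr
      have h1 : ContinuousAt g r := (hc r ⟨hr.1.le, hr.2.le⟩).continuousAt (Icc_mem_nhds hr.1 hr.2)
      obtain ⟨n, hn⟩ := hi r hr
      apply ContinuousAt.continuousWithinAt
      have h2 : ContinuousAt (fun t => g t / (2 * Real.pi) + 1 / 2) r := by fun_prop
      have h3 : g r / (2 * Real.pi) + 1 / 2 = n + 1 / 2 := by
        rw [hn, mul_div_cancel_left₀ _ (by positivity)]
      have h4 : ∀ᶠ t in nhds r, ⌊g t / (2 * Real.pi) + 1 / 2⌋ = n := by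
        have := h2.eventually (Ioo_mem_nhds (a := (n : ℝ)) (b := n + 1) (by linarith) (by linarith))
        filter_upwards [this] with t ht
        rw [Int.floor_eq_iff]
        exact ⟨ht.1.le, ht.2⟩
      have h5 : ⌊g r / (2 * Real.pi) + 1 / 2⌋ = n := h4.self_of_nhds
      rw [ContinuousAt, h5]
      exact Filter.Tendsto.congr' (h4.mono fun _ h => h.symm) tendsto_const_nhds
  have cl : closure (Ioo (0 : ℝ) 1) = Icc 0 1 := closure_Ioo (by norm_num)
  have all : ∀ s ∈ Icc (0 : ℝ) 1, g s = g (1 / 2) := by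
    have := Set.EqOn.of_subset_closure (s := Ioo (0 : ℝ) 1) (t := Icc 0 1) (f := g)
      (g := fun _ => g (1 / 2)) (fun s hs => key s hs _ ⟨by norm_num, by norm_num⟩) hc
      continuousOn_const Ioo_subset_Icc_self cl.ge
    exact this
  rw [all 0 ⟨le_rfl, zero_le_one⟩, all 1 ⟨zero_le_one, le_rfl⟩]

lemma cont_arg {f : ℝ → ℂ} {t : ℝ} (hf : ContinuousAt f t) (h : f t ∈ Complex.slitPlane) :
    ContinuousAt (fun t => Complex.arg (f t)) t :=
  ContinuousAt.comp (g := Complex.arg) (f := f) (Complex.continuousAt_arg h) hf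

variable {κ : Type*}

/-- winding sum -/
noncomputable def Wd (I : Finset κ) (a b : κ → ℂ) (p : ℂ) : ℝ :=
  ∑ k ∈ I, Complex.arg ((b k - p) / (a k - p))

lemma Wd_int {I : Finset κ} {a b : κ → ℂ} {p : ℂ} (hP : ∏ k ∈ I, (b k - p) = ∏ k ∈ I, (a k - p))
    (ha : ∀ k ∈ I, p ≠ a k) (hb : ∀ k ∈ I, p ≠ b k) : ∃ n : ℤ, Wd I a b p = 2 * Real.pi * n := by
  have hz : ∀ k ∈ I, (b k - p) / (a k - p) ≠ 0 := fun k hk =>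
    div_ne_zero (sub_ne_zero.2 (hb k hk).symm) (sub_ne_zero.2 (ha k hk).symm)
  have h1 : Complex.exp (Wd I a b p * Complex.I) =
      ∏ k ∈ I, (b k - p) / (a k - p) / (‖(b k - p) / (a k - p)‖ : ℂ) := by
    rw [Wd, Complex.ofReal_sum, Finset.sum_mul, Complex.exp_sum]
    refine Finset.prod_congr rfl fun k hk => ?_
    have := Complex.norm_mul_exp_arg_mul_I ((b k - p) / (a k - p))
    rw [eq_div_iff (by exact_mod_cast norm_ne_zero_iff.2 (hz k hk))]
    rw [mul_comm]; exact this
  have h2 : ∏ k ∈ I, (b k - p) / (a k - p) = 1 := by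
    rw [Finset.prod_div_distrib, hP, div_self]
    exact Finset.prod_ne_zero_iff.2 fun k hk => sub_ne_zero.2 (ha k hk).symm
  rw [Finset.prod_div_distrib, h2, ← Complex.ofReal_prod, ← norm_prod, h2] at h1
  norm_num at h1
  obtain ⟨n, hn⟩ := Complex.exp_eq_one_iff.1 h1
  refine ⟨n, ?_⟩
  have : (Wd I a b p : ℂ) = ((2 * Real.pi * n : ℝ) : ℂ) := by
    have hI := Complex.I_ne_zero
    apply mul_right_cancel₀ hI
    rw [hn]; push_cast; ring
  exact_mod_cast this

lemma Wd_line {I : Finset κ} {a b : κ → ℂ} {p p' : ℂ}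
    (hP : ∀ p, (∀ k ∈ I, p ≠ a k) → (∀ k ∈ I, p ≠ b k) → ∏ k ∈ I, (b k - p) = ∏ k ∈ I, (a k - p))
    (hoff : ∀ x ∈ segment ℝ p p', ∀ k ∈ I, x ∉ segment ℝ (a k) (b k)) : Wd I a b p = Wd I a b p' := by
  have hm : ∀ t ∈ Icc (0 : ℝ) 1, p + t * (p' - p) ∈ segment ℝ p p' := by
    intro t ht
    rw [segment_eq_image']
    exact ⟨t, ht, by simp⟩
  have := const_of_int (g := fun t : ℝ => Wd I a b (p + t * (p' - p))) ?_ ?_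
  · simpa using this
  · unfold Wd
    refine continuousOn_finsetSum _ fun k hk t ht => ?_
    have hs := slit_of_notMem (hoff _ (hm t ht) k hk)
    have hne : a k - (p + t * (p' - p)) ≠ 0 := fun e =>
      hoff _ (hm t ht) k hk (by rw [← sub_eq_zero.1 e]; exact left_mem_segment ℝ _ _)
    apply ContinuousAt.continuousWithinAt
    refine cont_arg ?_ hs
    exact ContinuousAt.div (by fun_prop) (by fun_prop) hne
  · intro t ht
    have h := hoff _ (hm t ⟨ht.1.le, ht.2.le⟩)
    have h1 : ∀ k ∈ I, p + t * (p' - p) ≠ a k := fun k hk e => h k hk (e ▸ left_mem_segment ℝ _ _)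
    have h2 : ∀ k ∈ I, p + t * (p' - p) ≠ b k := fun k hk e => h k hk (e ▸ right_mem_segment ℝ _ _)
    exact Wd_int (hP _ h1 h2) h1 h2

/-- the ray from `v` in direction `h` starts inside the segment to `e`, or avoids it -/
def RayOk (v e h : ℂ) : Prop :=
  (∃ c : ℝ, c ∈ Ioo (0 : ℝ) 1 ∧ h = c * (e - v)) ∨ ∀ t ∈ Ioc (0 : ℝ) 1, v + (t : ℂ) * h ∉ segment ℝ v e

lemma ray_aux {v e h : ℂ} (he : e ≠ v) (H : ∀ t ∈ Ioc (0 : ℝ) 1, v + (t : ℂ) * h ∉ segment ℝ v e)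
    {t s : ℝ} (ht : 0 ≤ t) (hs : 0 ≤ s) (hw : e - (v + t * h) = s * h) : False := by
  have h1 : e - v = ((t + s : ℝ) : ℂ) * h := by push_cast; linear_combination hw
  have h2 : 0 < t + s := by
    rcases (add_nonneg ht hs).eq_or_lt with e' | e'
    · rw [← e'] at h1; simp only [Complex.ofReal_zero, zero_mul] at h1
      exact absurd (sub_eq_zero.1 h1) he
    · exact e'
  have h3 : 0 < min 1 (t + s) := lt_min one_pos h2
  refine H (min 1 (t + s)) ⟨h3, min_le_left _ _⟩ ?_
  rw [segment_eq_image']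
  refine ⟨min 1 (t + s) / (t + s), ⟨by positivity, (div_le_one h2).2 (min_le_right _ _)⟩, ?_⟩
  simp only [Complex.real_smul]
  rw [h1, ← mul_assoc, ← Complex.ofReal_mul, div_mul_cancel₀ _ h2.ne']

lemma ray_ne {v e h : ℂ} (he : e ≠ v) (H : RayOk v e h) {t : ℝ} (ht : t ∈ Icc (0 : ℝ) 1) :
    e - (v + t * h) ≠ 0 := by
  intro h0
  rcases H with ⟨c, hc, rfl⟩ | H
  · have : ((1 - t * c : ℝ) : ℂ) * (e - v) = 0 := by push_cast; linear_combination h0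
    rcases mul_eq_zero.1 this with h | h
    · have : 1 - t * c = 0 := by exact_mod_cast h
      nlinarith [hc.1, hc.2, ht.1, ht.2]
    · exact he (sub_eq_zero.1 h)
  · exact ray_aux he H ht.1 le_rfl (by rw [h0]; simp)

lemma ray_cont {v e h : ℂ} (he : e ≠ v) (h0 : h ≠ 0) (H : RayOk v e h) :
    ContinuousOn (fun t : ℝ => Complex.arg (-h / (e - (v + t * h)))) (Icc 0 1) ∧
    ContinuousOn (fun t : ℝ => Complex.arg (-(e - (v + t * h)) / h)) (Icc 0 1) := by
  have hne := fun t ht => ray_ne he H (t := t) ht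
  have hev := sub_ne_zero.2 he
  rcases H with ⟨c, hc, e1⟩ | H
  · have key : ∀ t ∈ Icc (0 : ℝ) 1, 0 < 1 - t * c := fun t ht => by nlinarith [hc.1, hc.2, ht.1, ht.2]
    have hcc : (c : ℂ) ≠ 0 := by exact_mod_cast hc.1.ne'
    constructor
    · refine continuousOn_const (c := Real.pi) |>.congr fun t ht => ?_
      have : -h / (e - (v + t * h)) = ((-(c / (1 - t * c)) : ℝ) : ℂ) := by
        have hk : ((1 - t * c : ℝ) : ℂ) ≠ 0 := by exact_mod_cast (key t ht).ne'
        rw [div_eq_iff (hne t ht), show e - (v + t * h) = ((1 - t * c : ℝ) : ℂ) * (e - v) by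
          rw [e1]; push_cast; ring, e1]
        rw [Complex.ofReal_neg, Complex.ofReal_div, neg_mul, ← mul_assoc, div_mul_cancel₀ _ hk]
      dsimp only
      rw [this]
      exact Complex.arg_ofReal_of_neg (by have := div_pos hc.1 (key t ht); linarith)
    · refine continuousOn_const (c := Real.pi) |>.congr fun t ht => ?_
      have : -(e - (v + t * h)) / h = ((-((1 - t * c) / c) : ℝ) : ℂ) := by
        rw [div_eq_iff h0, e1]
        push_cast
        field_simp
        ring
      dsimp only
      rw [this]
      exact Complex.arg_ofReal_of_neg (by have := div_pos (key t ht) hc.1; linarith)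
  · constructor
    · intro t ht
      apply ContinuousAt.continuousWithinAt
      refine cont_arg (ContinuousAt.div (by fun_prop) (by fun_prop) (hne t ht)) ?_
      by_contra hc
      obtain ⟨s, hs, e1⟩ := neg_of_slit (hne t ht) hc
      have hs0 : (s : ℂ) ≠ 0 := fun e => h0 (by rw [e] at e1; simpa using e1)
      refine ray_aux he H ht.1 (s := s⁻¹) (by positivity) ?_
      push_cast
      field_simp
      linear_combination e1
    · intro t ht
      apply ContinuousAt.continuousWithinAt
      refine cont_arg (ContinuousAt.div (by fun_prop) (by fun_prop) h0) ?_
      by_contra hc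
      obtain ⟨s, hs, e1⟩ := neg_of_slit h0 hc
      exact ray_aux he H ht.1 hs (by linear_combination -e1)

lemma Wd_vertex [DecidableEq κ] {I : Finset κ} {a b : κ → ℂ}
    (hP : ∀ p, (∀ k ∈ I, p ≠ a k) → (∀ k ∈ I, p ≠ b k) → ∏ k ∈ I, (b k - p) = ∏ k ∈ I, (a k - p))
    {i j : κ} (hi : i ∈ I) (hj : j ∈ I) (hij : i ≠ j) {v h : ℂ} (hbi : b i = v) (haj : a j = v)
    (hai : a i ≠ v) (hbj : b j ≠ v) (h0 : h ≠ 0)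
    (hoff : ∀ t ∈ Icc (0 : ℝ) 1, ∀ k ∈ I, k ≠ i → k ≠ j → v + (t : ℂ) * h ∉ segment ℝ (a k) (b k))
    (hI : RayOk v (a i) h) (hJ : RayOk v (b j) h) :
    Wd I a b (v + h) = (∑ k ∈ (I.erase i).erase j, Complex.arg ((b k - v) / (a k - v))) +
      Complex.arg (-h / (a i - v)) + Complex.arg (-(b j - v) / h) := by
  let g : ℝ → ℝ := fun t => (∑ k ∈ (I.erase i).erase j,
      Complex.arg ((b k - (v + t * h)) / (a k - (v + t * h)))) +
      Complex.arg (-h / (a i - (v + t * h))) + Complex.arg (-(b j - (v + t * h)) / h)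
  have hji : j ∈ I.erase i := Finset.mem_erase.2 ⟨hij.symm, hj⟩
  have hg : ∀ t : ℝ, 0 < t → g t = Wd I a b (v + t * h) := by
    intro t ht
    have htc : (t : ℂ) ≠ 0 := by exact_mod_cast ht.ne'
    unfold Wd
    rw [← Finset.add_sum_erase _ _ hi, ← Finset.add_sum_erase _ _ hji, hbi, haj]
    have e1 : (v - (v + t * h)) / (a i - (v + t * h)) = (t : ℂ) * (-h / (a i - (v + t * h))) := by ring
    have e2 : (b j - (v + t * h)) / (v - (v + t * h)) = ((t⁻¹ : ℝ) : ℂ) * (-(b j - (v + t * h)) / h) := by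
      push_cast
      rw [show v - (v + t * h) = -(t * h) by ring]
      field_simp
    rw [e1, e2, Complex.arg_real_mul _ ht, Complex.arg_real_mul _ (inv_pos.2 ht)]
    simp only [g]; ring
  have hmem : ∀ k ∈ (I.erase i).erase j, k ≠ i ∧ k ≠ j ∧ k ∈ I := by
    intro k hk
    rw [Finset.mem_erase, Finset.mem_erase] at hk
    exact ⟨hk.2.1, hk.1, hk.2.2⟩
  have hI' := ray_cont hai h0 hI
  have hJ' := ray_cont hbj h0 hJ
  have := const_of_int (g := g) ?_ ?_
  · rw [hg 1 one_pos] at this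
    simp only [g, Complex.ofReal_zero, zero_mul, add_zero, Complex.ofReal_one, one_mul] at this
    exact this.symm
  · refine ContinuousOn.add (ContinuousOn.add ?_ hI'.1) hJ'.2
    refine continuousOn_finsetSum _ fun k hk t ht => ?_
    obtain ⟨k1, k2, k3⟩ := hmem k hk
    have hs := hoff t ht k k3 k1 k2
    have hne : a k - (v + t * h) ≠ 0 := fun e =>
      hs (by rw [← sub_eq_zero.1 e]; exact left_mem_segment ℝ _ _)
    apply ContinuousAt.continuousWithinAt
    exact cont_arg (ContinuousAt.div (by fun_prop) (by fun_prop) hne) (slit_of_notMem hs)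
  · intro t ht
    rw [hg t ht.1]
    have ht' : t ∈ Icc (0 : ℝ) 1 := ⟨ht.1.le, ht.2.le⟩
    have hv : v + t * h ≠ v := fun e => by
      have : (t : ℂ) * h = 0 := by linear_combination e
      rcases mul_eq_zero.1 this with h | h
      · exact ht.1.ne' (by exact_mod_cast h)
      · exact h0 h
    have h1 : ∀ k ∈ I, v + t * h ≠ a k := by
      intro k hk
      by_cases e : k = i
      · subst e; exact (sub_ne_zero.1 (ray_ne hai hI ht')).symm
      by_cases e' : k = j
      · subst e'; rw [haj]; exact hv
      · exact fun e'' => hoff t ht' k hk e e' (e'' ▸ left_mem_segment ℝ _ _)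
    have h2 : ∀ k ∈ I, v + t * h ≠ b k := by
      intro k hk
      by_cases e : k = i
      · subst e; rw [hbi]; exact hv
      by_cases e' : k = j
      · subst e'; exact (sub_ne_zero.1 (ray_ne hbj hJ ht')).symm
      · exact fun e'' => hoff t ht' k hk e e' (e'' ▸ right_mem_segment ℝ _ _)
    exact Wd_int (hP _ h1 h2) h1 h2

lemma arg_neg_div {u v : ℂ} (hu : u ≠ 0) (hv : v ≠ 0) :
    (v.arg < u.arg → Complex.arg (-u / v) = u.arg - v.arg - Real.pi) ∧
    (u.arg < v.arg → Complex.arg (-u / v) = u.arg - v.arg + Real.pi) := by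
  have hu' := Complex.norm_mul_exp_arg_mul_I u
  have hv' := Complex.norm_mul_exp_arg_mul_I v
  have pu : 0 < ‖u‖ := norm_pos_iff.2 hu
  have pv : 0 < ‖v‖ := norm_pos_iff.2 hv
  have key : ∀ k : ℤ, k = 1 ∨ k = -1 → -u / v = ((‖u‖ / ‖v‖ : ℝ) : ℂ) *
      Complex.exp ((u.arg - v.arg + k * Real.pi : ℝ) * Complex.I) := by
    intro k hk
    have e : Complex.exp (k * Real.pi * Complex.I) = -1 := by
      rcases hk with rfl | rfl
      · simp
      · rw [show ((-1 : ℤ) : ℂ) * Real.pi * Complex.I = -(Real.pi * Complex.I) by push_cast; ring,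
          Complex.exp_neg, Complex.exp_pi_mul_I]; norm_num
    push_cast
    rw [add_mul, Complex.exp_add, e, sub_mul, Complex.exp_sub]
    have hvn : (‖v‖ : ℂ) ≠ 0 := by exact_mod_cast pv.ne'
    have he := Complex.exp_ne_zero (v.arg * Complex.I)
    rw [div_eq_iff hv]
    have e2 : (‖u‖ : ℂ) / ‖v‖ * (Complex.exp (u.arg * Complex.I) / Complex.exp (v.arg * Complex.I) * -1) * v =
      -(‖u‖ * Complex.exp (u.arg * Complex.I)) * (v / (‖v‖ * Complex.exp (v.arg * Complex.I))) := by
      field_simp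
    rw [e2, hv', hu', div_self hv, mul_one]
  have r := div_pos pu pv
  have hu1 := Complex.arg_mem_Ioc u
  have hv1 := Complex.arg_mem_Ioc v
  have hpi := Real.pi_pos
  constructor
  · intro hlt
    rw [key (-1) (Or.inr rfl), Complex.arg_real_mul _ r, Complex.arg_exp_mul_I, toIocMod_eq_self _ |>.2]
    · push_cast; ring
    · push_cast; constructor <;> linarith [hu1.1, hu1.2, hv1.1, hv1.2]
  · intro hlt
    rw [key 1 (Or.inl rfl), Complex.arg_real_mul _ r, Complex.arg_exp_mul_I, toIocMod_eq_self _ |>.2]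
    · push_cast; ring
    · push_cast; constructor <;> linarith [hu1.1, hu1.2, hv1.1, hv1.2]

/-- comparing a direction with the boundary value -/
lemma arg_side {u d h : ℂ} (hu : u ≠ 0) (hd : d ≠ 0) (h0 : h ≠ 0) (e1 : u.arg ≠ d.arg)
    (e2 : u.arg ≠ h.arg) (e3 : h.arg ≠ d.arg) :
    Complex.arg (-h / u) + Complex.arg (-d / h) ≠ Real.pi + Complex.arg (-d / u) ↔
      cyc u.arg h.arg d.arg := by
  have a1 := arg_neg_div h0 hu
  have a2 := arg_neg_div hd h0
  have a3 := arg_neg_div hd hu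
  have hpi := Real.pi_pos
  unfold cyc
  generalize Complex.arg (-h / u) = A1 at *
  generalize Complex.arg (-d / h) = A2 at *
  generalize Complex.arg (-d / u) = A3 at *
  generalize u.arg = x at *
  generalize d.arg = y at *
  generalize h.arg = z at *
  generalize Real.pi = p at *
  clear hu hd h0
  rcases lt_or_gt_of_ne e1 with l1 | l1 <;> rcases lt_or_gt_of_ne e2 with l2 | l2 <;>
    rcases lt_or_gt_of_ne e3 with l3 | l3 <;> grind

end wind

end PA1_sec

section PA2_sec

section pgn
variable {κ : Type*}

structure Pgn (I : Finset κ) (a b : κ → ℂ) (pr : κ → κ) : Prop where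
  hpr : ∀ k ∈ I, pr k ∈ I
  hb : ∀ k ∈ I, b (pr k) = a k
  nd : ∀ k ∈ I, a k ≠ b k
  hs : ∀ k ∈ I, ∀ l ∈ I, k ≠ l → ∀ p, p ∈ segment ℝ (a k) (b k) → p ∈ segment ℝ (a l) (b l) →
    (k = pr l ∧ p = a l) ∨ (l = pr k ∧ p = a k)
  hP : ∀ p, (∀ k ∈ I, p ≠ a k) → (∀ k ∈ I, p ≠ b k) → ∏ k ∈ I, (b k - p) = ∏ k ∈ I, (a k - p)

lemma half_mem {x y : ℂ} {t : ℝ} (ht : t ∈ Icc (0 : ℝ) 1) :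
    x + t * ((y - x) / 2) ∈ segment ℝ x y := by
  rw [segment_eq_image']
  refine ⟨t / 2, ⟨by linarith [ht.1], by linarith [ht.2]⟩, ?_⟩
  simp only [Complex.real_smul]; push_cast; ring

lemma half_ne {x y : ℂ} (h : x ≠ y) {t : ℝ} (ht : t ∈ Icc (0 : ℝ) 1) :
    x + t * ((y - x) / 2) ≠ y := by
  intro e
  have : ((1 - t / 2 : ℝ) : ℂ) * (y - x) = 0 := by push_cast; linear_combination -e
  rcases mul_eq_zero.1 this with h' | h'
  · have : 1 - t / 2 = 0 := by exact_mod_cast h'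
    linarith [ht.2]
  · exact h (sub_eq_zero.1 h').symm

lemma mul_pos_ne {x h : ℂ} (h0 : h ≠ 0) {t : ℝ} (ht : 0 < t) : x + t * h ≠ x := by
  intro e
  have : (t : ℂ) * h = 0 := by linear_combination e
  rcases mul_eq_zero.1 this with h | h
  · exact ht.ne' (by exact_mod_cast h)
  · exact h0 h

lemma ray_common {v e e' : ℂ} (he : e ≠ v) (he' : e' ≠ v) (h : (e - v).arg = (e' - v).arg) :
    ∃ p, p ≠ v ∧ p ∈ segment ℝ v e ∧ p ∈ segment ℝ v e' := by
  wlog hle : ‖e - v‖ ≤ ‖e' - v‖ generalizing e e'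
  · obtain ⟨p, a, b, c⟩ := this he' he h.symm (le_of_not_ge hle)
    exact ⟨p, a, c, b⟩
  refine ⟨e, he, right_mem_segment ℝ _ _, ?_⟩
  have h1 := sub_ne_zero.2 he
  have h2 := sub_ne_zero.2 he'
  have h3 := (Complex.arg_eq_arg_iff h2 h1).1 h.symm
  rw [segment_eq_image']
  refine ⟨‖e - v‖ / ‖e' - v‖, ⟨by positivity, div_le_one_of_le₀ hle (norm_nonneg _)⟩, ?_⟩
  simp only [Complex.real_smul]
  push_cast
  rw [h3]; ring

namespace Pgn
variable {I : Finset κ} {a b : κ → ℂ} {pr : κ → κ}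

lemma pr_ne (H : Pgn I a b pr) {k : κ} (hk : k ∈ I) : pr k ≠ k := fun e => H.nd k hk (by
  have := H.hb k hk; rw [e] at this; exact this.symm)

lemma mem_a (H : Pgn I a b pr) {k l : κ} (hk : k ∈ I) (hl : l ∈ I) (h1 : l ≠ pr k) (h2 : l ≠ k) :
    a k ∉ segment ℝ (a l) (b l) := by
  intro h
  rcases H.hs k hk l hl h2.symm _ (left_mem_segment ℝ _ _) h with ⟨e, e'⟩ | ⟨e, -⟩
  · exact H.nd k hk (by rw [e', ← H.hb l hl, e])
  · exact h1 e

lemma value [DecidableEq κ] (H : Pgn I a b pr) {k : κ} (hk : k ∈ I) :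
    ∃ A : ℝ, Wd I a b (a k + (b k - a k) / 2) =
        A + Real.pi + Complex.arg (-(b k - a k) / (a (pr k) - a k)) ∧
      Wd I a b (a (pr k) + (b (pr k) - a (pr k)) / 2) =
        A + Real.pi + Complex.arg (-(b k - a k) / (a (pr k) - a k)) ∧
      ∀ h : ℂ, h ≠ 0 → (∀ t ∈ Ioc (0 : ℝ) 1, ∀ l ∈ I, a k + (t : ℂ) * h ∉ segment ℝ (a l) (b l)) →
        Wd I a b (a k + h) = A + Complex.arg (-h / (a (pr k) - a k)) + Complex.arg (-(b k - a k) / h) := by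
  have hp := H.hpr k hk
  have hne := H.pr_ne hk
  have hbk := H.hb k hk
  have n1 : a (pr k) ≠ a k := fun e => H.nd _ hp (by rw [e, hbk])
  have n2 : b k ≠ a k := (H.nd k hk).symm
  have sg : segment ℝ (a k) (a (pr k)) = segment ℝ (a (pr k)) (b (pr k)) := by
    rw [hbk, segment_symm]
  have s1 := sub_ne_zero.2 n1
  have s2 := sub_ne_zero.2 n2
  have V := fun h h0 h1 h2 h3 => Wd_vertex (h := h) H.hP hp hk hne hbk rfl n1 n2 h0 h1 h2 h3
  refine ⟨∑ k_1 ∈ (I.erase (pr k)).erase k, Complex.arg ((b k_1 - a k) / (a k_1 - a k)), ?_, ?_, ?_⟩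
  · rw [V ((b k - a k) / 2) (by simpa using s2)]
    · have e1 : -((b k - a k) / 2) / (a (pr k) - a k) =
        ((1 / 2 : ℝ) : ℂ) * (-(b k - a k) / (a (pr k) - a k)) := by push_cast; ring
      have e2 : -(b k - a k) / ((b k - a k) / 2) = ((-2 : ℝ) : ℂ) := by
        push_cast; field_simp
      rw [e1, e2, Complex.arg_real_mul _ (by norm_num), Complex.arg_ofReal_of_neg (by norm_num)]
      ring
    · intro t ht l hl l1 l2 hm
      rcases H.hs k hk l hl (Ne.symm l2) _ (half_mem ht) hm with ⟨e, e'⟩ | ⟨e, -⟩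
      · exact half_ne n2.symm ht (e'.trans (by rw [← H.hb l hl, e]))
      · exact l1 e
    · right
      intro t ht hm
      rw [sg] at hm
      have ht' : t ∈ Icc (0 : ℝ) 1 := ⟨ht.1.le, ht.2⟩
      rcases H.hs k hk _ hp hne.symm _ (half_mem ht') hm with ⟨e, e'⟩ | ⟨-, e'⟩
      · exact half_ne n2.symm ht' (e'.trans (by rw [← H.hb _ hp, ← e]))
      · exact mul_pos_ne (by simpa using s2) ht.1 e'
    · left
      exact ⟨1 / 2, by constructor <;> norm_num, by push_cast; ring⟩
  · rw [show a (pr k) + (b (pr k) - a (pr k)) / 2 = a k + (a (pr k) - a k) / 2 by rw [hbk]; ring,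
      V ((a (pr k) - a k) / 2) (by simpa using s1)]
    · have e1 : -((a (pr k) - a k) / 2) / (a (pr k) - a k) = ((-1 / 2 : ℝ) : ℂ) := by
        push_cast; field_simp
      have e2 : -(b k - a k) / ((a (pr k) - a k) / 2) =
        ((2 : ℝ) : ℂ) * (-(b k - a k) / (a (pr k) - a k)) := by push_cast; field_simp
      rw [e1, e2, Complex.arg_real_mul _ (by norm_num), Complex.arg_ofReal_of_neg (by norm_num)]
    · intro t ht l hl l1 l2 hm
      have hm' := half_mem (x := a k) (y := a (pr k)) ht
      rw [sg] at hm'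
      rcases H.hs _ hp l hl (Ne.symm l1) _ hm' hm with ⟨e, e'⟩ | ⟨e, e'⟩
      · have : a l = a k := by rw [← H.hb l hl, ← e, hbk]
        exact H.mem_a hk hl l1 l2 (this ▸ left_mem_segment ℝ _ _)
      · exact half_ne n1.symm ht e'
    · left
      exact ⟨1 / 2, by constructor <;> norm_num, by push_cast; ring⟩
    · right
      intro t ht hm
      have ht' : t ∈ Icc (0 : ℝ) 1 := ⟨ht.1.le, ht.2⟩
      have hm' := half_mem (x := a k) (y := a (pr k)) ht'
      rw [sg] at hm'
      rcases H.hs k hk _ hp hne.symm _ hm hm' with ⟨e, e'⟩ | ⟨-, e'⟩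
      · exact half_ne n1.symm ht' e'
      · exact mul_pos_ne (by simpa using s1) ht.1 e'
  · intro h h0 hoff
    refine V h h0 ?_ ?_ ?_
    · intro t ht l hl l1 l2
      rcases ht.1.eq_or_lt with e | e
      · rw [← e]; simpa using H.mem_a hk hl l1 l2
      · exact hoff t ⟨e, ht.2⟩ l hl
    · right; intro t ht; rw [sg]; exact hoff t ht _ hp
    · right; intro t ht; exact hoff t ht _ hk

lemma mid_eq (H : Pgn I a b pr) {k : κ} (hk : k ∈ I) :
    Wd I a b (a (pr k) + (b (pr k) - a (pr k)) / 2) = Wd I a b (a k + (b k - a k) / 2) := by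
  classical
  obtain ⟨A, h1, h2, -⟩ := H.value hk
  rw [h1, h2]

lemma side (H : Pgn I a b pr) {k : κ} (hk : k ∈ I) {h : ℂ} (h0 : h ≠ 0)
    (hoff : ∀ t ∈ Ioc (0 : ℝ) 1, ∀ l ∈ I, a k + (t : ℂ) * h ∉ segment ℝ (a l) (b l)) :
    Wd I a b (a k + h) ≠ Wd I a b (a k + (b k - a k) / 2) ↔
      cyc (a (pr k) - a k).arg h.arg (b k - a k).arg := by
  classical
  have hp := H.hpr k hk
  have hne := H.pr_ne hk
  have hbk := H.hb k hk
  have n1 : a (pr k) ≠ a k := fun e => H.nd _ hp (by rw [e, hbk])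
  have n2 : b k ≠ a k := (H.nd k hk).symm
  have sg : segment ℝ (a k) (a (pr k)) = segment ℝ (a (pr k)) (b (pr k)) := by
    rw [hbk, segment_symm]
  obtain ⟨A, h1, -, h3⟩ := H.value hk
  have hh : ∀ p, p ≠ a k → p ∈ segment ℝ (a k) (a k + h) → ∀ l ∈ I, p ∉ segment ℝ (a l) (b l) := by
    intro p hp hm l hl
    rw [segment_eq_image'] at hm
    obtain ⟨t, ht, rfl⟩ := hm
    simp only [Complex.real_smul, add_sub_cancel_left] at hp ⊢
    refine hoff t ⟨lt_of_le_of_ne ht.1 fun e => hp (by rw [← e]; simp), ht.2⟩ l hl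
  have nh : a k + h ≠ a k := by simpa using h0
  rw [← arg_side (sub_ne_zero.2 n1) (sub_ne_zero.2 n2) h0, h1, h3 h h0 hoff]
  · constructor
    · intro q q'; exact q (by linarith)
    · intro q q'; exact q (by linarith)
  · intro e
    obtain ⟨p, p1, p2, p3⟩ := ray_common n1 n2 e
    rw [sg] at p2
    rcases H.hs k hk _ hp hne.symm _ p3 p2 with ⟨e1, e2⟩ | ⟨-, e'⟩
    · have hq := H.hb _ hp
      rw [← e1] at hq
      have : (a k + a (pr k)) / 2 = a (pr k) ∨ (a k + a (pr k)) / 2 = a k := by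
        have m1 : (a k + a (pr k)) / 2 ∈ segment ℝ (a k) (b k) := by
          rw [hq]
          have := half_mem (x := a k) (y := a (pr k)) (t := 1) ⟨zero_le_one, le_rfl⟩
          convert this using 1
          push_cast; ring
        have m2 : (a k + a (pr k)) / 2 ∈ segment ℝ (a (pr k)) (b (pr k)) := by
          have m1' := m1
          rw [hq] at m1'
          rw [← sg]; exact m1'
        rcases H.hs k hk _ hp hne.symm _ m1 m2 with ⟨-, e⟩ | ⟨-, e⟩
        · exact Or.inl e
        · exact Or.inr e
      rcases this with e | e
      · exact n1 (by linear_combination -2 * e)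
      · exact n1 (by linear_combination 2 * e)
    · exact p1 e'
  · intro e
    obtain ⟨p, p1, p2, p3⟩ := ray_common n1 nh (by simpa using e)
    rw [sg] at p2
    exact hh p p1 p3 _ hp p2
  · intro e
    obtain ⟨p, p1, p2, p3⟩ := ray_common nh n2 (by simpa using e)
    exact hh p p1 p2 _ hk p3

end Pgn
end pgn

end PA2_sec

section PA3_sec

/-- polygonal drawing -/
structure PL {V : Type u} (G : SimpleGraph V) where
  ps : V → ℂ
  m : V → V → ℕ
  q : V → V → ℕ → ℂ
  ps_inj : Function.Injective ps
  m_pos : ∀ u v, G.Adj u v → 1 ≤ m u v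
  m_symm : ∀ u v, G.Adj u v → m v u = m u v
  q_rev : ∀ u v, G.Adj u v → ∀ i ≤ m u v, q v u i = q u v (m u v - i)
  q_zero : ∀ u v, G.Adj u v → q u v 0 = ps u
  nd : ∀ u v, G.Adj u v → ∀ i < m u v, q u v i ≠ q u v (i + 1)
  same : ∀ u v, G.Adj u v → ∀ i j, i < j → j < m u v → ∀ p,
    p ∈ segment ℝ (q u v i) (q u v (i + 1)) → p ∈ segment ℝ (q u v j) (q u v (j + 1)) →
    j = i + 1 ∧ p = q u v j
  diff : ∀ u v u' v', G.Adj u v → G.Adj u' v' → s(u, v) ≠ s(u', v') → ∀ i < m u v, ∀ j < m u' v',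
    ∀ p, p ∈ segment ℝ (q u v i) (q u v (i + 1)) → p ∈ segment ℝ (q u' v' j) (q u' v' (j + 1)) →
    ∃ w, (w = u ∨ w = v) ∧ (w = u' ∨ w = v') ∧ p = ps w

lemma seg_half {x y z : ℂ} (h : x ≠ y) (hz : z ∈ segment ℝ x (x + (y - x) / 2)) :
    z ∈ segment ℝ x y ∧ z ≠ y := by
  rw [segment_eq_image'] at hz
  obtain ⟨t, ht, rfl⟩ := hz
  simp only [Complex.real_smul, add_sub_cancel_left]
  exact ⟨half_mem ht, half_ne h ht⟩

lemma seg_half' {x y z : ℂ} (h : x ≠ y) (hz : z ∈ segment ℝ (x + (y - x) / 2) y) :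
    z ∈ segment ℝ x y ∧ z ≠ x := by
  rw [segment_symm, show x + (y - x) / 2 = y + (x - y) / 2 by ring] at hz
  have := seg_half h.symm hz
  rwa [segment_symm] at this

namespace PL
variable {V : Type u} {G : SimpleGraph V} (P : PL G)

lemma q_last {u v : V} (h : G.Adj u v) : P.q u v (P.m u v) = P.ps v := by
  have := P.q_rev u v h 0 (Nat.zero_le _)
  rw [P.q_zero v u h.symm] at this
  simpa using this.symm

lemma end0 {u v : V} (h : G.Adj u v) {i : ℕ} (hi : i < P.m u v)
    (hp : P.ps u ∈ segment ℝ (P.q u v i) (P.q u v (i + 1))) : i = 0 := by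
  by_contra h0
  have h1 := P.same u v h 0 i (Nat.pos_of_ne_zero h0) hi (P.ps u)
    (by rw [P.q_zero u v h]; exact left_mem_segment ℝ _ _) hp
  have := P.nd u v h 0 (by omega)
  rw [P.q_zero u v h, ← h1.1, ← h1.2] at this
  exact this rfl

lemma end1 {u v : V} (h : G.Adj u v) {i : ℕ} (hi : i < P.m u v)
    (hp : P.ps v ∈ segment ℝ (P.q u v i) (P.q u v (i + 1))) : i + 1 = P.m u v := by
  by_contra h0
  have e : P.m u v - 1 + 1 = P.m u v := by omega
  have h1 := P.same u v h i (P.m u v - 1) (by omega) (by omega) (P.ps v) hp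
    (by rw [e, P.q_last h]; exact right_mem_segment ℝ _ _)
  have := P.nd u v h (P.m u v - 1) (by omega)
  rw [e, P.q_last h, ← h1.2] at this
  exact this rfl

/-- outgoing angle -/
noncomputable def ang (u v : V) : ℝ := (P.q u v 1 - P.ps u).arg

/-- middle of first segment -/
noncomputable def md (u v : V) : ℂ := P.q u v 0 + (P.q u v 1 - P.q u v 0) / 2

lemma q1_ne {u v : V} (h : G.Adj u v) : P.q u v 1 ≠ P.ps u := by
  have := P.nd u v h 0 (P.m_pos u v h)
  rw [P.q_zero u v h] at this
  exact this.symm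

lemma ang_inj (v x y : V) (hx : G.Adj v x) (hy : G.Adj v y) (h : P.ang v x = P.ang v y) : x = y := by
  by_contra hne
  obtain ⟨p, p0, p1, p2⟩ := ray_common (P.q1_ne hx) (P.q1_ne hy) h
  have p1' := p1
  have p2' := p2
  rw [← P.q_zero v x hx] at p1'
  rw [← P.q_zero v y hy] at p2'
  obtain ⟨w, h1, h2, rfl⟩ := P.diff v x v y hx hy (fun e => hne (Sym2.congr_right.1 e)) 0 (P.m_pos _ _ hx) 0 (P.m_pos _ _ hy) p p1' p2'
  have : w = v := by
    rcases h1 with h1 | rfl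
    · exact h1
    · rcases h2 with h2 | h2
      · exact h2
      · exact absurd h2 hne
  exact p0 (by rw [this])

section poly
variable {n : ℕ} [NeZero n] (c : ZMod n → V)

/-- index set of the polygon -/
def pI : Finset (Σ _ : ZMod n, ℕ) := Finset.univ.sigma fun i => Finset.range (P.m (c i) (c (i + 1)))
/-- starts -/
def pa (k : Σ _ : ZMod n, ℕ) : ℂ := P.q (c k.1) (c (k.1 + 1)) k.2
/-- ends -/
def pb (k : Σ _ : ZMod n, ℕ) : ℂ := P.q (c k.1) (c (k.1 + 1)) (k.2 + 1)
/-- predecessor -/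
def ppr (k : Σ _ : ZMod n, ℕ) : Σ _ : ZMod n, ℕ :=
  if k.2 = 0 then ⟨k.1 - 1, P.m (c (k.1 - 1)) (c k.1) - 1⟩ else ⟨k.1, k.2 - 1⟩

lemma mem_pI {k : Σ _ : ZMod n, ℕ} : k ∈ P.pI c ↔ k.2 < P.m (c k.1) (c (k.1 + 1)) := by
  simp [pI]

variable {c}

lemma edge_ne (hn : 3 ≤ n) (hc : Function.Injective c) {i j : ZMod n} (h : i ≠ j) :
    s(c i, c (i + 1)) ≠ s(c j, c (j + 1)) := by
  intro e
  rcases Sym2.eq_iff.1 e with ⟨e1, -⟩ | ⟨e1, e2⟩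
  · exact h (hc e1)
  · have h1 := hc e1
    have h2 := hc e2
    rw [h1] at h2
    have h3 : ((2 : ℕ) : ZMod n) = 0 := by
      push_cast
      linear_combination h2
    rw [ZMod.natCast_eq_zero_iff] at h3
    have := Nat.le_of_dvd (by norm_num) h3
    omega

lemma hs_aux (hn : 3 ≤ n) (hc : Function.Injective c) (ha : ∀ i, G.Adj (c i) (c (i + 1)))
    {i j : ZMod n} (hij : i ≠ j) {s t : ℕ} (hsm : s < P.m (c i) (c (i + 1)))
    (htm : t < P.m (c j) (c (j + 1))) {p : ℂ}
    (h1 : p ∈ segment ℝ (P.q (c i) (c (i + 1)) s) (P.q (c i) (c (i + 1)) (s + 1)))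
    (h2 : p ∈ segment ℝ (P.q (c j) (c (j + 1)) t) (P.q (c j) (c (j + 1)) (t + 1)))
    (e : i = j + 1) (hp : p = P.ps (c i)) :
    (⟨j, t⟩ : Σ _ : ZMod n, ℕ) = P.ppr c ⟨i, s⟩ ∧ p = P.pa c ⟨i, s⟩ := by
  have hs0 := P.end0 (ha i) hsm (hp ▸ h1)
  subst hp e
  have ht := P.end1 (ha j) htm h2
  subst hs0
  refine ⟨?_, (P.q_zero _ _ (ha _)).symm⟩
  have : t = P.m (c j) (c (j + 1)) - 1 := by omega
  simp [ppr, this]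

lemma pgn (hn : 3 ≤ n) (hc : Function.Injective c) (ha : ∀ i, G.Adj (c i) (c (i + 1))) :
    Pgn (P.pI c) (P.pa c) (P.pb c) (P.ppr c) where
  hpr k hk := by
    rw [mem_pI] at hk ⊢
    obtain ⟨i, s⟩ := k
    simp only [ppr] at hk ⊢
    split_ifs with h
    · have := P.m_pos _ _ (ha (i - 1))
      simp only [sub_add_cancel] at this ⊢
      omega
    · simp only at h ⊢; omega
  hb k hk := by
    rw [mem_pI] at hk
    obtain ⟨i, s⟩ := k
    simp only [ppr, pa, pb] at hk ⊢
    split_ifs with h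
    · have := P.m_pos _ _ (ha (i - 1))
      have hl := P.q_last (ha (i - 1))
      simp only [sub_add_cancel] at this hl ⊢
      rw [Nat.sub_add_cancel this, hl, h, P.q_zero _ _ (ha i)]
    · simp only at h ⊢
      rw [Nat.sub_add_cancel (by omega)]
  nd k hk := by
    rw [mem_pI] at hk
    exact P.nd _ _ (ha _) _ hk
  hs := by
    rintro ⟨i, s⟩ hk ⟨j, t⟩ hl hne p h1 h2
    rw [mem_pI] at hk hl
    simp only [pa, pb] at hk hl h1 h2
    by_cases hij : i = j
    · subst hij
      have hst : s ≠ t := fun e => hne (by rw [e])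
      rcases lt_or_gt_of_ne hst with h | h
      · obtain ⟨e1, e2⟩ := P.same _ _ (ha i) s t h hl p h1 h2
        left
        refine ⟨?_, e2⟩
        subst e1; simp [ppr]
      · obtain ⟨e1, e2⟩ := P.same _ _ (ha i) t s h hk p h2 h1
        right
        refine ⟨?_, e2⟩
        subst e1; simp [ppr]
    · obtain ⟨w, w1, w2, hp⟩ := P.diff _ _ _ _ (ha i) (ha j) (edge_ne hn hc hij) s hk t hl p h1 h2
      rcases w1 with rfl | rfl
      · rcases w2 with e | e
        · exact absurd (hc e) hij
        · right
          exact P.hs_aux hn hc ha hij hk hl h1 h2 (hc e) hp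
      · rcases w2 with e | e
        · left
          exact P.hs_aux hn hc ha (Ne.symm hij) hl hk h2 h1 (hc e).symm (by rw [hp, e])
        · exact absurd (add_right_cancel (hc e)) hij
  hP p h1 h2 := by
    unfold pI
    rw [Finset.prod_sigma, Finset.prod_sigma]
    simp only [pa, pb]
    have hz : ∏ i : ZMod n, (P.ps (c i) - p) ≠ 0 := by
      refine Finset.prod_ne_zero_iff.2 fun i _ => sub_ne_zero.2 ?_
      have := h1 ⟨i, 0⟩ (by rw [mem_pI]; exact P.m_pos _ _ (ha i))
      simp only [pa] at this
      rw [P.q_zero _ _ (ha i)] at this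
      exact this.symm
    have hsft : ∏ i : ZMod n, (P.ps (c (i + 1)) - p) = ∏ i : ZMod n, (P.ps (c i) - p) :=
      Equiv.prod_comp (Equiv.addRight (1 : ZMod n)) (fun i => P.ps (c i) - p)
    apply mul_right_cancel₀ hz
    conv_rhs => rw [← hsft]
    rw [← Finset.prod_mul_distrib, ← Finset.prod_mul_distrib]
    refine Finset.prod_congr rfl fun i _ => ?_
    have e1 := Finset.prod_range_succ (fun k => P.q (c i) (c (i + 1)) k - p) (P.m (c i) (c (i + 1)))
    rw [Finset.prod_range_succ', P.q_zero _ _ (ha i), P.q_last (ha i)] at e1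
    exact e1

lemma mids (hn : 3 ≤ n) (hc : Function.Injective c) (ha : ∀ i, G.Adj (c i) (c (i + 1))) (i : ZMod n) :
    Wd (P.pI c) (P.pa c) (P.pb c) (P.md (c i) (c (i + 1))) =
      Wd (P.pI c) (P.pa c) (P.pb c) (P.md (c 0) (c (0 + 1))) := by
  have H := P.pgn hn hc ha
  have k1 : ∀ i : ZMod n, ∀ s : ℕ, s < P.m (c i) (c (i + 1)) →
      Wd (P.pI c) (P.pa c) (P.pb c) (P.pa c ⟨i, s⟩ + (P.pb c ⟨i, s⟩ - P.pa c ⟨i, s⟩) / 2) =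
      Wd (P.pI c) (P.pa c) (P.pb c) (P.md (c i) (c (i + 1))) := by
    intro i s
    induction s with
    | zero => intro _; rfl
    | succ s ih =>
      intro hs
      rw [← ih (by omega)]
      have := H.mid_eq (k := ⟨i, s + 1⟩) (by rw [mem_pI]; exact hs)
      simp only [ppr, Nat.succ_ne_zero, if_false, Nat.add_sub_cancel] at this
      exact this.symm
  have k2 : ∀ k : ℕ, Wd (P.pI c) (P.pa c) (P.pb c) (P.md (c (k : ZMod n)) (c ((k : ZMod n) + 1))) =
      Wd (P.pI c) (P.pa c) (P.pb c) (P.md (c 0) (c (0 + 1))) := by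
    intro k
    induction k with
    | zero => simp
    | succ k ih =>
      rw [← ih]
      have hm := P.m_pos _ _ (ha (k : ZMod n))
      rw [← k1 (k : ZMod n) (P.m (c (k : ZMod n)) (c ((k : ZMod n) + 1)) - 1) (by omega)]
      have := H.mid_eq (k := ⟨(k : ZMod n) + 1, 0⟩) (by rw [mem_pI]; exact P.m_pos _ _ (ha _))
      simp only [ppr, if_true, add_sub_cancel_right] at this
      rw [this]
      push_cast
      rfl
  have := k2 i.val
  rwa [ZMod.natCast_zmod_val] at this

lemma off {u v : V} (h : G.Adj u v) (ha : ∀ i, G.Adj (c i) (c (i + 1)))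
    (hne : ∀ i, s(u, v) ≠ s(c i, c (i + 1))) {j : ℕ} (hj : j < P.m u v) {p : ℂ}
    (hp : p ∈ segment ℝ (P.q u v j) (P.q u v (j + 1)))
    (hp' : (p ≠ P.ps u ∨ ∀ i, u ≠ c i) ∧ (p ≠ P.ps v ∨ ∀ i, v ≠ c i)) :
    ∀ k ∈ P.pI c, p ∉ segment ℝ (P.pa c k) (P.pb c k) := by
  intro k hk hm
  rw [mem_pI] at hk
  obtain ⟨w, w1, w2, rfl⟩ := P.diff _ _ _ _ h (ha k.1) (hne k.1) j hj _ hk p hp hm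
  have hw : ∃ i, w = c i := by rcases w2 with e | e <;> exact ⟨_, e⟩
  obtain ⟨i, hi⟩ := hw
  rcases w1 with rfl | rfl
  · rcases hp'.1 with h | h
    · exact h rfl
    · exact h _ hi
  · rcases hp'.2 with h | h
    · exact h rfl
    · exact h _ hi

/-- near the first half, the other endpoint is avoided -/
lemma first_half {u v : V} (h : G.Adj u v) {p : ℂ} (hp : p ∈ segment ℝ (P.q u v 0) (P.md u v)) :
    p ∈ segment ℝ (P.q u v 0) (P.q u v (0 + 1)) ∧ p ≠ P.ps v := by
  have h0 := P.m_pos _ _ h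
  obtain ⟨h1, h2⟩ := seg_half (P.nd u v h 0 h0) hp
  refine ⟨h1, fun e => h2 ?_⟩
  rw [e] at h1 ⊢
  rw [P.end1 h h0 h1, P.q_last h]

lemma chain (hn : 3 ≤ n) (hc : Function.Injective c) (ha : ∀ i, G.Adj (c i) (c (i + 1)))
    {u v : V} (h : G.Adj u v) (hne : ∀ i, s(u, v) ≠ s(c i, c (i + 1))) :
    Wd (P.pI c) (P.pa c) (P.pb c) (P.md u v) = Wd (P.pI c) (P.pa c) (P.pb c) (P.md v u) := by
  have H := P.pgn hn hc ha
  have key : ∀ j, j < P.m u v → Wd (P.pI c) (P.pa c) (P.pb c) (P.md u v) =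
      Wd (P.pI c) (P.pa c) (P.pb c) (P.q u v j + (P.q u v (j + 1) - P.q u v j) / 2) := by
    intro j
    induction j with
    | zero => intro _; rfl
    | succ j ih =>
      intro hj
      rw [ih (by omega)]
      trans Wd (P.pI c) (P.pa c) (P.pb c) (P.q u v (j + 1))
      · refine Wd_line H.hP fun x hx => ?_
        obtain ⟨x1, x2⟩ := seg_half' (P.nd u v h j (by omega)) hx
        refine P.off h ha hne (by omega) x1 ⟨Or.inl fun e => ?_, Or.inl fun e => ?_⟩
        · rw [e] at x1 x2
          have := P.end0 h (by omega) x1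
          subst this
          exact x2 (P.q_zero u v h).symm
        · rw [e] at x1
          have := P.end1 h (by omega) x1
          omega
      · refine Wd_line H.hP fun x hx => ?_
        obtain ⟨x1, x2⟩ := seg_half (P.nd u v h (j + 1) (by omega)) hx
        refine P.off h ha hne hj x1 ⟨Or.inl fun e => ?_, Or.inl fun e => ?_⟩
        · rw [e] at x1 x2
          have := P.end0 h (by omega) x1
          omega
        · rw [e] at x1 x2
          have := P.end1 h hj x1
          rw [this, P.q_last h] at x2
          exact x2 rfl
  have hm := P.m_pos _ _ h
  rw [key (P.m u v - 1) (by omega)]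
  congr 1
  unfold md
  rw [P.q_rev u v h 0 (by omega), P.q_rev u v h 1 hm, Nat.sub_add_cancel hm, Nat.sub_zero]
  ring

lemma at_vertex (hn : 3 ≤ n) (hc : Function.Injective c) (ha : ∀ i, G.Adj (c i) (c (i + 1)))
    {w x : V} (h : G.Adj w x) (hw : ∀ i, w ≠ c i) :
    Wd (P.pI c) (P.pa c) (P.pb c) (P.md w x) = Wd (P.pI c) (P.pa c) (P.pb c) (P.ps w) := by
  have H := P.pgn hn hc ha
  symm
  refine Wd_line H.hP fun p hp => ?_
  rw [← P.q_zero w x h] at hp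
  obtain ⟨p1, p2⟩ := P.first_half h hp
  refine P.off h ha ?_ (P.m_pos _ _ h) p1 ⟨Or.inr hw, Or.inl p2⟩
  intro i e
  rcases Sym2.eq_iff.1 e with ⟨e1, -⟩ | ⟨e1, -⟩ <;> exact hw _ e1

lemma at_cycle (hn : 3 ≤ n) (hc : Function.Injective c) (ha : ∀ i, G.Adj (c i) (c (i + 1)))
    {i : ZMod n} {x : V} (h : G.Adj (c i) x) (h1 : x ≠ c (i - 1)) (h2 : x ≠ c (i + 1)) :
    Wd (P.pI c) (P.pa c) (P.pb c) (P.md (c i) x) ≠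
      Wd (P.pI c) (P.pa c) (P.pb c) (P.md (c i) (c (i + 1))) ↔
    cyc (P.ang (c i) (c (i - 1))) (P.ang (c i) x) (P.ang (c i) (c (i + 1))) := by
  have H := P.pgn hn hc ha
  have hq0 : P.pa c ⟨i, 0⟩ = P.ps (c i) := P.q_zero _ _ (ha i)
  have hd : P.q (c i) x 1 - P.ps (c i) ≠ 0 := sub_ne_zero.2 (P.q1_ne h)
  have h0 : (P.q (c i) x 1 - P.ps (c i)) / 2 ≠ 0 := by simpa using hd
  have := H.side (k := ⟨i, 0⟩) (by rw [mem_pI]; exact P.m_pos _ _ (ha i)) h0 ?_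
  · have e1 : P.pa c (P.ppr c ⟨i, 0⟩) = P.q (c i) (c (i - 1)) 1 := by
      simp only [ppr, if_true, pa]
      have h3 := ha (i - 1)
      rw [sub_add_cancel] at h3 ⊢
      rw [P.q_rev _ _ h3 1 (P.m_pos _ _ h3)]
    have e2 : (P.q (c i) x 1 - P.ps (c i)) / 2 =
      ((1 / 2 : ℝ) : ℂ) * (P.q (c i) x 1 - P.ps (c i)) := by push_cast; ring
    rw [e1, hq0] at this
    rw [show ((P.q (c i) x 1 - P.ps (c i)) / 2).arg = P.ang (c i) x by
      rw [e2, Complex.arg_real_mul _ (by norm_num)]; rfl] at this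
    unfold md
    rw [P.q_zero _ _ h, P.q_zero _ _ (ha i)]
    exact this
  · intro t ht
    have hm : P.pa c ⟨i, 0⟩ + t * ((P.q (c i) x 1 - P.ps (c i)) / 2) ∈
        segment ℝ (P.q (c i) x 0) (P.md (c i) x) := by
      rw [segment_eq_image']
      refine ⟨t, ⟨ht.1.le, ht.2⟩, ?_⟩
      unfold md
      simp only [Complex.real_smul, add_sub_cancel_left]
      rw [hq0, P.q_zero _ _ h]
    obtain ⟨p1, p2⟩ := P.first_half h hm
    refine P.off h ha ?_ (P.m_pos _ _ h) p1 ⟨Or.inl ?_, Or.inl p2⟩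
    · intro j e
      rcases Sym2.eq_iff.1 e with ⟨e1, e2⟩ | ⟨e1, e2⟩
      · have := hc e1; subst this; exact h2 e2
      · have := hc e1; subst this; exact h1 (by simpa using e2)
    · rw [hq0]; exact mul_pos_ne h0 ht.1

end poly

theorem rot : Rot G P.ang where
  inj := P.ang_inj
  lo v x := by have := Complex.neg_pi_lt_arg (P.q v x 1 - P.ps v); have := Real.pi_lt_four; unfold ang; linarith
  hi v x := by have := Complex.arg_le_pi (P.q v x 1 - P.ps v); have := Real.pi_lt_four; unfold ang; linarith
  side n c hn hc ha := by
    haveI : NeZero n := ⟨by omega⟩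
    refine ⟨fun u w => Wd (P.pI c) (P.pa c) (P.pb c) (P.md u w) ≠
      Wd (P.pI c) (P.pa c) (P.pb c) (P.md (c 0) (c (0 + 1))), ?_, ?_, ?_⟩
    · intro u v h hne
      simp only [P.chain hn hc ha h hne]
    · intro w hw x y hx hy
      simp only [P.at_vertex hn hc ha hx hw, P.at_vertex hn hc ha hy hw]
    · intro i h hi h1 h2
      rw [← P.at_cycle hn hc ha hi h1 h2, P.mids hn hc ha i]

end PL

end PA3_sec

section PA4_sec

section chain

/-- discrete chain -/
structure Chn (K : Set ℂ) (δ : ℝ) (m : ℕ) (z : ℕ → ℂ) : Prop where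
  mem : ∀ i ≤ m, z i ∈ K
  ne : ∀ i < m, z i ≠ z (i + 1)
  lt : ∀ i < m, dist (z i) (z (i + 1)) < δ
  far : ∀ i j, i + 2 ≤ j → j ≤ m → δ ≤ dist (z i) (z j)

lemma Chn.rev {K : Set ℂ} {δ : ℝ} {m : ℕ} {z : ℕ → ℂ} (h : Chn K δ m z) :
    Chn K δ m (fun i => z (m - i)) where
  mem i hi := h.mem _ (Nat.sub_le _ _)
  ne i hi := by
    have := (h.ne (m - (i + 1)) (by omega)).symm
    rwa [show m - (i + 1) + 1 = m - i by omega] at this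
  lt i hi := by
    have := h.lt (m - (i + 1)) (by omega)
    rwa [show m - (i + 1) + 1 = m - i by omega, dist_comm] at this
  far i j hi hj := by
    rw [dist_comm]
    exact h.far _ _ (by omega) (by omega)

lemma Chn.exists {K : Set ℂ} (hK : IsPreconnected K) {a b : ℂ} (ha : a ∈ K) (hb : b ∈ K)
    {δ : ℝ} (hδ : 0 < δ) : ∃ m z, z 0 = a ∧ z m = b ∧ Chn K δ m z := by
  let H : SimpleGraph K :=
    { Adj := fun x y => x ≠ y ∧ dist x y < δ
      symm := ⟨fun x y h => ⟨h.1.symm, by rw [dist_comm]; exact h.2⟩⟩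
      loopless := ⟨fun x h => h.1 rfl⟩ }
  have hr : ∀ x y : K, H.Reachable x y := by
    have : PreconnectedSpace K := isPreconnected_iff_preconnectedSpace.1 hK
    intro x y
    refine (isPreconnected_univ (α := K)).induction₂ H.Reachable ?_ ?_ ?_ (mem_univ x) (mem_univ y)
    · intro x _
      rw [nhdsWithin_univ]
      filter_upwards [Metric.ball_mem_nhds x hδ] with y hy
      by_cases e : x = y
      · rw [e]
      · exact SimpleGraph.Adj.reachable ⟨e, by rw [dist_comm]; exact hy⟩
    · intro x y z _ _ _ h1 h2; exact h1.trans h2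
    · intro x y _ _ h; exact h.symm
  have hc : H.Connected := by
    haveI : Nonempty K := ⟨⟨a, ha⟩⟩
    exact ⟨hr⟩
  obtain ⟨p, hp⟩ := hc.exists_walk_length_eq_dist ⟨a, ha⟩ ⟨b, hb⟩
  have d1 : ∀ i, H.dist ⟨a, ha⟩ (p.getVert i) ≤ i := by
    intro i
    refine (SimpleGraph.dist_le (p.take i)).trans ?_
    simp
  have d2 : ∀ i, H.dist (p.getVert i) ⟨b, hb⟩ ≤ p.length - i := by
    intro i
    refine (SimpleGraph.dist_le (p.drop i)).trans ?_
    simp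
  refine ⟨p.length, fun i => (p.getVert i : ℂ), by simp, by simp, ?_, ?_, ?_, ?_⟩
  · intro i _; exact (p.getVert i).2
  · intro i hi e
    exact (p.adj_getVert_succ hi).1 (Subtype.ext e)
  · intro i hi; exact (p.adj_getVert_succ hi).2
  · intro i j hij hj
    by_contra! hlt
    have t1 := hc.dist_triangle (u := ⟨a, ha⟩) (v := p.getVert i) (w := ⟨b, hb⟩)
    have t2 := hc.dist_triangle (u := p.getVert i) (v := p.getVert j) (w := ⟨b, hb⟩)
    have t3 : H.dist (p.getVert i) (p.getVert j) ≤ 1 := by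
      by_cases e : p.getVert i = p.getVert j
      · rw [e]; simp
      · have : H.Adj (p.getVert i) (p.getVert j) := ⟨e, hlt⟩
        rw [SimpleGraph.dist_eq_one_iff_adj.2 this]
    have := d1 i
    have := d2 j
    omega

lemma ray_close {x y w p : ℂ} {δ : ℝ} (hp : p ≠ y) (h1 : p ∈ segment ℝ y x) (h2 : p ∈ segment ℝ y w)
    (hx : dist x y < δ) (hw : dist w y < δ) : dist x w < δ := by
  rw [segment_eq_image'] at h1 h2
  obtain ⟨s, hs, e1⟩ := h1
  obtain ⟨t, ht, e2⟩ := h2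
  simp only [Complex.real_smul] at e1 e2
  wlog hst : s ≤ t generalizing x w s t
  · rw [dist_comm]
    exact this hw hx t ht e2 s hs e1 (le_of_not_ge hst)
  have hs0 : 0 < s := lt_of_le_of_ne hs.1 fun e => hp (by rw [← e1, ← e]; simp)
  have ht0 : 0 < t := hs0.trans_le hst
  have e3 : w - y = ((s / t : ℝ) : ℂ) * (x - y) := by
    have : (t : ℂ) ≠ 0 := by exact_mod_cast ht0.ne'
    push_cast
    field_simp
    linear_combination e2 - e1
  have e4 : x - w = ((1 - s / t : ℝ) : ℂ) * (x - y) := by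
    push_cast at e3 ⊢
    linear_combination -e3
  have h01 : s / t ≤ 1 := div_le_one_of_le₀ hst ht0.le
  have h00 : 0 < s / t := by positivity
  rw [dist_eq_norm, e4, norm_mul, Complex.norm_real, Real.norm_of_nonneg (by linarith)]
  rw [dist_eq_norm] at hx
  nlinarith [norm_nonneg (x - y)]

lemma seg_dist {a b p : ℂ} (h : p ∈ segment ℝ a b) : dist a p + dist p b = dist a b :=
  dist_add_dist_of_mem_segment h

lemma Chn.same {K : Set ℂ} {δ : ℝ} {m : ℕ} {z : ℕ → ℂ} (h : Chn K δ m z) {i j : ℕ} (hij : i < j)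
    (hj : j < m) {p : ℂ} (h1 : p ∈ segment ℝ (z i) (z (i + 1))) (h2 : p ∈ segment ℝ (z j) (z (j + 1))) :
    j = i + 1 ∧ p = z j := by
  have s1 := seg_dist h1
  have s2 := seg_dist h2
  have l1 := h.lt i (by omega)
  have l2 := h.lt j (by omega)
  have e : j = i + 1 := by
    by_contra hne
    have f1 := h.far i j (by omega) (by omega)
    have f2 := h.far (i + 1) (j + 1) (by omega) (by omega)
    have t1 := dist_triangle (z i) p (z j)
    have t2 := dist_triangle (z (i + 1)) p (z (j + 1))
    rw [dist_comm p (z j)] at t1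
    rw [dist_comm (z (i + 1)) p] at t2
    linarith
  refine ⟨e, ?_⟩
  subst e
  by_contra hp
  rw [segment_symm] at h1
  have := ray_close hp h1 h2 l1 (by rw [dist_comm]; exact l2)
  have f1 := h.far i (i + 1 + 1) (by omega) (by omega)
  linarith

end chain

section surgery

/-- cutting an arc outside of two discs -/
lemma surgery {f : ℝ → ℂ} (hf : ContinuousOn f (Icc 0 1)) {r : ℝ}
    (hr : 2 * r < dist (f 0) (f 1)) (hr0 : 0 < r) : ∃ X Y : ℂ, ∃ K : Set ℂ,
    K ⊆ f '' Icc 0 1 ∧ IsCompact K ∧ IsPreconnected K ∧ X ∈ K ∧ Y ∈ K ∧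
    dist X (f 0) = r ∧ dist Y (f 1) = r ∧
    (∀ z ∈ K, r ≤ dist z (f 0) ∧ (dist z (f 0) = r → z = X)) ∧
    (∀ z ∈ K, r ≤ dist z (f 1) ∧ (dist z (f 1) = r → z = Y)) := by
  have c0 : ContinuousOn (fun t => dist (f t) (f 0)) (Icc 0 1) := by fun_prop
  have c1 : ContinuousOn (fun t => dist (f t) (f 1)) (Icc 0 1) := by fun_prop
  have k0 : IsCompact (Icc (0 : ℝ) 1 ∩ (fun t => dist (f t) (f 0)) ⁻¹' Iic r) :=
    isCompact_Icc.of_isClosed_subset (c0.preimage_isClosed_of_isClosed isClosed_Icc isClosed_Iic)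
      inter_subset_left
  obtain ⟨s, ⟨hs, hsr⟩, hsm⟩ := k0.exists_isGreatest ⟨0, ⟨le_rfl, zero_le_one⟩, by simp [hr0.le]⟩
  simp only [mem_preimage, mem_Iic] at hsr
  have hs' : ∀ t, s < t → t ≤ 1 → r < dist (f t) (f 0) := by
    intro t h1 h2
    by_contra! h
    have := hsm ⟨⟨hs.1.trans h1.le, h2⟩, h⟩
    linarith
  have es : dist (f s) (f 0) = r := by
    have := intermediate_value_Icc hs.2 (c0.mono (Icc_subset_Icc hs.1 le_rfl))
    obtain ⟨t, ht, e⟩ := this (show r ∈ Icc _ _ from ⟨hsr, by rw [dist_comm]; linarith⟩)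
    rcases ht.1.eq_or_lt with h | h
    · rw [h]; exact e
    · have := hs' t h ht.2
      simp only at e
      linarith
  have k1 : IsCompact (Icc s 1 ∩ (fun t => dist (f t) (f 1)) ⁻¹' Iic r) :=
    isCompact_Icc.of_isClosed_subset ((c1.mono (Icc_subset_Icc hs.1 le_rfl)).preimage_isClosed_of_isClosed
      isClosed_Icc isClosed_Iic) inter_subset_left
  obtain ⟨t, ⟨ht, htr⟩, htm⟩ := k1.exists_isLeast ⟨1, ⟨hs.2, le_rfl⟩, by simp [hr0.le]⟩
  simp only [mem_preimage, mem_Iic] at htr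
  have ht' : ∀ x, s ≤ x → x < t → r < dist (f x) (f 1) := by
    intro x h1 h2
    by_contra! h
    have := htm ⟨⟨h1, h2.le.trans ht.2⟩, h⟩
    linarith
  have et : dist (f t) (f 1) = r := by
    have := intermediate_value_Icc' ht.1 (c1.mono (Icc_subset_Icc hs.1 ht.2))
    have tr := dist_triangle (f 0) (f s) (f 1)
    rw [dist_comm (f 0) (f s)] at tr
    obtain ⟨x, hx, e⟩ := this (show r ∈ Icc _ _ from ⟨htr, by linarith⟩)
    rcases hx.2.eq_or_lt with h | h
    · rw [← h]; exact e
    · have := ht' x hx.1 h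
      simp only at e
      linarith
  have sub : Icc s t ⊆ Icc 0 1 := Icc_subset_Icc hs.1 ht.2
  refine ⟨f s, f t, f '' Icc s t, image_mono sub, isCompact_Icc.image_of_continuousOn (hf.mono sub),
    isPreconnected_Icc.image _ (hf.mono sub), mem_image_of_mem _ ⟨le_rfl, ht.1⟩,
    mem_image_of_mem _ ⟨ht.1, le_rfl⟩, es, et, ?_, ?_⟩
  · rintro _ ⟨x, hx, rfl⟩
    rcases hx.1.eq_or_lt with h | h
    · rw [← h]; exact ⟨es.ge, fun _ => rfl⟩
    · have := hs' x h (hx.2.trans ht.2)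
      exact ⟨this.le, fun e => by linarith⟩
  · rintro _ ⟨x, hx, rfl⟩
    rcases hx.2.eq_or_lt with h | h
    · rw [h]; exact ⟨et.ge, fun _ => rfl⟩
    · have := ht' x hx.1 h
      exact ⟨this.le, fun e => by linarith⟩

end surgery

end PA4_sec

section PA5_sec

section thick
variable {V ι : Type*}

/-- topological drawing -/
structure TD (en : ι → Sym2 V) (ps : V → ℂ) (AR : ι → Set ℂ) : Prop where
  inj : Function.Injective ps
  loop : ∀ e u v, en e = s(u, v) → u ≠ v
  curve : ∀ e u v, en e = s(u, v) → ∃ f : ℝ → ℂ, ContinuousOn f (Icc 0 1) ∧ f 0 = ps u ∧ f 1 = ps v ∧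
    f '' Icc 0 1 = AR e
  inter : ∀ e e', e ≠ e' → ∀ z ∈ AR e, z ∈ AR e' → ∃ w, w ∈ en e ∧ w ∈ en e' ∧ z = ps w
  vx : ∀ e w, ps w ∈ AR e → w ∈ en e

/-- drawing with straight ends -/
structure TK (en : ι → Sym2 V) (ps : V → ℂ) (r : ℝ) (K : ι → Set ℂ) (X : ι → V → ℂ) : Prop where
  r0 : 0 < r
  cpt : ∀ e, IsCompact (K e)
  cn : ∀ e, IsPreconnected (K e)
  vm : ∀ e, ∀ w ∈ en e, ps w ∈ K e
  ball : ∀ e, ∀ w ∈ en e, ∀ z ∈ K e, dist z (ps w) < r → z ∈ segment ℝ (ps w) (X e w)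
  Xi : ∀ e e', e ≠ e' → ∀ w ∈ en e, w ∈ en e' → ∀ z ∈ segment ℝ (ps w) (X e w),
    z ∈ segment ℝ (ps w) (X e' w) → z = ps w
  int : ∀ e e', e ≠ e' → ∀ z ∈ K e, z ∈ K e' → ∃ w, w ∈ en e ∧ w ∈ en e' ∧ z = ps w

lemma ray_eq {y x w p : ℂ} {r : ℝ} (hp : p ≠ y) (h1 : p ∈ segment ℝ y x) (h2 : p ∈ segment ℝ y w)
    (hx : dist x y = r) (hw : dist w y = r) : x = w := by
  rw [segment_eq_image'] at h1 h2
  obtain ⟨s, hs, e1⟩ := h1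
  obtain ⟨t, ht, e2⟩ := h2
  simp only [Complex.real_smul] at e1 e2
  have hs0 : 0 < s := lt_of_le_of_ne hs.1 fun e => hp (by rw [← e1, ← e]; simp)
  have ht0 : 0 < t := lt_of_le_of_ne ht.1 fun e => hp (by rw [← e2, ← e]; simp)
  have e3 : (s : ℂ) * (x - y) = t * (w - y) := by linear_combination e1 - e2
  have e4 := congrArg norm e3
  rw [norm_mul, norm_mul, Complex.norm_real, Complex.norm_real, Real.norm_of_nonneg hs0.le,
    Real.norm_of_nonneg ht0.le, ← dist_eq_norm, ← dist_eq_norm, hx, hw] at e4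
  have hr : r ≠ 0 := by
    intro h0
    rw [h0, dist_eq_zero] at hx
    exact hp (by rw [← e1, hx]; simp)
  have e5 : s = t := mul_right_cancel₀ hr e4
  subst e5
  have := mul_left_cancel₀ (by exact_mod_cast hs0.ne') e3
  linear_combination this

variable {en : ι → Sym2 V} {ps : V → ℂ} {AR : ι → Set ℂ}

lemma TD.radius [Finite V] [Finite ι] (T : TD en ps AR) : ∃ r, 0 < r ∧
    (∀ u v, u ≠ v → 2 * r < dist (ps u) (ps v)) ∧
    (∀ e w, w ∉ en e → ∀ z ∈ AR e, r < dist z (ps w)) := by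
  have h1 : ∀ᶠ r : ℝ in nhdsWithin 0 (Ioi 0), ∀ u v, u ≠ v → 2 * r < dist (ps u) (ps v) := by
    refine Filter.eventually_all.2 fun u => Filter.eventually_all.2 fun v => ?_
    by_cases h : u = v
    · exact Filter.Eventually.of_forall fun _ h' => absurd h h'
    · have : 0 < dist (ps u) (ps v) := dist_pos.2 fun e => h (T.inj e)
      filter_upwards [nhdsWithin_le_nhds (Iio_mem_nhds (half_pos this))] with r hr _
      rw [mem_Iio] at hr
      linarith
  have h2 : ∀ᶠ r : ℝ in nhdsWithin 0 (Ioi 0), ∀ e w, w ∉ en e → ∀ z ∈ AR e, r < dist z (ps w) := by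
    refine Filter.eventually_all.2 fun e => Filter.eventually_all.2 fun w => ?_
    by_cases h : w ∈ en e
    · exact Filter.Eventually.of_forall fun _ h' => absurd h h'
    · have hcl : IsClosed (AR e) := by
        obtain ⟨⟨u, v⟩, hq⟩ := Quot.exists_rep (en e)
        obtain ⟨f, hf, -, -, h3⟩ := T.curve e u v hq.symm
        rw [← h3]
        exact (isCompact_Icc.image_of_continuousOn hf).isClosed
      obtain ⟨ε, e0, he⟩ := Metric.isOpen_iff.1 hcl.isOpen_compl (ps w) (fun hh => h (T.vx e w hh))
      filter_upwards [nhdsWithin_le_nhds (Iio_mem_nhds e0)] with r hr _ z hz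
      rw [mem_Iio] at hr
      by_contra! h'
      exact he (Metric.mem_ball.2 (h'.trans_lt hr)) hz
  obtain ⟨r, h1, h2, h3⟩ := (h1.and (h2.and self_mem_nhdsWithin)).exists
  exact ⟨r, h3, h1, h2⟩

lemma TD.edge (T : TD en ps AR) {r : ℝ} (r0 : 0 < r)
    (hr : ∀ u v, u ≠ v → 2 * r < dist (ps u) (ps v)) (e : ι) : ∃ (K : Set ℂ) (X : V → ℂ),
    K ⊆ AR e ∧ IsCompact (K ∪ ⋃ w ∈ {w | w ∈ en e}, segment ℝ (ps w) (X w)) ∧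
    IsPreconnected (K ∪ ⋃ w ∈ {w | w ∈ en e}, segment ℝ (ps w) (X w)) ∧
    ∀ w ∈ en e, X w ∈ K ∧ dist (X w) (ps w) = r ∧
      ∀ z ∈ K, r ≤ dist z (ps w) ∧ (dist z (ps w) = r → z = X w) := by
  classical
  obtain ⟨⟨u, v⟩, hq⟩ := Quot.exists_rep (en e)
  have hq' : en e = s(u, v) := hq.symm
  have huv := T.loop e u v hq'
  obtain ⟨f, hf, f0, f1, h3⟩ := T.curve e u v hq'
  obtain ⟨X, Y, K, k1, k2, k3, k4, k5, k6, k7, k8, k9⟩ := surgery hf (r := r)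
    (by rw [f0, f1]; exact hr u v huv) r0
  have hU : (⋃ w ∈ {w | w ∈ en e}, segment ℝ (ps w) (if w = u then X else Y)) =
      segment ℝ (ps u) X ∪ segment ℝ (ps v) Y := by
    have : {w | w ∈ en e} = {u, v} := by ext w; simp [hq']
    rw [this, biUnion_pair, if_pos rfl, if_neg huv.symm]
  refine ⟨K, fun w => if w = u then X else Y, h3 ▸ k1, ?_, ?_, ?_⟩
  · rw [hU]
    have hseg : ∀ a b : ℂ, IsCompact (segment ℝ a b) := by
      intro a b
      rw [segment_eq_image']
      exact isCompact_Icc.image (by fun_prop)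
    exact k2.union ((hseg _ _).union (hseg _ _))
  · rw [hU, ← union_assoc]
    have hseg : ∀ a b : ℂ, IsPreconnected (segment ℝ a b) := fun a b =>
      (convex_segment a b).isPreconnected
    refine IsPreconnected.union Y (Or.inl k5) (right_mem_segment ℝ _ _) ?_ (hseg _ _)
    exact IsPreconnected.union X k4 (right_mem_segment ℝ _ _) k3 (hseg _ _)
  · intro w hw
    rw [hq', Sym2.mem_iff] at hw
    rw [f0] at k6 k8
    rw [f1] at k7 k9
    rcases hw with rfl | rfl
    · simp only [if_true]
      exact ⟨k4, k6, k8⟩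
    · simp only [if_neg huv.symm]
      exact ⟨k5, k7, k9⟩

lemma seg_le {y x z : ℂ} {r : ℝ} (h : z ∈ segment ℝ y x) (hx : dist x y = r) : dist z y ≤ r := by
  have := seg_dist h
  rw [dist_comm y z, dist_comm y x] at this
  have := dist_nonneg (x := z) (y := x)
  linarith

lemma seg_end {y x z : ℂ} {r : ℝ} (h : z ∈ segment ℝ y x) (hx : dist x y = r) (hz : r ≤ dist z y) :
    z = x := by
  have := seg_dist h
  rw [dist_comm y z, dist_comm y x] at this
  have := dist_nonneg (x := z) (y := x)
  exact dist_eq_zero.1 (by linarith)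

lemma TD.thick [Finite V] [Finite ι] (T : TD en ps AR) : ∃ r K X, TK en ps r K X := by
  obtain ⟨r, r0, hr, ha⟩ := T.radius
  choose K X h1 h2 h3 h4 using T.edge r0 hr
  have hX : ∀ e e', e ≠ e' → ∀ w ∈ en e, w ∈ en e' → X e w ≠ X e' w := by
    intro e e' hne w hw hw' he
    have m1 := h1 e (h4 e w hw).1
    have m2 := h1 e' (h4 e' w hw').1
    rw [← he] at m2
    obtain ⟨w', -, -, e3⟩ := T.inter e e' hne _ m1 m2
    have d := (h4 e w hw).2.1
    rw [e3] at d
    by_cases hww : w' = w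
    · rw [hww, dist_self] at d
      linarith
    · have := hr w' w hww
      linarith
  -- segment against curve
  have hsc : ∀ e e', e ≠ e' → ∀ z ∈ K e, ∀ w ∈ en e', z ∈ segment ℝ (ps w) (X e' w) → False := by
    intro e e' hne z hz w hw hs
    have hle := seg_le hs (h4 e' w hw).2.1
    by_cases hwe : w ∈ en e
    · obtain ⟨g1, g2⟩ := (h4 e w hwe).2.2 z hz
      have := g2 (le_antisymm hle g1)
      have h' := seg_end hs (h4 e' w hw).2.1 g1
      exact hX e e' hne w hwe hw (this.symm.trans h')
    · have := ha e w hwe z (h1 e hz)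
      linarith
  have hXi : ∀ e e', e ≠ e' → ∀ w ∈ en e, w ∈ en e' → ∀ z ∈ segment ℝ (ps w) (X e w),
      z ∈ segment ℝ (ps w) (X e' w) → z = ps w := by
    intro e e' hne w hw hw' z hz hz'
    by_contra hzw
    exact hX e e' hne w hw hw' (ray_eq hzw hz hz' (h4 e w hw).2.1 (h4 e' w hw').2.1)
  refine ⟨r, fun e => K e ∪ ⋃ w ∈ {w | w ∈ en e}, segment ℝ (ps w) (X e w), X, r0, h2, h3, ?_, ?_,
    hXi, ?_⟩
  · intro e w hw
    exact Or.inr (mem_biUnion hw (left_mem_segment ℝ _ _))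
  · intro e w hw z hz hd
    rcases hz with hz | hz
    · exact absurd ((h4 e w hw).2.2 z hz).1 (not_le.2 hd)
    · obtain ⟨w', hw', hz⟩ := mem_iUnion₂.1 hz
      by_cases hww : w' = w
      · rw [← hww]; exact hz
      · have := hr w' w hww
        have := seg_le hz (h4 e w' hw').2.1
        have := dist_triangle (ps w') z (ps w)
        rw [dist_comm (ps w') z] at this
        linarith
  · intro e e' hne z hz hz'
    rcases hz with hz | hz
    · rcases hz' with hz' | hz'
      · exact T.inter e e' hne z (h1 e hz) (h1 e' hz')
      · obtain ⟨w', hw', hz'⟩ := mem_iUnion₂.1 hz'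
        exact (hsc e e' hne z hz w' hw' hz').elim
    · obtain ⟨w, hw, hz⟩ := mem_iUnion₂.1 hz
      rcases hz' with hz' | hz'
      · exact (hsc e' e hne.symm z hz' w hw hz).elim
      · obtain ⟨w', hw', hz'⟩ := mem_iUnion₂.1 hz'
        by_cases hww : w' = w
        · subst hww
          exact ⟨w', hw, hw', hXi e e' hne w' hw hw' z hz hz'⟩
        · have := hr w' w hww
          have := seg_le hz (h4 e w hw).2.1
          have := seg_le hz' (h4 e' w' hw').2.1
          have := dist_triangle (ps w') z (ps w)
          rw [dist_comm (ps w') z] at this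
          linarith

variable {r : ℝ} {K : ι → Set ℂ} {X : ι → V → ℂ}

lemma TK.delta [Finite V] [Finite ι] (T : TK en ps r K X) : ∃ δ, 0 < δ ∧ δ < r / 2 ∧
    ∀ e e', e ≠ e' → ∀ a ∈ K e, ∀ c ∈ K e', dist a c < 2 * δ →
      ∃ w, w ∈ en e ∧ w ∈ en e' ∧ dist a (ps w) < r / 2 ∧ dist c (ps w) < r / 2 := by
  have h1 : ∀ᶠ δ : ℝ in nhdsWithin 0 (Ioi 0), ∀ e e', e ≠ e' → ∀ a ∈ K e, ∀ c ∈ K e', dist a c < 2 * δ →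
      ∃ w, w ∈ en e ∧ w ∈ en e' ∧ dist a (ps w) < r / 2 ∧ dist c (ps w) < r / 2 := by
    refine Filter.eventually_all.2 fun e => Filter.eventually_all.2 fun e' => ?_
    by_cases h : e = e'
    · exact Filter.Eventually.of_forall fun _ h' => absurd h h'
    · have hB : IsCompact ((K e ×ˢ K e') ∩ ⋂ w ∈ {w | w ∈ en e ∧ w ∈ en e'},
          ({p : ℂ × ℂ | r / 2 ≤ dist p.1 (ps w)} ∪ {p : ℂ × ℂ | r / 2 ≤ dist p.2 (ps w)})) := by
        refine ((T.cpt e).prod (T.cpt e')).inter_right (isClosed_biInter fun w _ => ?_)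
        exact (isClosed_le continuous_const (by fun_prop)).union
          (isClosed_le continuous_const (by fun_prop))
      obtain ⟨d, d0, hd⟩ := hB.exists_forall_le' (f := fun p : ℂ × ℂ => dist p.1 p.2) (a := 0)
        (by fun_prop) (by
          rintro ⟨a, c⟩ ⟨⟨ha, hc⟩, hw⟩
          refine dist_pos.2 fun e1 => ?_
          simp only at e1 ha hc
          subst e1
          obtain ⟨w, w1, w2, rfl⟩ := T.int e e' h a ha hc
          have := mem_iInter₂.1 hw w ⟨w1, w2⟩
          have hr := T.r0
          simp at this
          linarith)
      filter_upwards [nhdsWithin_le_nhds (Iio_mem_nhds (half_pos d0))] with δ hδ _ a ha c hc hac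
      rw [mem_Iio] at hδ
      by_contra! hno
      have := hd (a, c) ⟨⟨ha, hc⟩, mem_iInter₂.2 fun w hw => by
        by_cases hh : dist a (ps w) < r / 2
        · exact Or.inr (hno w hw.1 hw.2 hh)
        · exact Or.inl (not_lt.1 hh)⟩
      simp only at this
      linarith
  have hr := T.r0
  have h2 : ∀ᶠ δ : ℝ in nhdsWithin 0 (Ioi 0), δ < r / 2 :=
    nhdsWithin_le_nhds (Iio_mem_nhds (half_pos hr))
  obtain ⟨δ, h1, h2, h3⟩ := (h1.and (h2.and self_mem_nhdsWithin)).exists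
  exact ⟨δ, h3, h2, h1⟩

lemma TK.cross (T : TK en ps r K X) {δ : ℝ} (hδ : δ < r / 2)
    (H : ∀ e e', e ≠ e' → ∀ a ∈ K e, ∀ c ∈ K e', dist a c < 2 * δ →
      ∃ w, w ∈ en e ∧ w ∈ en e' ∧ dist a (ps w) < r / 2 ∧ dist c (ps w) < r / 2)
    {e e' : ι} (hne : e ≠ e') {a b c d p : ℂ} (ha : a ∈ K e) (hb : b ∈ K e) (hc : c ∈ K e')
    (hd : d ∈ K e') (hab : dist a b < δ) (hcd : dist c d < δ) (h1 : p ∈ segment ℝ a b)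
    (h2 : p ∈ segment ℝ c d) : ∃ w, w ∈ en e ∧ w ∈ en e' ∧ p = ps w := by
  have s1 := seg_dist h1
  have s2 := seg_dist h2
  have := dist_nonneg (x := p) (y := b)
  have := dist_nonneg (x := p) (y := d)
  have t := dist_triangle a p c
  rw [dist_comm p c] at t
  obtain ⟨w, w1, w2, w3, w4⟩ := H e e' hne a ha c hc (by linarith)
  refine ⟨w, w1, w2, ?_⟩
  have t1 := dist_triangle b a (ps w)
  have t2 := dist_triangle d c (ps w)
  rw [dist_comm b a] at t1
  rw [dist_comm d c] at t2
  have m := T.ball e w w1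
  have m' := T.ball e' w w2
  have hr := T.r0
  exact T.Xi e e' hne w w1 w2 p
    ((convex_segment _ _).segment_subset (m a ha (by linarith)) (m b hb (by linarith)) h1)
    ((convex_segment _ _).segment_subset (m' c hc (by linarith)) (m' d hd (by linarith)) h2)

end thick

end PA5_sec

section PA6_sec

lemma TK.edgeChain {V ι : Type*} {en : ι → Sym2 V} {ps : V → ℂ} {r : ℝ} {K : ι → Set ℂ} {X : ι → V → ℂ}
    (T : TK en ps r K X) (hl : ∀ e u v, en e = s(u, v) → u ≠ v) {δ : ℝ} (hδ : 0 < δ) (e : ι) :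
    ∃ (m : ℕ) (q : V → ℕ → ℂ), ∀ u v, en e = s(u, v) → q u 0 = ps u ∧ q u m = ps v ∧
      (∀ i ≤ m, q v i = q u (m - i)) ∧ Chn (K e) δ m (q u) := by
  classical
  obtain ⟨⟨a, b⟩, hq⟩ := Quot.exists_rep (en e)
  have hq' : en e = s(a, b) := hq.symm
  have hab := hl e a b hq'
  obtain ⟨m, z, z0, zm, hz⟩ := Chn.exists (T.cn e) (T.vm e a (by simp [hq'])) (T.vm e b (by simp [hq'])) hδ
  refine ⟨m, fun w i => if w = a then z i else z (m - i), fun u v huv => ?_⟩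
  rw [hq'] at huv
  rcases Sym2.eq_iff.1 huv with ⟨rfl, rfl⟩ | ⟨rfl, rfl⟩
  · simp only [if_true, if_neg hab.symm]
    exact ⟨z0, zm, fun i _ => trivial, hz⟩
  · simp only [if_true, if_neg hab.symm]
    refine ⟨by simpa using zm, by simpa using z0, fun i hi => ?_, hz.rev⟩
    rw [Nat.sub_sub_self hi]

theorem exists_PL {V : Type u} [Finite V] {G : SimpleGraph V} (E : PlaneEmbedding G) : Nonempty (PL G) := by
  let Φ := Complex.equivRealProdCLM.symm
  let AR : G.edgeSet → Set ℂ := fun e => {z | ∃ (u v : V) (h : G.Adj u v), s(u, v) = e.1 ∧ z ∈ Φ '' E.arc h}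
  have hAR : ∀ (e : G.edgeSet) (u v : V) (h : G.Adj u v), e.1 = s(u, v) → AR e = Φ '' E.arc h := by
    intro e u v h he
    ext z
    constructor
    · rintro ⟨u', v', h', e1, hz⟩
      rw [he] at e1
      rcases Sym2.eq_iff.1 e1 with ⟨rfl, rfl⟩ | ⟨rfl, rfl⟩
      · exact hz
      · rwa [← E.arc_symm h]
    · intro hz
      exact ⟨u, v, h, he.symm, hz⟩
  have hadj : ∀ (e : G.edgeSet) (u v : V), e.1 = s(u, v) → G.Adj u v := by
    intro e u v h
    have := e.2
    rw [h] at this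
    exact this
  have TT : TD (Subtype.val : G.edgeSet → Sym2 V) (fun v => Φ (E.pos v)) AR := by
    refine ⟨fun u v h => E.pos_inj (Φ.injective h), fun e u v h => (hadj e u v h).ne, ?_, ?_, ?_⟩
    · intro e u v h
      obtain ⟨f, f1, -, f3, f4, f5⟩ := E.arc_curve (hadj e u v h)
      refine ⟨fun t => Φ (f t), Φ.continuous.comp_continuousOn f1, by simp only [f3], by simp only [f4], ?_⟩
      rw [hAR e u v (hadj e u v h) h, ← f5, image_image]
    · rintro e e' hne z ⟨u, v, h, e1, a, ha, rfl⟩ ⟨u', v', h', e2, a', ha', h3⟩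
      have h3 := Φ.injective h3
      subst h3
      have := E.arc_inter h h' (by rw [e1, e2]; exact fun h => hne (Subtype.ext h)) ⟨ha, ha'⟩
      rw [← e1, ← e2]
      simp only [mem_inter_iff, mem_insert_iff, mem_singleton_iff] at this
      obtain ⟨t1, t2⟩ := this
      rcases t1 with t1 | t1
      · refine ⟨u, by simp, ?_, by rw [t1]⟩
        rw [Sym2.mem_iff]
        rw [t1] at t2
        exact t2.imp (fun h => E.pos_inj h) (fun h => E.pos_inj h)
      · refine ⟨v, by simp, ?_, by rw [t1]⟩
        rw [Sym2.mem_iff]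
        rw [t1] at t2
        exact t2.imp (fun h => E.pos_inj h) (fun h => E.pos_inj h)
    · rintro e w ⟨u, v, h, e1, a, ha, h3⟩
      have h3 := Φ.injective h3
      subst h3
      rw [← e1, Sym2.mem_iff]
      exact E.pos_arc h w ha
  obtain ⟨r, K, X, T⟩ := TT.thick
  obtain ⟨δ, d0, d1, d2⟩ := T.delta
  choose m q hq using fun e => T.edgeChain TT.loop d0 e
  classical
  have ed : ∀ {u v : V} (h : G.Adj u v), ((⟨s(u, v), h⟩ : G.edgeSet) : Sym2 V) = s(u, v) := fun _ => rfl
  have esw : ∀ {u v : V} (h : G.Adj u v), (⟨s(v, u), h.symm⟩ : G.edgeSet) = ⟨s(u, v), h⟩ :=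
    fun _ => Subtype.ext Sym2.eq_swap
  let M : V → V → ℕ := fun u v => if h : G.Adj u v then m ⟨s(u, v), h⟩ else 0
  let Q : V → V → ℕ → ℂ := fun u v => if h : G.Adj u v then q ⟨s(u, v), h⟩ u else 0
  have hM : ∀ {u v : V} (h : G.Adj u v), M u v = m ⟨s(u, v), h⟩ := fun h => dif_pos h
  have hQ : ∀ {u v : V} (h : G.Adj u v), Q u v = q ⟨s(u, v), h⟩ u := fun h => dif_pos h
  have hM' : ∀ {u v : V} (h : G.Adj u v), M v u = m ⟨s(u, v), h⟩ := fun h => by rw [hM h.symm, esw h]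
  have hQ' : ∀ {u v : V} (h : G.Adj u v), Q v u = q ⟨s(u, v), h⟩ v := fun h => by rw [hQ h.symm, esw h]
  refine ⟨⟨fun v => Φ (E.pos v), M, Q, TT.inj, ?_, ?_, ?_, ?_, ?_, ?_, ?_⟩⟩
  · intro u v h
    rw [hM h]
    obtain ⟨h1, h2, -, -⟩ := hq _ u v (ed h)
    by_contra hlt
    have : m ⟨s(u, v), h⟩ = 0 := by omega
    rw [this, h1] at h2
    exact h.ne (TT.inj h2)
  · intro u v h; rw [hM h, hM' h]
  · intro u v h i hi
    rw [hM h] at hi ⊢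
    rw [hQ h, hQ' h]
    exact (hq _ u v (ed h)).2.2.1 i hi
  · intro u v h
    rw [hQ h]; exact (hq _ u v (ed h)).1
  · intro u v h i hi
    rw [hM h] at hi
    rw [hQ h]
    exact (hq _ u v (ed h)).2.2.2.ne i hi
  · intro u v h i j hij hj p h1 h2
    rw [hM h] at hj
    rw [hQ h] at h1 h2 ⊢
    exact (hq _ u v (ed h)).2.2.2.same hij hj h1 h2
  · intro u v u' v' h h' hne i hi j hj p h1 h2
    rw [hM h] at hi
    rw [hQ h] at h1
    rw [hM h'] at hj
    rw [hQ h'] at h2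
    have c := (hq _ u v (ed h)).2.2.2
    have c' := (hq _ u' v' (ed h')).2.2.2
    obtain ⟨w, w1, w2, w3⟩ := T.cross d1 d2 (e := ⟨s(u, v), h⟩) (e' := ⟨s(u', v'), h'⟩)
      (fun e => hne (Subtype.ext_iff.1 e)) (c.mem i hi.le) (c.mem (i + 1) hi) (c'.mem j hj.le)
      (c'.mem (j + 1) hj) (c.lt i hi) (c'.lt j hj) h1 h2
    exact ⟨w, Sym2.mem_iff.1 w1, Sym2.mem_iff.1 w2, w3⟩

end PA6_sec

/-- Every triconnected 4-planar graph is subhamiltonian. -/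
theorem triconnected_four_planar_subhamiltonian {V : Type u} [Fintype V]
    (G : SimpleGraph V) (h3 : G.IsTriconnected) (hplanar : G.IsPlanar)
    (hdeg : G.MaxDegreeLE 4) : G.IsSubhamiltonian := by
  obtain ⟨E⟩ := hplanar
  obtain ⟨P⟩ := exists_PL E
  refine rot_subham (noCut_of_tri h3) P.rot hdeg ?_
  have := h3.1
  rwa [Nat.card_eq_fintype_card] at this
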